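/- arXiv:1510.06663 — 2 statements merged into one kernel-verified Lean document; each statement's English description precedes it below -/
import Mathlib

section
/- Let h : ℝ² → ℝ² be an orientation preserving homeomorphism and let C ⊆ ℝ² be a continuum such that h⁻¹(C) ∪ C is acyclic. If there exists a point c ∈ C such that h⁻ⁱ(c) ∈ C for every positive integer i, or such that hⁱ(c) ∈ C for every positive integer i, then C contains a fixed point of h. -/
/-- A (planar) continuum: a compact connected subset of the plane
containing more than one point. -/
def IsContinuum (C : Set (ℝ × ℝ)) : Prop :=
  IsCompact C ∧ IsConnected C ∧ C.Nontrivial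

/-- A planar set is acyclic if its complement is connected
(it does not separate the plane). -/
def IsAcyclic (K : Set (ℝ × ℝ)) : Prop :=
  IsConnected Kᶜ

/-- A homeomorphism of the plane is isotopic to the identity if there is a
continuous family of homeomorphisms joining the identity to it. -/
def IsotopicToIdentity (h : (ℝ × ℝ) ≃ₜ (ℝ × ℝ)) : Prop :=
  ∃ F : ℝ → (ℝ × ℝ) → (ℝ × ℝ),
    Continuous (fun q : ℝ × (ℝ × ℝ) => F q.1 q.2) ∧
    (∀ t : ℝ, ∃ g : (ℝ × ℝ) ≃ₜ (ℝ × ℝ), ⇑g = F t) ∧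
    F 0 = id ∧ F 1 = ⇑h

section PlaneTopology

open Set Filter Topology Complex unitInterval

theorem exists_log_homotopy {A : Type*} [TopologicalSpace A] (H : I × A → ℂ)
    (hH : Continuous H) (hH0 : ∀ x, H x ≠ 0) (g : A → ℂ) (hg : Continuous g)
    (h0 : ∀ a, exp (g a) = H (0, a)) :
    ∃ L : I × A → ℂ, Continuous L ∧ (∀ x, exp (L x) = H x) ∧ ∀ a, L (0, a) = g a := by
  let H' : C(I × A, {z : ℂ // z ≠ 0}) := ⟨fun x => ⟨H x, hH0 x⟩, by fun_prop⟩
  have hz : ∀ a, H' (0, a) = (fun z : ℂ ↦ (⟨_, z.exp_ne_zero⟩ : {z : ℂ // z ≠ 0}))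
      ((⟨g, hg⟩ : C(A, ℂ)) a) := by
    intro a
    apply Subtype.ext
    exact (h0 a).symm
  refine ⟨Complex.isCoveringMap_exp.liftHomotopy H' ⟨g, hg⟩ hz, ContinuousMap.continuous _, ?_, ?_⟩
  · intro x
    have := congrFun (Complex.isCoveringMap_exp.liftHomotopy_lifts H' ⟨g, hg⟩ hz) x
    exact congrArg Subtype.val this
  · intro a
    exact Complex.isCoveringMap_exp.liftHomotopy_zero H' ⟨g, hg⟩ hz a

theorem Convex.exists_log {E : Type*} [AddCommGroup E] [Module ℝ E] [TopologicalSpace E]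
    [IsTopologicalAddGroup E] [ContinuousSMul ℝ E] {S : Set E} (hS : Convex ℝ S) {f : E → ℂ}
    (hf : ContinuousOn f S) (hf0 : ∀ z ∈ S, f z ≠ 0) :
    ∃ l : E → ℂ, ContinuousOn l S ∧ ∀ z ∈ S, exp (l z) = f z := by
  classical
  rcases S.eq_empty_or_nonempty with rfl | ⟨z₀, hz₀⟩
  · exact ⟨0, by simp, by simp⟩
  have hmem : ∀ x : I × S, z₀ + (x.1 : ℝ) • ((x.2 : E) - z₀) ∈ S := fun x =>
    hS.add_smul_sub_mem hz₀ x.2.2 x.1.2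
  obtain ⟨L, hL, hL1, -⟩ := exists_log_homotopy
    (fun x : I × S => f (z₀ + (x.1 : ℝ) • ((x.2 : E) - z₀)))
    (hf.comp_continuous (by fun_prop) hmem) (fun x => hf0 _ (hmem x))
    (fun _ => log (f z₀)) continuous_const (fun a => by simp [exp_log (hf0 _ hz₀)])
  refine ⟨fun z => if hz : z ∈ S then L (1, ⟨z, hz⟩) else 0, ?_, ?_⟩
  · rw [continuousOn_iff_continuous_domRestrict]
    convert hL.comp (f := fun z : S => ((1 : I), z)) (by fun_prop) using 1
    ext z
    simp
  · intro z hz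
    simp [hz, hL1]

/-- `φ` has a continuous logarithm whose total change is `d`. -/
def LogChange (φ : I → ℂ) (d : ℂ) : Prop :=
  ∃ l : I → ℂ, Continuous l ∧ (∀ t, exp (l t) = φ t) ∧ l 1 - l 0 = d

namespace LogChange

theorem exists_of_continuous {φ : I → ℂ} (hφ : Continuous φ) (h0 : ∀ t, φ t ≠ 0) :
    ∃ d, LogChange φ d := by
  obtain ⟨L, hL, hL1, -⟩ := exists_log_homotopy (A := Unit) (fun x => φ x.1)
    (by fun_prop) (fun x => h0 _) (fun _ => log (φ 0)) continuous_const (fun a => exp_log (h0 0))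
  exact ⟨_, fun t => L (t, ()), by fun_prop, fun t => hL1 _, rfl⟩

theorem _root_.eq_add_const_of_exp_eq {X : Type*} [TopologicalSpace X] {s : Set X}
    (hs : IsPreconnected s) {l m : X → ℂ} (hl : ContinuousOn l s) (hm : ContinuousOn m s)
    (h : ∀ x ∈ s, exp (l x) = exp (m x)) {x y : X} (hx : x ∈ s) (hy : y ∈ s) :
    l x - m x = l y - m y := by
  have hk : ∀ z ∈ s, ∃ n : ℤ, l z - m z = n * (2 * Real.pi * Complex.I) := fun z hz => by
    obtain ⟨n, hn⟩ := exp_eq_exp_iff_exists_int.1 (h z hz)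
    exact ⟨n, by rw [hn]; ring⟩
  have hc : ContinuousOn (fun z => (l z - m z).im / (2 * Real.pi)) s := by fun_prop
  have hpi := Real.pi_pos
  have hk' : ∀ z ∈ s, ∃ n : ℤ, (l z - m z).im / (2 * Real.pi) = n := fun z hz => by
    obtain ⟨n, hn⟩ := hk z hz
    refine ⟨n, ?_⟩
    rw [hn]
    simp
  have key : (l x - m x).im / (2 * Real.pi) = (l y - m y).im / (2 * Real.pi) := by
    refine hs.constant_of_mapsTo (T := range ((↑) : ℤ → ℝ))
      Int.isClosedEmbedding_coe_real.isInducing.isDiscrete_range hc ?_ hx hy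
    · intro z hz
      obtain ⟨n, hn⟩ := hk' z hz
      exact ⟨n, hn.symm⟩
  obtain ⟨n, hn⟩ := hk x hx
  obtain ⟨n', hn'⟩ := hk y hy
  rw [hn, hn'] at key
  simp at key
  rw [hn, hn']
  have : n = n' := by exact_mod_cast key
  rw [this]

theorem unique {φ : I → ℂ} {d d' : ℂ} (h : LogChange φ d) (h' : LogChange φ d') : d = d' := by
  obtain ⟨l, hl, hl1, rfl⟩ := h
  obtain ⟨m, hm, hm1, rfl⟩ := h'
  have := eq_add_const_of_exp_eq (isPreconnected_univ (α := I)) hl.continuousOn hm.continuousOn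
    (fun x _ => (hl1 x).trans (hm1 x).symm) (mem_univ 0) (mem_univ 1)
  linear_combination -this

theorem mul {φ ψ : I → ℂ} {d e : ℂ} (h : LogChange φ d) (h' : LogChange ψ e) :
    LogChange (fun t => φ t * ψ t) (d + e) := by
  obtain ⟨l, hl, hl1, rfl⟩ := h
  obtain ⟨m, hm, hm1, rfl⟩ := h'
  exact ⟨fun t => l t + m t, by fun_prop, fun t => by rw [exp_add, hl1, hm1], by ring⟩

theorem congr {φ ψ : I → ℂ} {d : ℂ} (h : LogChange φ d) (h' : ∀ t, φ t = ψ t) :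
    LogChange ψ d := by
  rwa [← funext h']

theorem of_slitPlane {φ : I → ℂ} (hφ : Continuous φ) (h : ∀ t, φ t ∈ slitPlane) :
    LogChange φ (log (φ 1) - log (φ 0)) :=
  ⟨fun t => log (φ t), hφ.clog h, fun t => exp_log (slitPlane_ne_zero (h t)), rfl⟩

theorem of_log {X : Type*} [TopologicalSpace X] {s : Set X} {f l : X → ℂ} (hl : ContinuousOn l s)
    (h : ∀ z ∈ s, exp (l z) = f z) {γ : I → X} (hγ : Continuous γ) (hγs : ∀ t, γ t ∈ s) :
    LogChange (fun t => f (γ t)) (l (γ 1) - l (γ 0)) :=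
  ⟨fun t => l (γ t), hl.comp_continuous hγ hγs, fun t => h _ (hγs t), rfl⟩

theorem exp_mul_eq {φ : I → ℂ} {d : ℂ} (h : LogChange φ d) : exp d * φ 0 = φ 1 := by
  obtain ⟨l, hl, hl1, rfl⟩ := h
  rw [← hl1 0, ← hl1 1, ← exp_add]
  ring_nf

theorem trans {X : Type*} [TopologicalSpace X] {f : X → ℂ} {a b c : X} {γ : Path a b}
    {γ' : Path b c} {d e : ℂ} (h : LogChange (fun t => f (γ t)) d)
    (h' : LogChange (fun t => f (γ' t)) e) :
    LogChange (fun t => f (γ.trans γ' t)) (d + e) := by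
  obtain ⟨l, hl, hl1, rfl⟩ := h
  obtain ⟨m, hm, hm1, rfl⟩ := h'
  have h01 : exp (l 1 - m 0) = 1 := by
    rw [exp_sub, hl1, hm1]
    have : f b ≠ 0 := by
      have := hm1 0
      dsimp only at this
      rw [γ'.source] at this
      rw [← this]; exact exp_ne_zero _
    simp [this]
  let P : Path (l 0) (l 1) := ⟨⟨l, hl⟩, rfl, rfl⟩
  let Q : Path (l 1) (m 1 + (l 1 - m 0)) :=
    ⟨⟨fun t => m t + (l 1 - m 0), by fun_prop⟩, by simp, by simp⟩
  refine ⟨P.trans Q, (P.trans Q).continuous, fun t => ?_, by simp; ring⟩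
  dsimp only
  rw [Path.trans_apply γ γ', Path.trans_apply P Q]
  split_ifs with ht
  · exact hl1 _
  · change exp (m _ + (l 1 - m 0)) = _
    rw [exp_add, h01, mul_one]
    exact hm1 _

end LogChange

theorem exists_int_antidifference (H : ℤ → ℂ) : ∃ G : ℤ → ℂ, ∀ n, G (n + 1) - G n = H n := by
  refine ⟨fun n => ∑ k ∈ Finset.Ico 0 n, H k - ∑ k ∈ Finset.Ico n 0, H k, fun n => ?_⟩
  rcases le_or_gt 0 n with hn | hn
  · dsimp only
    rw [← Finset.insert_Ico_right_eq_Ico_add_one hn, Finset.sum_insert (by simp),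
      Finset.Ico_eq_empty (by omega : ¬ n + 1 < 0), Finset.Ico_eq_empty (by omega : ¬ n < 0)]
    simp
  · dsimp only
    rw [Finset.Ico_eq_empty (by omega : ¬ 0 < n + 1), Finset.Ico_eq_empty (by omega : ¬ 0 < n),
      ← Finset.insert_Ico_add_one_left_eq_Ico (a := n) (b := 0) hn, Finset.sum_insert (by simp)]
    simp

theorem sum_Ico_int_sub (f : ℤ → ℂ) {m n : ℤ} (h : m ≤ n) :
    ∑ k ∈ Finset.Ico m n, (f (k + 1) - f k) = f n - f m := by
  induction n, h using Int.leInduction with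
  | base => simp
  | succ n hn ih =>
    rw [← Finset.insert_Ico_right_eq_Ico_add_one hn, Finset.sum_insert (by simp), ih]
    ring

/-- Discrete winding weight of a lattice loop about the unit square with lower left corner `p`. -/
def latticeWinding (x y : ℕ → ℤ) (N : ℕ) (p : ℤ × ℤ) : ℂ :=
  ∑ i ∈ Finset.range N, (if p.1 < x (i + 1) then 1 else 0) *
    ((if p.2 < y (i + 1) then 1 else 0) - (if p.2 < y i then 1 else 0))

theorem discrete_green (G K : ℤ → ℤ → ℂ) (x y : ℕ → ℤ) (N : ℕ) (M : ℤ)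
    (hx : x N = x 0) (hy : y N = y 0) (hxM : ∀ i ≤ N, |x i| ≤ M) (hyM : ∀ i ≤ N, |y i| ≤ M) :
    ∑ i ∈ Finset.range N, (G (x (i + 1)) (y i) - G (x i) (y i) +
      (K (x (i + 1)) (y (i + 1)) - K (x (i + 1)) (y i))) =
    ∑ p ∈ Finset.Ico (-M) M ×ˢ Finset.Ico (-M) M, latticeWinding x y N p *
      ((G (p.1 + 1) p.2 - G p.1 p.2) + (K (p.1 + 1) (p.2 + 1) - K (p.1 + 1) p.2)
        - (G (p.1 + 1) (p.2 + 1) - G p.1 (p.2 + 1)) - (K p.1 (p.2 + 1) - K p.1 p.2)) := by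
  set J : ℤ → ℤ → ℂ := fun a b => K a b - G a b with hJ
  set c : ℤ × ℤ → ℂ := fun p => ((G (p.1 + 1) p.2 - G p.1 p.2) +
    (K (p.1 + 1) (p.2 + 1) - K (p.1 + 1) p.2)
        - (G (p.1 + 1) (p.2 + 1) - G p.1 (p.2 + 1)) - (K p.1 (p.2 + 1) - K p.1 p.2)) with hc
  have hE : ∀ a b : ℤ, |a| ≤ M → |b| ≤ M →
      ∑ p ∈ Finset.Ico (-M) M ×ˢ Finset.Ico (-M) M,
        (if p.1 < a then 1 else 0) * (if p.2 < b then 1 else 0) * c p =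
      J a b - J (-M) b - J a (-M) + J (-M) (-M) := by
    intro a b ha hb
    rw [abs_le] at ha hb
    have hsub : Finset.Ico (-M) a ×ˢ Finset.Ico (-M) b ⊆
        Finset.Ico (-M) M ×ˢ Finset.Ico (-M) M :=
      Finset.product_subset_product (Finset.Ico_subset_Ico_right ha.2)
        (Finset.Ico_subset_Ico_right hb.2)
    rw [← Finset.sum_subset hsub]
    · rw [Finset.sum_product]
      have : ∀ i ∈ Finset.Ico (-M) a, ∑ j ∈ Finset.Ico (-M) b,
          (if (i, j).1 < a then (1 : ℂ) else 0) * (if (i, j).2 < b then 1 else 0) * c (i, j) =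
          (J (i + 1) b - J (i + 1) (-M)) - (J i b - J i (-M)) := by
        intro i hi
        rw [← sum_Ico_int_sub _ hb.1, ← sum_Ico_int_sub _ hb.1, ← Finset.sum_sub_distrib]
        refine Finset.sum_congr rfl fun j hj => ?_
        rw [Finset.mem_Ico] at hi hj
        simp only [hi.2, hj.2, if_true, hc, hJ]
        ring
      rw [Finset.sum_congr rfl this, sum_Ico_int_sub (fun i => J i b - J i (-M)) ha.1]
      ring
    · intro p hp hp'
      simp only [Finset.mem_product, Finset.mem_Ico] at hp hp'
      by_cases h1 : p.1 < a
      · by_cases h2 : p.2 < b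
        · exact absurd ⟨⟨hp.1.1, h1⟩, hp.2.1, h2⟩ hp'
        · simp [h2]
      · simp [h1]
  have h1 : ∀ i ∈ Finset.range N, (G (x (i + 1)) (y i) - G (x i) (y i) +
      (K (x (i + 1)) (y (i + 1)) - K (x (i + 1)) (y i))) =
      ∑ p ∈ Finset.Ico (-M) M ×ˢ Finset.Ico (-M) M,
        ((if p.1 < x (i + 1) then 1 else 0) *
    ((if p.2 < y (i + 1) then 1 else 0) - (if p.2 < y i then 1 else 0))) * c p +
      ((G (x (i + 1)) (y (i + 1)) + J (-M) (y (i + 1))) - (G (x i) (y i) + J (-M) (y i))) := by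
    intro i hi
    rw [Finset.mem_range] at hi
    simp only [mul_sub, sub_mul, Finset.sum_sub_distrib]
    rw [hE _ _ (hxM _ (by omega)) (hyM _ (by omega)), hE _ _ (hxM _ (by omega)) (hyM _ (by omega))]
    simp only [hJ]
    ring
  rw [Finset.sum_congr rfl h1, Finset.sum_add_distrib,
    Finset.sum_range_sub (fun i => G (x i) (y i) + J (-M) (y i)), hx, hy, sub_self, add_zero,
    Finset.sum_comm]
  simp only [latticeWinding, Finset.sum_mul, hc]

open Classical in
/-- Change of a logarithm of `f` along the segment from `u` to `v` (`0` if there is none). -/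
noncomputable def logDiff (f : ℂ → ℂ) (u v : ℂ) : ℂ :=
  if h : ∃ l : ℂ → ℂ, ContinuousOn l (segment ℝ u v) ∧ ∀ z ∈ segment ℝ u v, exp (l z) = f z
  then h.choose v - h.choose u else 0

theorem logDiff_eq {f l : ℂ → ℂ} {S : Set ℂ} {u v : ℂ} (hS : Convex ℝ S) (hl : ContinuousOn l S)
    (h : ∀ z ∈ S, exp (l z) = f z) (hu : u ∈ S) (hv : v ∈ S) : logDiff f u v = l v - l u := by
  have hsub := hS.segment_subset hu hv
  have hex : ∃ l : ℂ → ℂ, ContinuousOn l (segment ℝ u v) ∧ ∀ z ∈ segment ℝ u v, exp (l z) = f z :=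
    ⟨l, hl.mono hsub, fun z hz => h z (hsub hz)⟩
  rw [logDiff, dif_pos hex]
  have := eq_add_const_of_exp_eq (convex_segment u v).isPreconnected hex.choose_spec.1
    (hl.mono hsub) (fun z hz => (hex.choose_spec.2 z hz).trans (h z (hsub hz)).symm)
    (left_mem_segment ℝ u v) (right_mem_segment ℝ u v)
  linear_combination -this

theorem logDiff_sub {u c p q : ℂ} (hp : 0 < (u * (p - c)).re) (hq : 0 < (u * (q - c)).re) :
    logDiff (fun z => z - c) p q = log (u * (q - c)) - log (u * (p - c)) := by
  have hu : u ≠ 0 := by rintro rfl; simp at hp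
  rw [logDiff_eq (S := {z | 0 < (u * (z - c)).re}) (l := fun z => log (u * (z - c)) - log u)
    ?_ ?_ ?_ hp hq]
  · ring
  · have : {z : ℂ | 0 < (u * (z - c)).re} = {z : ℂ | u.re * z.re - u.im * z.im > (u * c).re} := by
      ext z; simp [mul_sub]
    rw [this]
    refine convex_halfSpace_gt ⟨fun x y => ?_, fun r x => ?_⟩ _ <;> simp <;> ring
  · refine ContinuousOn.sub (ContinuousOn.clog (by fun_prop) fun z hz => Or.inl hz) (by fun_prop)
  · intro z hz
    have : u * (z - c) ≠ 0 := by
      intro h; simp only [mem_ofPred_eq, h, zero_re, lt_irrefl] at hz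
    rw [exp_sub, exp_log this, exp_log hu]
    field_simp

/-- The point of the square lattice of mesh `ε` with integer coordinates `(a, b)`. -/
noncomputable def latticePt (ε : ℝ) (a b : ℤ) : ℂ := ⟨ε * a, ε * b⟩

/-- The change of `log f` around a lattice square. -/
noncomputable def logCurl (f : ℂ → ℂ) (ε : ℝ) (p : ℤ × ℤ) : ℂ :=
  logDiff f (latticePt ε p.1 p.2) (latticePt ε (p.1 + 1) p.2) +
    logDiff f (latticePt ε (p.1 + 1) p.2) (latticePt ε (p.1 + 1) (p.2 + 1)) -
    logDiff f (latticePt ε p.1 (p.2 + 1)) (latticePt ε (p.1 + 1) (p.2 + 1)) -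
    logDiff f (latticePt ε p.1 p.2) (latticePt ε p.1 (p.2 + 1))

/-- A closed square of the lattice of mesh `ε`. -/
def latticeSquare (ε : ℝ) (p : ℤ × ℤ) : Set ℂ :=
  Icc (ε * p.1) (ε * (p.1 + 1)) ×ℂ Icc (ε * p.2) (ε * (p.2 + 1))

theorem logCurl_eq_zero {f : ℂ → ℂ} {ε : ℝ} (hε : 0 < ε) {p : ℤ × ℤ}
    (hf : ContinuousOn f (latticeSquare ε p)) (h0 : ∀ z ∈ latticeSquare ε p, f z ≠ 0) :
    logCurl f ε p = 0 := by
  have hconv : Convex ℝ (latticeSquare ε p) :=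
    ((convex_Icc _ _).linear_preimage reLm).inter
      ((convex_Icc _ _).linear_preimage imLm)
  obtain ⟨l, hl, hl1⟩ := hconv.exists_log hf h0
  have hm : ∀ a b : ℤ, (a = p.1 ∨ a = p.1 + 1) → (b = p.2 ∨ b = p.2 + 1) →
      latticePt ε a b ∈ latticeSquare ε p := by
    rintro a b (rfl | rfl) (rfl | rfl) <;>
      simp only [latticePt, latticeSquare, mem_reProdIm, mem_Icc] <;> push_cast <;>
      refine ⟨⟨?_, ?_⟩, ?_, ?_⟩ <;> nlinarith
  simp only [logCurl]
  rw [logDiff_eq hconv hl hl1 (hm _ _ (by simp) (by simp)) (hm _ _ (by simp) (by simp)),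
    logDiff_eq hconv hl hl1 (hm _ _ (by simp) (by simp)) (hm _ _ (by simp) (by simp)),
    logDiff_eq hconv hl hl1 (hm _ _ (by simp) (by simp)) (hm _ _ (by simp) (by simp)),
    logDiff_eq hconv hl hl1 (hm _ _ (by simp) (by simp)) (hm _ _ (by simp) (by simp))]
  ring

theorem logCurl_center_ne_zero {ε : ℝ} (hε : 0 < ε) (p : ℤ × ℤ) :
    logCurl (fun z => z - ⟨ε * (p.1 + 1 / 2), ε * (p.2 + 1 / 2)⟩) ε p ≠ 0 := by
  set c : ℂ := ⟨ε * (p.1 + 1 / 2), ε * (p.2 + 1 / 2)⟩ with hc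
  set A : ℂ := ⟨ε / 2, ε / 2⟩ with hA
  set B : ℂ := ⟨ε / 2, -(ε / 2)⟩ with hB
  have h00 : latticePt ε p.1 p.2 - c = -A := by
    apply Complex.ext <;> simp [latticePt, hc, hA] <;> ring
  have h10 : latticePt ε (p.1 + 1) p.2 - c = B := by
    apply Complex.ext <;> simp [latticePt, hc, hB] <;> ring
  have h11 : latticePt ε (p.1 + 1) (p.2 + 1) - c = A := by
    apply Complex.ext <;> simp [latticePt, hc, hA] <;> ring
  have h01 : latticePt ε p.1 (p.2 + 1) - c = -B := by
    apply Complex.ext <;> simp [latticePt, hc, hB] <;> ring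
  have hIB : Complex.I * B = A := by apply Complex.ext <;> simp [hA, hB]
  have hIA : Complex.I * A = -B := by apply Complex.ext <;> simp [hA, hB]
  have hAre : 0 < A.re := by simp [hA, hε]
  have hBre : 0 < B.re := by simp [hB, hε]
  have hne : log A - log B ≠ 0 := by
    intro h
    have : A = B := by
      rw [← exp_log (x := A) (by intro h; simp [h] at hAre),
        ← exp_log (x := B) (by intro h; simp [h] at hBre), sub_eq_zero.1 h]
    have := congrArg Complex.im this
    simp [hA, hB] at this
    linarith
  simp only [logCurl]
  rw [logDiff_sub (u := Complex.I) (by rw [h00]; simpa [hIA] using hBre)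
      (by rw [h10, hIB]; exact hAre),
    logDiff_sub (u := 1) (by rw [h10]; simpa using hBre) (by rw [h11]; simpa using hAre),
    logDiff_sub (u := -Complex.I) (by rw [h01, neg_mul_neg, hIB]; exact hAre)
      (by rw [h11, neg_mul, hIA, neg_neg]; exact hBre),
    logDiff_sub (u := -1) (by rw [h00]; simpa using hAre) (by rw [h01]; simpa using hBre),
    h00, h10, h11, h01]
  rw [neg_mul_neg, neg_mul, mul_neg, hIB, hIA, one_mul, one_mul, neg_mul_neg, neg_mul_neg, one_mul,
    one_mul, neg_neg]
  intro h
  apply hne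
  linear_combination h / 4

theorem norm_lt_of_abs_re_im {z : ℂ} {r s t : ℝ} (hre : |z.re| ≤ r) (him : |z.im| ≤ s)
    (h : r + s < t) : ‖z‖ < t :=
  (norm_le_abs_re_add_abs_im z).trans_lt (by linarith)

theorem exists_winding_weights {γ : I → ℂ} (hloop : γ 1 = γ 0) {ε : ℝ}
    (hε : 0 < ε) {N : ℕ} (hN : 0 < N)
    (hNε : ∀ s t : I, |(s : ℝ) - t| ≤ 1 / N → ‖γ s - γ t‖ < ε) :
    ∃ (T : Finset (ℤ × ℤ)) (w : ℤ × ℤ → ℂ), ∀ (f : ℂ → ℂ) (U : Set ℂ) (d : ℂ),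
      ContinuousOn f U → (∀ z ∈ U, f z ≠ 0) → (∀ t, Metric.ball (γ t) (5 * ε) ⊆ U) →
      Continuous γ → LogChange (fun t => f (γ t)) d → d = ∑ p ∈ T, w p * logCurl f ε p := by
  have hN' : (0 : ℝ) < N := by exact_mod_cast hN
  set τ : ℕ → I := fun i => projIcc (0 : ℝ) 1 zero_le_one (i / N) with hτ
  have hτ0 : τ 0 = 0 := by simp [hτ]
  have hτN : τ N = 1 := by simp [hτ, div_self hN'.ne']
  have hτmono : ∀ i, τ i ≤ τ (i + 1) := fun i => monotone_projIcc _ (by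
    push_cast
    gcongr
    linarith)
  have hτstep : ∀ i, |(τ (i + 1) : ℝ) - τ i| ≤ 1 / N := fun i => by
    refine (abs_projIcc_sub_projIcc (zero_le_one' ℝ)).trans ?_
    rw [show ((i + 1 : ℕ) : ℝ) / N - i / N = 1 / N by push_cast; ring,
      abs_of_nonneg (by positivity)]
  set x : ℕ → ℤ := fun i => ⌊(γ (τ i)).re / ε⌋ with hx
  set y : ℕ → ℤ := fun i => ⌊(γ (τ i)).im / ε⌋ with hy
  set M : ℤ := ∑ i ∈ Finset.range (N + 1), (|x i| + |y i|) with hM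
  have hMi : ∀ i ≤ N, |x i| + |y i| ≤ M := fun i hi =>
    Finset.single_le_sum (f := fun i => |x i| + |y i|) (fun i _ => by positivity)
      (Finset.mem_range.2 (by omega))
  have hxb : ∀ i, ε * x i ≤ (γ (τ i)).re ∧ (γ (τ i)).re < ε * x i + ε := fun i => by
    have h1 := Int.floor_le ((γ (τ i)).re / ε)
    have h2 := Int.lt_floor_add_one ((γ (τ i)).re / ε)
    rw [le_div_iff₀ hε] at h1
    rw [div_lt_iff₀ hε] at h2
    constructor <;> simp only [hx] <;> linarith
  have hyb : ∀ i, ε * y i ≤ (γ (τ i)).im ∧ (γ (τ i)).im < ε * y i + ε := fun i => by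
    have h1 := Int.floor_le ((γ (τ i)).im / ε)
    have h2 := Int.lt_floor_add_one ((γ (τ i)).im / ε)
    rw [le_div_iff₀ hε] at h1
    rw [div_lt_iff₀ hε] at h2
    constructor <;> simp only [hy] <;> linarith
  have hclose : ∀ i, |(γ (τ (i + 1))).re - (γ (τ i)).re| < ε ∧
      |(γ (τ (i + 1))).im - (γ (τ i)).im| < ε := fun i =>
    ⟨(abs_re_le_norm (γ (τ (i + 1)) - γ (τ i))).trans_lt (hNε _ _ (hτstep i)),
      (abs_im_le_norm (γ (τ (i + 1)) - γ (τ i))).trans_lt (hNε _ _ (hτstep i))⟩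
  have hxs : ∀ i, |x (i + 1) - x i| ≤ 1 := fun i => by
    have h1 := abs_lt.1 (hclose i).1
    have h2 := hxb i
    have h3 := hxb (i + 1)
    have h4 : ((x (i + 1) : ℝ) - x i) < 2 := by nlinarith
    have h5 : -2 < ((x (i + 1) : ℝ) - x i) := by nlinarith
    have h4' : x (i + 1) - x i < 2 := by exact_mod_cast h4
    have h5' : -2 < x (i + 1) - x i := by exact_mod_cast h5
    rw [abs_le]; omega
  have hys : ∀ i, |y (i + 1) - y i| ≤ 1 := fun i => by
    have h1 := abs_lt.1 (hclose i).2
    have h2 := hyb i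
    have h3 := hyb (i + 1)
    have h4 : ((y (i + 1) : ℝ) - y i) < 2 := by nlinarith
    have h5 : -2 < ((y (i + 1) : ℝ) - y i) := by nlinarith
    have h4' : y (i + 1) - y i < 2 := by exact_mod_cast h4
    have h5' : -2 < y (i + 1) - y i := by exact_mod_cast h5
    rw [abs_le]; omega
  have hP : ∀ i a b, (a = x i ∨ a = x (i + 1)) → (b = y i ∨ b = y (i + 1)) →
      latticePt ε a b ∈ Metric.ball (γ (τ i)) (5 * ε) := fun i a b ha hb => by
    rw [mem_ball_iff_norm]
    have h1 := abs_lt.1 (hclose i).1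
    have h1' := abs_lt.1 (hclose i).2
    have h2 := hxb i
    have h3 := hxb (i + 1)
    have h4 := hyb i
    have h5 := hyb (i + 1)
    refine norm_lt_of_abs_re_im (r := 2 * ε) (s := 2 * ε) ?_ ?_ ?_
    · rcases ha with rfl | rfl <;> simp only [latticePt, sub_re, abs_le] <;>
        constructor <;> linarith
    · rcases hb with rfl | rfl <;> simp only [latticePt, sub_im, abs_le] <;>
        constructor <;> linarith
    · linarith
  refine ⟨Finset.Ico (-M) M ×ˢ Finset.Ico (-M) M, latticeWinding x y N, ?_⟩
  intro f U d hf hf0 hball hγ ⟨L, hL, hL1, hd⟩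
  choose G hG using fun b => exists_int_antidifference
    (fun a => logDiff f (latticePt ε a b) (latticePt ε (a + 1) b))
  choose K hK using fun a => exists_int_antidifference
    (fun b => logDiff f (latticePt ε a b) (latticePt ε a (b + 1)))
  have hGl : ∀ {B : Set ℂ} {l : ℂ → ℂ}, Convex ℝ B → ContinuousOn l B →
      (∀ z ∈ B, exp (l z) = f z) → ∀ {a a' b : ℤ}, |a' - a| ≤ 1 → latticePt ε a b ∈ B →
      latticePt ε a' b ∈ B → G b a' - G b a = l (latticePt ε a' b) - l (latticePt ε a b) := by
    intro B l hB hl hl1 a a' b haa ha ha'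
    obtain h | rfl | h : a' = a + 1 ∨ a' = a ∨ a = a' + 1 := by rw [abs_le] at haa; omega
    · subst h
      rw [hG, logDiff_eq hB hl hl1 ha ha']
    · simp
    · subst h
      have := hG b a'
      rw [logDiff_eq hB hl hl1 ha' ha] at this
      linear_combination -this
  have hKl : ∀ {B : Set ℂ} {l : ℂ → ℂ}, Convex ℝ B → ContinuousOn l B →
      (∀ z ∈ B, exp (l z) = f z) → ∀ {a b b' : ℤ}, |b' - b| ≤ 1 → latticePt ε a b ∈ B →
      latticePt ε a b' ∈ B → K a b' - K a b = l (latticePt ε a b') - l (latticePt ε a b) := by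
    intro B l hB hl hl1 a b b' haa ha ha'
    obtain h | rfl | h : b' = b + 1 ∨ b' = b ∨ b = b' + 1 := by rw [abs_le] at haa; omega
    · subst h
      rw [hK, logDiff_eq hB hl hl1 ha ha']
    · simp
    · subst h
      have := hK a b'
      rw [logDiff_eq hB hl hl1 ha' ha] at this
      linear_combination -this
  have hgreen := discrete_green (fun a b => G b a) K x y N M (by simp only [hx, hτN, hτ0, hloop])
    (by simp only [hy, hτN, hτ0, hloop])
    (fun i hi => by have := hMi i hi; have := abs_nonneg (y i); omega)
    (fun i hi => by have := hMi i hi; have := abs_nonneg (x i); omega)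
  simp only [hG, hK] at hgreen
  simp only [logCurl]
  rw [← hgreen, ← hd]
  set c : ℕ → ℂ := fun i => logDiff f (latticePt ε (x i) (y i)) (γ (τ i)) with hc
  have hstep : ∀ i ∈ Finset.range N, (G (y i) (x (i + 1)) - G (y i) (x i) +
      (K (x (i + 1)) (y (i + 1)) - K (x (i + 1)) (y i))) =
      (L (τ (i + 1)) - c (i + 1)) - (L (τ i) - c i) := by
    intro i hi
    have hB := convex_ball (γ (τ i)) (5 * ε)
    obtain ⟨l, hl, hl1⟩ := hB.exists_log (hf.mono (hball (τ i))) fun z hz => hf0 z (hball _ hz)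
    have h1 := hP i (x i) (y i) (by simp) (by simp)
    have h2 := hP i (x (i + 1)) (y i) (by simp) (by simp)
    have h3 := hP i (x (i + 1)) (y (i + 1)) (by simp) (by simp)
    have hmem : ∀ t ∈ Icc (τ i) (τ (i + 1)), γ t ∈ Metric.ball (γ (τ i)) (5 * ε) := by
      intro t ht
      rw [mem_ball_iff_norm]
      refine (hNε _ _ ?_).trans_le (by linarith)
      have h1 : (τ i : ℝ) ≤ t := ht.1
      have h2 : (t : ℝ) ≤ τ (i + 1) := ht.2
      refine le_trans ?_ (hτstep i)
      rw [abs_of_nonneg (by linarith), abs_of_nonneg (by linarith)]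
      linarith
    have h4 := hmem _ (left_mem_Icc.2 (hτmono i))
    have h5 := hmem _ (right_mem_Icc.2 (hτmono i))
    rw [hGl hB hl hl1 (hxs i) h1 h2, hKl hB hl hl1 (hys i) h2 h3]
    have := eq_add_const_of_exp_eq (l := L) (m := fun t => l (γ t))
      (isPreconnected_Icc (a := τ i) (b := τ (i + 1)))
      hL.continuousOn (hl.comp hγ.continuousOn hmem)
      (fun t ht => (hL1 t).trans (hl1 _ (hmem t ht)).symm)
      (left_mem_Icc.2 (hτmono i)) (right_mem_Icc.2 (hτmono i))
    simp only [hc]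
    rw [logDiff_eq hB hl hl1 h1 h4, logDiff_eq hB hl hl1 h3 h5]
    linear_combination this
  rw [Finset.sum_congr rfl hstep, Finset.sum_range_sub (fun i => L (τ i) - c i)]
  simp only [hc, hx, hy, hτN, hτ0, hloop]
  ring

/-- A loop in an open set having winding number `0` about every point of the complement has
winding number `0` with respect to every continuous nonvanishing function on the set. -/
theorem logChange_eq_zero_of_winding {U : Set ℂ} (hU : IsOpen U) {γ : I → ℂ} (hγ : Continuous γ)
    (hloop : γ 1 = γ 0) (hγU : ∀ t, γ t ∈ U) (hw : ∀ p ∉ U, LogChange (fun t => γ t - p) 0)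
    {f : ℂ → ℂ} (hf : ContinuousOn f U) (hf0 : ∀ z ∈ U, f z ≠ 0) :
    LogChange (fun t => f (γ t)) 0 := by
  obtain ⟨d, hd⟩ := LogChange.exists_of_continuous (hf.comp_continuous hγ hγU)
    (fun t => hf0 _ (hγU t))
  obtain ⟨ρ, hρ, hρU⟩ := (isCompact_range hγ).exists_thickening_subset_open hU
    (range_subset_iff.2 hγU)
  set ε := ρ / 8 with hερ
  have hε : 0 < ε := by positivity
  have hball8 : ∀ t, Metric.ball (γ t) (8 * ε) ⊆ U := fun t => by
    refine Subset.trans ?_ hρU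
    rw [show 8 * ε = ρ by rw [hερ]; ring]
    exact Metric.ball_subset_thickening (mem_range_self t) ρ
  obtain ⟨δ, hδ, hδε⟩ := Metric.uniformContinuous_iff.1
    (CompactSpace.uniformContinuous_of_continuous hγ) ε hε
  obtain ⟨N, hN⟩ := exists_nat_one_div_lt hδ
  obtain ⟨T, w, hT⟩ := exists_winding_weights hloop hε (Nat.succ_pos N) fun s t hst => by
    rw [← dist_eq_norm]
    refine hδε (lt_of_le_of_lt ?_ hN)
    rw [Subtype.dist_eq, Real.dist_eq]
    exact_mod_cast hst
  have h0 : d = 0 := by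
    rw [hT f U d hf hf0 (fun t => (Metric.ball_subset_ball (by linarith)).trans (hball8 t)) hγ hd]
    refine Finset.sum_eq_zero fun q hq => ?_
    by_cases hsq : latticeSquare ε q ⊆ U
    · rw [logCurl_eq_zero hε (hf.mono hsq) fun z hz => hf0 z (hsq hz), mul_zero]
    obtain ⟨p, hpq, hpU⟩ := not_subset.1 hsq
    set c : ℂ := ⟨ε * (q.1 + 1 / 2), ε * (q.2 + 1 / 2)⟩ with hc
    have hpc : ‖p - c‖ < 2 * ε := by
      obtain ⟨h1, h2⟩ := mem_reProdIm.1 hpq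
      refine norm_lt_of_abs_re_im (r := ε / 2) (s := ε / 2) ?_ ?_ (by linarith) <;>
        rw [mem_Icc] at h1 h2 <;> simp only [hc, sub_re, sub_im, abs_le] <;>
        constructor <;> linarith
    have hγp : ∀ t, 8 * ε ≤ ‖γ t - p‖ := fun t => by
      by_contra! h
      exact hpU (hball8 t (by rwa [mem_ball_iff_norm']))
    have hγp0 : ∀ t, γ t - p ≠ 0 := fun t h => by
      have := hγp t
      rw [h, norm_zero] at this
      linarith
    have hγc : ∀ t, 6 * ε < ‖γ t - c‖ := fun t => by
      have := norm_sub_le (γ t - c) (p - c)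
      have := hγp t
      rw [show γ t - c - (p - c) = γ t - p by ring] at *
      linarith
    have hwc : LogChange (fun t => γ t - c) 0 := by
      have h1 : LogChange (fun t => (γ t - c) / (γ t - p)) _ :=
        LogChange.of_slitPlane (Continuous.div (by fun_prop) (by fun_prop) hγp0) fun t => by
          refine ball_one_subset_slitPlane ?_
          rw [mem_ball_iff_norm, show (γ t - c) / (γ t - p) - 1 = (p - c) / (γ t - p) by
            rw [div_sub_one (hγp0 t)]; ring, norm_div, div_lt_one (norm_pos_iff.2 (hγp0 t))]
          linarith [hγp t]
      have h2 := (h1.mul (hw p hpU)).congr (ψ := fun t => γ t - c) fun t =>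
        div_mul_cancel₀ _ (hγp0 t)
      rwa [hloop, sub_self, zero_add] at h2
    have hsum := hT (fun z => z - c) {c}ᶜ 0 (by fun_prop)
      (fun z hz => sub_ne_zero.2 hz) (fun t z hz hzc => by
        rw [mem_singleton_iff.1 hzc, mem_ball_iff_norm'] at hz
        linarith [hγc t]) hγ hwc
    rw [Finset.sum_eq_single q] at hsum
    · rw [(mul_eq_zero.1 hsum.symm).resolve_right (logCurl_center_ne_zero hε q), zero_mul]
    · intro r _ hrq
      rw [logCurl_eq_zero hε (by fun_prop) fun z hz h => ?_, mul_zero]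
      obtain rfl := sub_eq_zero.1 h
      apply hrq
      obtain ⟨⟨h1, h2⟩, h3, h4⟩ := mem_reProdIm.1 hz
      simp only [hc] at h1 h2 h3 h4
      rw [mul_le_mul_iff_right₀ hε] at h1 h2 h3 h4
      have a1 : (r.1 : ℝ) < q.1 + 1 := by linarith
      have a2 : (q.1 : ℝ) < r.1 + 1 := by linarith
      have a3 : (r.2 : ℝ) < q.2 + 1 := by linarith
      have a4 : (q.2 : ℝ) < r.2 + 1 := by linarith
      have b1 : r.1 < q.1 + 1 := by exact_mod_cast a1
      have b2 : q.1 < r.1 + 1 := by exact_mod_cast a2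
      have b3 : r.2 < q.2 + 1 := by exact_mod_cast a3
      have b4 : q.2 < r.2 + 1 := by exact_mod_cast a4
      ext <;> omega
    · intro h; exact absurd hq h
  rwa [h0] at hd

theorem LogChange.neg {φ : I → ℂ} {d : ℂ} (h : LogChange φ d) : LogChange (fun t => -φ t) d := by
  obtain ⟨l, hl, hl1, rfl⟩ := h
  exact ⟨fun t => l t + Real.pi * Complex.I, by fun_prop,
    fun t => by rw [exp_add, exp_pi_mul_I, hl1]; ring, by ring⟩

/-- `h` can be joined to the identity through continuous injections of the plane. -/
def PlaneIsotopic (h : ℂ ≃ₜ ℂ) : Prop :=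
  ∃ F : I → ℂ → ℂ, Continuous (fun q : I × ℂ => F q.1 q.2) ∧ (∀ t, Function.Injective (F t)) ∧
    (∀ z, F 0 z = z) ∧ ∀ z, F 1 z = h z

namespace PlaneIsotopic

theorem trans {g h : ℂ ≃ₜ ℂ} (hg : PlaneIsotopic g) (hh : PlaneIsotopic h) :
    PlaneIsotopic (g.trans h) := by
  obtain ⟨F, hF, hFi, hF0, hF1⟩ := hg
  obtain ⟨G, hG, hGi, hG0, hG1⟩ := hh
  refine ⟨fun t z => G t (F t z), hG.comp (continuous_fst.prodMk hF),
    fun t => (hGi t).comp (hFi t), fun z => by simp [hF0, hG0], fun z => by simp [hF1, hG1]⟩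

theorem exists_slope_log {h : ℂ ≃ₜ ℂ} (hh : PlaneIsotopic h) : ∃ Θ : ℂ × ℂ → ℂ,
    ContinuousOn Θ {x | x.1 ≠ x.2} ∧
    (∀ p q, p ≠ q → exp (Θ (p, q)) = (h q - h p) / (q - p)) ∧
    ∀ p q, p ≠ q → Θ (p, q) = Θ (q, p) := by
  classical
  obtain ⟨F, hF, hFi, hF0, hF1⟩ := hh
  have hA : ∀ x : {x : ℂ × ℂ | x.1 ≠ x.2}, x.1.2 - x.1.1 ≠ 0 := fun x => sub_ne_zero.2 x.2.symm
  have hc1 : Continuous fun x : I × {x : ℂ × ℂ | x.1 ≠ x.2} => F x.1 x.2.1.1 :=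
    hF.comp (continuous_fst.prodMk (by fun_prop))
  have hc2 : Continuous fun x : I × {x : ℂ × ℂ | x.1 ≠ x.2} => F x.1 x.2.1.2 :=
    hF.comp (continuous_fst.prodMk (by fun_prop))
  obtain ⟨L, hL, hL1, hL0⟩ := exists_log_homotopy (A := {x : ℂ × ℂ | x.1 ≠ x.2})
    (fun x => (F x.1 x.2.1.2 - F x.1 x.2.1.1) / (x.2.1.2 - x.2.1.1))
    ((hc2.sub hc1).div (by fun_prop) fun x => hA x.2)
    (fun x => div_ne_zero (sub_ne_zero.2 fun h => x.2.2 (hFi _ h).symm) (hA _))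
    (fun _ => 0) continuous_const (fun a => by simp [hF0, div_self (hA a)])
  refine ⟨fun x => if hx : x.1 ≠ x.2 then L (1, ⟨x, hx⟩) else 0, ?_, ?_, ?_⟩
  · rw [continuousOn_iff_continuous_domRestrict]
    convert hL.comp (f := fun z : {x : ℂ × ℂ | x.1 ≠ x.2} => ((1 : I), z)) (by fun_prop) using 1
    ext z
    have := z.2
    simp only [ne_eq, mem_ofPred_eq] at this
    simp [this]
  · intro p q hpq
    simp [hpq, hL1, hF1]
  · intro p q hpq
    have := eq_add_const_of_exp_eq (isPreconnected_univ (α := I))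
      (l := fun t => L (t, ⟨(p, q), hpq⟩)) (m := fun t => L (t, ⟨(q, p), hpq.symm⟩))
      (by fun_prop) (by fun_prop) (fun t _ => by
        simp only [hL1]
        rw [← neg_sub, ← neg_sub p q, neg_div_neg_eq]) (mem_univ 1) (mem_univ 0)
    simp only [hL0, sub_self] at this
    simp [hpq, hpq.symm, sub_eq_zero.1 this]

/-- The loop from `a` through `h a` and `h (h a)` back to `a`. -/
noncomputable def orbitLoop (h : ℂ ≃ₜ ℂ) {a : ℂ} (α : Path a (h a)) (κ : Path (h (h a)) a) :
    Path a a :=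
  (α.trans (α.map h.continuous)).trans κ

theorem not_logChange_orbitLoop {h : ℂ ≃ₜ ℂ} (hh : PlaneIsotopic h) {a : ℂ} {α : Path a (h a)}
    (hα : ∀ t, h (α t) ≠ α t) {κ : Path (h (h a)) a} (hκ : ∀ s t, h (κ s) ≠ κ t) :
    ¬ LogChange (fun t => h (orbitLoop h α κ t) - orbitLoop h α κ t) 0 := by
  intro h0
  obtain ⟨Θ, hΘ, hΘe, hΘs⟩ := hh.exists_slope_log
  have hne : a ≠ h a := fun e => hα 0 (by simp [← e])
  obtain ⟨d, hd⟩ := LogChange.exists_of_continuous (φ := fun t => h (α t) - α t) (by fun_prop)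
    fun t => sub_ne_zero.2 (hα t)
  have hd2 : LogChange (fun t => h (h (α t)) - h (α t)) (d + (Θ (h a, h (h a)) - Θ (a, h a))) := by
    have := LogChange.of_log hΘ (f := fun x => exp (Θ x)) (fun _ _ => rfl)
      (γ := fun t => (α t, h (α t))) (by fun_prop) fun t => (hα t).symm
    simp only [Path.source, Path.target] at this
    refine (hd.mul this).congr fun t => ?_
    have := sub_ne_zero.2 (hα t)
    rw [hΘe _ _ (hα t).symm]
    field_simp
  obtain ⟨e, l, hl, hl1, -⟩ := LogChange.exists_of_continuous (φ := fun t => h (κ 0) - κ t)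
    (by fun_prop) fun t => sub_ne_zero.2 (hκ 0 t)
  obtain ⟨m, hm, hm1, -⟩ := exists_log_homotopy (A := I) (fun x => h (κ x.1) - κ x.2)
    (by fun_prop) (fun x => sub_ne_zero.2 (hκ _ _)) l hl hl1
  have hμ : LogChange (fun t => h a - κ t) (m (1, 1) - m (1, 0)) :=
    ⟨fun t => m (1, t), by fun_prop, fun t => by simp [hm1], rfl⟩
  have hB : LogChange (fun t => h (κ t) - h (h a)) (m (1, 0) - m (0, 0)) :=
    ⟨fun t => m (t, 0), by fun_prop, fun t => by simp [hm1], rfl⟩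
  have hC : LogChange (fun t => h (κ t) - κ t) (m (1, 1) - m (0, 0)) :=
    ⟨fun t => m (t, t), by fun_prop, fun t => by simp [hm1], rfl⟩
  have hκa : ∀ t, h a ≠ κ t := fun t => by simpa using hκ 1 t
  have hB' : LogChange (fun t => h (κ t) - h (h a))
      (m (1, 1) - m (1, 0) + (Θ (h a, a) - Θ (h a, h (h a)))) := by
    have := LogChange.of_log hΘ (f := fun x => exp (Θ x)) (fun _ _ => rfl)
      (γ := fun t => (h a, κ t)) (by fun_prop) hκa
    simp only [Path.source, Path.target] at this
    refine (hμ.mul this).neg.congr fun t => ?_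
    have := sub_ne_zero.2 (hκa t).symm
    rw [hΘe _ _ (hκa t)]
    field_simp
    ring
  have hBB := hB.unique hB'
  have htot := (((hd.trans (f := fun z => h z - z) (γ' := α.map h.continuous) hd2).trans
    (f := fun z => h z - z) hC)).unique h0
  rw [hΘs _ _ hne] at htot
  have hsum : d + (m (1, 1) - m (1, 0)) = 0 := by
    linear_combination (1 / 2) * htot - (1 / 2) * hBB
  have e1 := hd.exp_mul_eq
  have e2 := hμ.exp_mul_eq
  simp only [Path.source, Path.target] at e1 e2
  have e3 : exp d * exp (m (1, 1) - m (1, 0)) = 1 := by rw [← exp_add, hsum, exp_zero]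
  have e4 : h a - a ≠ 0 := sub_ne_zero.2 hne.symm
  have e5 : exp d * exp (m (1, 1) - m (1, 0)) * (h a - a) = -(h a - a) := by
    linear_combination (exp (m (1, 1) - m (1, 0))) * e1 - e2
  rw [e3, one_mul] at e5
  exact e4 (self_eq_neg.1 e5)

theorem exists_local_drag {c v : ℂ} {r : ℝ} (hv : ‖v‖ < r) :
    ∃ ψ : ℂ ≃ₜ ℂ, PlaneIsotopic ψ ∧ (∀ z ∉ Metric.ball c r, ψ z = z) ∧ ψ c = c + v := by
  have hr : 0 < r := (norm_nonneg v).trans_lt hv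
  set φ : ℂ → ℝ := fun x => max 0 (1 - ‖x - c‖ / r) with hφ
  have hφc : Continuous φ := by fun_prop
  have hφl : ∀ x y, |φ x - φ y| ≤ ‖x - y‖ / r := fun x y => by
    refine (abs_max_sub_max_le_max _ _ _ _).trans ?_
    rw [sub_self, abs_zero, max_eq_right (abs_nonneg _)]
    rw [show 1 - ‖x - c‖ / r - (1 - ‖y - c‖ / r) = (‖y - c‖ - ‖x - c‖) / r by ring, abs_div,
      abs_of_pos hr]
    gcongr
    refine (abs_norm_sub_norm_le _ _).trans ?_
    rw [sub_sub_sub_cancel_right, norm_sub_rev]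
  have hdiff : ∀ (s : ℝ), 0 ≤ s → s ≤ 1 → ∀ x y : ℂ,
      ‖(x + (s * φ x) • v) - (y + (s * φ y) • v) - (x - y)‖ ≤ ‖v‖ / r * ‖x - y‖ := by
    intro s hs0 hs1 x y
    rw [show (x + (s * φ x) • v) - (y + (s * φ y) • v) - (x - y) = (s * (φ x - φ y)) • v by
      simp only [real_smul]; push_cast; ring, norm_smul, norm_mul, Real.norm_eq_abs,
      Real.norm_eq_abs, abs_of_nonneg hs0]
    calc s * |φ x - φ y| * ‖v‖ ≤ 1 * (‖x - y‖ / r) * ‖v‖ := by gcongr; exact hφl x y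
      _ = _ := by ring
  have hvr : ‖v‖ / r < 1 := (div_lt_one hr).2 hv
  have happ : ApproximatesLinearOn (fun x => x + (1 * φ x) • v)
      ((ContinuousLinearEquiv.refl ℝ ℂ : ℂ ≃L[ℝ] ℂ) : ℂ →L[ℝ] ℂ) univ (‖v‖ / r).toNNReal := by
    intro x _ y _
    rw [Real.coe_toNNReal _ (by positivity)]
    simpa using hdiff 1 zero_le_one le_rfl x y
  let ψ := happ.toHomeomorph _ (Or.inr (by
    rw [← NNReal.coe_lt_coe, Real.coe_toNNReal _ (by positivity)]
    simpa using hvr))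
  have hψ : ∀ z, ψ z = z + (1 * φ z) • v := fun z => rfl
  refine ⟨ψ, ⟨fun t z => z + ((t : ℝ) * φ z) • v, by fun_prop, fun t x y hxy => ?_,
    fun z => by simp, fun z => by simp [hψ]⟩, fun z hz => ?_, by simp [hψ, hφ]⟩
  · by_contra hne
    have h1 := hdiff t t.2.1 t.2.2 x y
    dsimp only at hxy
    rw [hxy, sub_self, zero_sub, norm_neg] at h1
    have : 0 < ‖x - y‖ := norm_pos_iff.2 (sub_ne_zero.2 hne)
    nlinarith
  · rw [mem_ball_iff_norm, not_lt] at hz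
    have : φ z = 0 := by
      simp only [hφ]
      rw [max_eq_left]
      rw [sub_nonpos, one_le_div hr]
      exact hz
    simp [hψ, this]

theorem exists_drag {E : Set ℂ} (hE : IsOpen E) (hE' : IsPreconnected E) {p q : ℂ} (hp : p ∈ E)
    (hq : q ∈ E) : ∃ ψ : ℂ ≃ₜ ℂ, PlaneIsotopic ψ ∧ (∀ z ∉ E, ψ z = z) ∧ ψ p = q := by
  refine hE'.induction₂' (fun p q => ∃ ψ : ℂ ≃ₜ ℂ, PlaneIsotopic ψ ∧ (∀ z ∉ E, ψ z = z) ∧ ψ p = q)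
    ?_ ?_ hp hq
  · intro x hx
    obtain ⟨r, hr, hrE⟩ := Metric.isOpen_iff.1 hE x hx
    filter_upwards [mem_nhdsWithin_of_mem_nhds (Metric.ball_mem_nhds x (half_pos hr))] with y hy
    rw [mem_ball_iff_norm] at hy
    constructor
    · obtain ⟨ψ, h1, h2, h3⟩ := exists_local_drag (c := x) (v := y - x) (r := r / 2) hy
      exact ⟨ψ, h1, fun z hz => h2 z fun hz' =>
        hz (hrE (Metric.ball_subset_ball (by linarith) hz')), by rw [h3]; ring⟩
    · obtain ⟨ψ, h1, h2, h3⟩ := exists_local_drag (c := y) (v := x - y) (r := r / 2)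
        (by rwa [norm_sub_rev])
      refine ⟨ψ, h1, fun z hz => h2 z fun hz' => hz (hrE ?_), by rw [h3]; ring⟩
      rw [mem_ball_iff_norm] at hz' ⊢
      calc ‖z - x‖ = ‖(z - y) + (y - x)‖ := by ring_nf
        _ ≤ _ := norm_add_le _ _
        _ < r := by linarith
  · rintro x y z - - - ⟨ψ, h1, h2, h3⟩ ⟨ψ', h1', h2', h3'⟩
    exact ⟨ψ.trans ψ', h1.trans h1', fun w hw => by simp [h2 w hw, h2' w hw], by simp [h3, h3']⟩

end PlaneIsotopic

/-- Every continuous nonvanishing function on `D` has a continuous logarithm. -/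
def HasLogs (D : Set ℂ) : Prop :=
  ∀ f : ℂ → ℂ, ContinuousOn f D → (∀ z ∈ D, f z ≠ 0) →
    ∃ l : ℂ → ℂ, ContinuousOn l D ∧ ∀ z ∈ D, exp (l z) = f z

/-- `h` is isotopic to the identity and fixed point free on the simply connected domain `D`, and
maps the domain `V ⊆ D` into `D`. -/
structure FixedPointFree (h : ℂ ≃ₜ ℂ) (D V : Set ℂ) : Prop where
  isotopic : PlaneIsotopic h
  isOpen : IsOpen D
  isPreconnected : IsPreconnected D
  hasLogs : HasLogs D
  ne : ∀ z ∈ D, h z ≠ z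
  isOpen' : IsOpen V
  isPreconnected' : IsPreconnected V
  subset : V ⊆ D
  mapsTo : ∀ z ∈ V, h z ∈ D

theorem eq_of_exp_eq_of_norm_lt {u v : ℂ} (h : exp u = exp v) (h1 : ‖u - v‖ < 1) : u = v := by
  obtain ⟨n, hn⟩ := exp_eq_exp_iff_exists_int.1 h
  rcases eq_or_ne n 0 with rfl | hn0
  · simpa using hn
  · exfalso
    rw [hn, add_sub_cancel_left] at h1
    have h2 : (1 : ℝ) ≤ |(n : ℝ)| := by exact_mod_cast Int.one_le_abs hn0
    have h3 := Real.pi_gt_three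
    simp [abs_of_pos Real.pi_pos] at h1
    nlinarith

theorem isOpen_image_log {D : Set ℂ} {p : ℂ} {s : ℂ → ℂ} (hs : ContinuousOn s D)
    (hs1 : ∀ z ∈ D, exp (s z) = z - p) {W : Set ℂ} (hW : IsOpen W) (hWD : W ⊆ D) :
    IsOpen (s '' W) := by
  have hc : Continuous fun u : ℂ => p + exp u := by fun_prop
  have : s '' W = (fun u => p + exp u) ⁻¹' W ∩
      (fun u => s (p + exp u) - u) ⁻¹' Metric.ball 0 1 := by
    ext u
    constructor
    · rintro ⟨z, hz, rfl⟩
      simp [hs1 z (hWD hz), hz]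
    · rintro ⟨h1, h2⟩
      refine ⟨p + exp u, h1, eq_of_exp_eq_of_norm_lt ?_ (by simpa using h2)⟩
      rw [hs1 _ (hWD h1), add_sub_cancel_left]
  rw [this]
  refine ContinuousOn.isOpen_inter_preimage ?_ (hW.preimage hc) Metric.isOpen_ball
  exact ((hs.mono hWD).comp hc.continuousOn fun u hu => hu).sub continuousOn_id

namespace FixedPointFree

variable {h : ℂ ≃ₜ ℂ} {D V : Set ℂ}

theorem exists_lift (H : FixedPointFree h D V) {p x₀ : ℂ} (hp : h p = p) (hx₀ : x₀ ∈ V) :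
    ∃ (h' : ℂ ≃ₜ ℂ) (s : ℂ → ℂ), ContinuousOn s D ∧ (∀ z ∈ D, exp (s z) = z - p) ∧
      FixedPointFree h' (s '' D) (s '' V) ∧ (∀ z ∈ V, h' (s z) = s (h z)) ∧
      ∀ u, exp (h' u) = h (p + exp u) - p := by
  have hpD : p ∉ D := fun hD => H.ne p hD hp
  have hDp : ∀ z ∈ D, z - p ≠ 0 := fun z hz h => hpD (sub_eq_zero.1 h ▸ hz)
  obtain ⟨s, hs, hs1⟩ := H.hasLogs (fun z => z - p) (by fun_prop) hDp
  obtain ⟨F, hF, hFi, hF0, hF1⟩ := H.isotopic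
  have hA : ∀ z : {z : ℂ | z ≠ p}, (z : ℂ) - p ≠ 0 := fun z => sub_ne_zero.2 z.2
  have hc1 : Continuous fun x : I × {z : ℂ | z ≠ p} => F x.1 x.2 :=
    hF.comp (continuous_fst.prodMk (by fun_prop))
  have hc2 : Continuous fun x : I × {z : ℂ | z ≠ p} => F x.1 p :=
    hF.comp (continuous_fst.prodMk (by fun_prop))
  obtain ⟨L, hL, hL1, hL0⟩ := exists_log_homotopy (A := {z : ℂ | z ≠ p})
    (fun x => (F x.1 x.2 - F x.1 p) / (x.2 - p))
    ((hc1.sub hc2).div (by fun_prop) fun x => hA x.2)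
    (fun x => div_ne_zero (sub_ne_zero.2 fun h => x.2.2 (hFi _ h)) (hA _))
    (fun _ => 0) continuous_const (fun a => by simp [hF0, div_self (hA a)])
  have hL1' : ∀ z, exp (L (1, z)) = (h z - p) / (z - p) := fun z => by
    rw [hL1]; simp [hF1, hp]
  have hpe : ∀ u : ℂ, p + exp u ≠ p := fun u => by simp [exp_ne_zero]
  let e : ℂ → {z : ℂ | z ≠ p} := fun u => ⟨p + exp u, hpe u⟩
  have he : Continuous e := Continuous.subtype_mk (by fun_prop) _
  have hinv : ∀ z, z ≠ p → h.symm z ≠ p := fun z hz h' => hz (by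
    rw [← h.apply_symm_apply z, h', hp])
  let k : ℂ → {z : ℂ | z ≠ p} := fun u => ⟨h.symm (p + exp u), hinv _ (hpe u)⟩
  have hk : Continuous k := Continuous.subtype_mk (by fun_prop) _
  have hx₀p : x₀ ≠ p := sub_ne_zero.1 (hDp _ (H.subset hx₀))
  set c : ℂ := s (h x₀) - s x₀ - L (1, ⟨x₀, hx₀p⟩) with hc
  have hec : exp c = 1 := by
    rw [hc, exp_sub, exp_sub, hs1 _ (H.mapsTo _ hx₀), hs1 _ (H.subset hx₀), hL1']
    exact div_self (div_ne_zero (hDp _ (H.mapsTo _ hx₀)) (hDp _ (H.subset hx₀)))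
  have hex : ∀ u, exp (u + L (1, e u) + c) = h (p + exp u) - p := fun u => by
    rw [exp_add, exp_add, hec, hL1']
    simp only [e, add_sub_cancel_left]
    field_simp [exp_ne_zero]
  let h' : ℂ ≃ₜ ℂ :=
    { toFun := fun u => u + L (1, e u) + c
      invFun := fun w => w - c - L (1, k w)
      left_inv := fun u => by
        have : k (u + L (1, e u) + c) = e u := by
          apply Subtype.ext
          simp only [k, e, hex]
          simp
        dsimp only
        rw [this]; ring
      right_inv := fun w => by
        have hkw : (h (k w) : ℂ) = p + exp w := by simp [k]
        have : e (w - c - L (1, k w)) = k w := by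
          apply Subtype.ext
          have h0 := hA (k w)
          simp only [e]
          rw [exp_sub, exp_sub, hec, hL1', hkw, add_sub_cancel_left, div_one]
          field_simp [exp_ne_zero]
          ring
        dsimp only
        rw [this]; ring
      continuous_toFun := by fun_prop
      continuous_invFun := by fun_prop }
  have hh' : ∀ u, h' u = u + L (1, e u) + c := fun u => rfl
  have hcomm : ∀ z ∈ V, h' (s z) = s (h z) := by
    intro z hz
    have := eq_add_const_of_exp_eq H.isPreconnected' (l := fun z => h' (s z))
      (m := fun z => s (h z))
      (h'.continuous.comp_continuousOn (hs.mono H.subset))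
      (hs.comp h.continuous.continuousOn H.mapsTo) (fun z hz => by
        rw [hh', hex, hs1 z (H.subset hz), hs1 _ (H.mapsTo z hz), add_sub_cancel]) hz hx₀
    have h0 : h' (s x₀) - s (h x₀) = 0 := by
      have : e (s x₀) = ⟨x₀, hx₀p⟩ := by
        apply Subtype.ext
        simp [e, hs1 x₀ (H.subset hx₀)]
      rw [hh', this, hc]; ring
    rw [h0] at this
    exact sub_eq_zero.1 this
  refine ⟨h', s, hs, hs1, ⟨⟨fun t u => u + L (t, e u) + t * c, by fun_prop, ?_, ?_, ?_⟩,
    isOpen_image_log hs hs1 H.isOpen subset_rfl, H.isPreconnected.image s hs, ?_, ?_,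
    isOpen_image_log hs hs1 H.isOpen' H.subset, H.isPreconnected'.image s (hs.mono H.subset),
    image_mono H.subset, ?_⟩, hcomm, fun u => by rw [hh', hex]⟩
  · intro t u v huv
    have h1 : u + L (t, e u) = v + L (t, e v) := by simpa using huv
    have h2 : F t (p + exp u) = F t (p + exp v) := by
      have h3 := congrArg exp h1
      rw [exp_add, exp_add, hL1, hL1] at h3
      simp only [e, add_sub_cancel_left] at h3
      field_simp [exp_ne_zero] at h3
      simpa using h3
    have h3 : e u = e v := Subtype.ext (hFi t h2)
    rw [h3] at h1
    exact add_right_cancel h1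
  · intro u
    simp [hL0]
  · intro u
    simp [hh']
  · intro f hf hf0
    obtain ⟨l, hl, hl1⟩ := H.hasLogs (fun z => f (s z)) (hf.comp hs (mapsTo_image s D))
      fun z hz => hf0 _ (mem_image_of_mem s hz)
    have hm : ∀ u ∈ s '' D, p + exp u ∈ D ∧ s (p + exp u) = u := by
      rintro _ ⟨z, hz, rfl⟩
      rw [hs1 z hz, add_sub_cancel]
      exact ⟨hz, rfl⟩
    refine ⟨fun u => l (p + exp u), hl.comp (by fun_prop) fun u hu => (hm u hu).1, fun u hu => ?_⟩
    rw [hl1 _ (hm u hu).1, (hm u hu).2]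
  · rintro _ ⟨z, hz, rfl⟩ hfix
    apply H.ne z hz
    have := hex (s z)
    rw [← hh', hfix, hs1 z hz, add_sub_cancel] at this
    linear_combination -this
  · rintro _ ⟨z, hz, rfl⟩
    rw [hcomm z hz]
    exact mem_image_of_mem s (H.mapsTo z hz)

end FixedPointFree

theorem HasLogs.logChange_loop {D : Set ℂ} (hD : HasLogs D) {f : ℂ → ℂ} (hf : ContinuousOn f D)
    (hf0 : ∀ z ∈ D, f z ≠ 0) {γ : I → ℂ} (hγ : Continuous γ) (hloop : γ 1 = γ 0)
    (hγD : ∀ t, γ t ∈ D) : LogChange (fun t => f (γ t)) 0 := by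
  obtain ⟨l, hl, hl1⟩ := hD f hf hf0
  have := LogChange.of_log hl hl1 hγ hγD
  rwa [hloop, sub_self] at this

theorem Homeomorph.apply_mem_of_support {ψ : ℂ ≃ₜ ℂ} {T : Set ℂ} (hψ : ∀ z ∉ T, ψ z = z) {z : ℂ}
    (hz : z ∈ T) : ψ z ∈ T := by
  by_contra h
  exact h (by rwa [ψ.injective (hψ _ h)])

theorem IsPreconnected.thickening {X : Set ℂ} (hX : IsPreconnected X) (δ : ℝ) :
    IsPreconnected (Metric.thickening δ X) := by
  rw [← add_ball_zero, ← add_image_prod]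
  exact (hX.prod (convex_ball _ _).isPreconnected).image _ continuous_add.continuousOn

theorem IsCompact.eventually_thickening_subset {X U : Set ℂ} (hX : IsCompact X) (hU : IsOpen U)
    (hXU : X ⊆ U) : ∀ᶠ δ in 𝓝[>] (0 : ℝ), Metric.thickening δ X ⊆ U := by
  obtain ⟨ρ, hρ, hρU⟩ := hX.exists_thickening_subset_open hU hXU
  filter_upwards [Ioo_mem_nhdsGT hρ] with δ hδ
  exact (Metric.thickening_mono hδ.2.le X).trans hρU

theorem eventually_thickening_image_disjoint {h : ℂ ≃ₜ ℂ} {X Y : Set ℂ} (hX : IsCompact X)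
    (hY : IsCompact Y) (hXY : ∀ z ∈ X, h z ∉ Y) :
    ∀ᶠ δ in 𝓝[>] (0 : ℝ), ∀ z ∈ Metric.thickening δ X, h z ∉ Metric.thickening δ Y := by
  have hd : Disjoint (h '' X) Y := by
    rw [Set.disjoint_left]
    rintro _ ⟨z, hz, rfl⟩
    exact hXY z hz
  obtain ⟨η, hη, hη'⟩ := hd.exists_thickenings (hX.image h.continuous) hY.isClosed
  filter_upwards [Ioo_mem_nhdsGT hη, hX.eventually_thickening_subset
    (U := h ⁻¹' Metric.thickening η (h '' X)) (Metric.isOpen_thickening.preimage h.continuous)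
    (fun z hz => Metric.self_subset_thickening hη _ (mem_image_of_mem h hz))] with δ hδ hδX z hz hz'
  exact Set.disjoint_left.1 hη' (hδX hz) (Metric.thickening_mono hδ.2.le _ hz')

namespace FixedPointFree

variable {h : ℂ ≃ₜ ℂ} {D V : Set ℂ}

theorem trans_of_ne (H : FixedPointFree h D V) {ψ : ℂ ≃ₜ ℂ} (hψ : PlaneIsotopic ψ)
    (hψD : ∀ z ∉ D, ψ z = z) (hne : ∀ z ∈ D, ψ (h z) ≠ z) : FixedPointFree (h.trans ψ) D V where
  isotopic := H.isotopic.trans hψ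
  isOpen := H.isOpen
  isPreconnected := H.isPreconnected
  hasLogs := H.hasLogs
  ne := hne
  isOpen' := H.isOpen'
  isPreconnected' := H.isPreconnected'
  subset := H.subset
  mapsTo z hz := Homeomorph.apply_mem_of_support hψD (H.mapsTo z hz)

/-- No fixed point free system has a point of period `n`, with orbit in the small domain. -/
def NoPeriod (n : ℕ) : Prop :=
  ∀ (h : ℂ ≃ₜ ℂ) (D V : Set ℂ), FixedPointFree h D V → ∀ x, (∀ k < n, h^[k] x ∈ V) →
    h^[n] x ≠ x

theorem noPeriod_one : NoPeriod 1 := fun _ _ _ H x hx hn =>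
  H.ne x (H.subset (hx 0 one_pos)) hn

theorem noPeriod_two : NoPeriod 2 := by
  intro h D V H x hx hn
  have hx0 : x ∈ V := hx 0 two_pos
  have hx1 : h x ∈ V := hx 1 one_lt_two
  have hn' : h (h x) = x := hn
  have hV : IsPathConnected V := H.isOpen'.isConnected_iff_isPathConnected.1
    ⟨⟨x, hx0⟩, H.isPreconnected'⟩
  obtain ⟨α, hα⟩ := hV.joinedIn x hx0 (h x) hx1
  let κ : Path (h (h x)) x := (Path.refl x).cast hn' rfl
  have hκ : ∀ t, κ t = x := fun t => rfl
  refine H.isotopic.not_logChange_orbitLoop (fun t => H.ne _ (H.subset (hα t)))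
    (κ := κ) (fun s t => by rw [hκ, hκ]; exact H.ne _ (H.subset hx0)) ?_
  refine H.hasLogs.logChange_loop (f := fun z => h z - z) (by fun_prop)
    (fun z hz => sub_ne_zero.2 (H.ne z hz)) (Path.continuous _) (by simp) fun t => ?_
  have ht := mem_range_self (f := PlaneIsotopic.orbitLoop h α κ) t
  rw [PlaneIsotopic.orbitLoop, Path.trans_range, Path.trans_range] at ht
  rcases ht with (⟨s, hs⟩ | ⟨s, hs⟩) | ⟨s, hs⟩ <;> rw [PlaneIsotopic.orbitLoop, ← hs]
  · exact H.subset (hα s)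
  · exact H.mapsTo _ (hα s)
  · rw [hκ]
    exact H.subset hx0

theorem not_return (H : FixedPointFree h D V) {n : ℕ} (IH : ∀ j, 0 < j → j < n → NoPeriod j)
    {T : Set ℂ} (hTo : IsOpen T) (hTc : IsPreconnected T) (hTD : T ⊆ D) (hT : ∀ z ∈ T, h z ∉ T)
    {x : ℂ} (hx : x ∈ T) {j : ℕ} (hj : 0 < j) (hjn : j < n) (hV : ∀ k < j, h^[k] x ∈ V) :
    h^[j] x ∉ T := by
  intro hjT
  classical
  have hex : ∃ j, 0 < j ∧ h^[j] x ∈ T := ⟨j, hj, hjT⟩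
  set i := Nat.find hex with hi
  obtain ⟨hi0, hiT⟩ := Nat.find_spec hex
  rw [← hi] at hi0 hiT
  have hij : i ≤ j := Nat.find_min' hex ⟨hj, hjT⟩
  have hmin : ∀ k, 0 < k → k < i → h^[k] x ∉ T := fun k hk hki hkT =>
    Nat.find_min hex hki ⟨hk, hkT⟩
  obtain ⟨ψ, hψ, hψT, hψx⟩ := PlaneIsotopic.exists_drag hTo hTc hiT hx
  have hψD : ∀ z ∉ D, ψ z = z := fun z hz => hψT z fun h => hz (hTD h)
  have H' := H.trans_of_ne hψ hψD fun z hz hfix => by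
    by_cases hzT : h z ∈ T
    · exact hT z (hfix ▸ Homeomorph.apply_mem_of_support hψT hzT) hzT
    · exact H.ne z hz ((hψT _ hzT).symm.trans hfix)
  have horb : ∀ k < i, (h.trans ψ)^[k] x = h^[k] x := by
    intro k
    induction k with
    | zero => intro _; rfl
    | succ k ih =>
      intro hk
      rw [Function.iterate_succ_apply', ih (by omega), Homeomorph.trans_apply,
        ← Function.iterate_succ_apply' h, hψT _ (hmin _ (by omega) hk)]
  refine IH i hi0 (by omega) _ D V H' x (fun k hk => ?_) ?_
  · rw [horb k hk]
    exact hV k (by omega)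
  · obtain ⟨k, hk⟩ : ∃ k, i = k + 1 := ⟨i - 1, by omega⟩
    have hk' : h (h^[k] x) = h^[i] x := by rw [hk, Function.iterate_succ_apply']
    rw [hk, Function.iterate_succ_apply', horb k (by omega), Homeomorph.trans_apply, hk', hψx]

/-- A free domain `E` whose boundary contains `z` and `h z`, with continua `F` and `G` joining the
periodic point `x` to `z` and to `h z` inside `E`. -/
structure FreeChain (h : ℂ ≃ₜ ℂ) (D V : Set ℂ) (n : ℕ) (x : ℂ) (E F G : Set ℂ) (z : ℂ) : Prop where
  fpf : FixedPointFree h D V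
  orbit : ∀ k < n, h^[k] x ∈ V
  period : h^[n] x = x
  isOpen : IsOpen E
  isPreconnected : IsPreconnected E
  subset : E ⊆ V
  free : ∀ w ∈ E, h w ∉ E
  mem : z ∈ V
  mem' : h z ∈ V
  mem_closure : z ∈ closure E
  mem_closure' : h z ∈ closure E
  compact_F : IsCompact F
  compact_G : IsCompact G
  conn_F : IsPreconnected F
  conn_G : IsPreconnected G
  F_subset : ∀ w ∈ F, w ∈ E ∨ w = z
  G_subset : ∀ w ∈ G, w ∈ E ∨ w = h z
  x_mem_F : x ∈ F
  x_mem_G : x ∈ G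
  z_mem_F : z ∈ F
  z_mem_G : h z ∈ G

namespace FreeChain

variable {n : ℕ} {x z : ℂ} {E F G : Set ℂ}

theorem apply_ne (C : FreeChain h D V n x E F G z) {w : ℂ} (hw : w ∈ E) {y : ℂ}
    (hy : y ∈ closure E) : h w ≠ y := by
  rintro rfl
  obtain ⟨_, ⟨w', hw', rfl⟩, hE⟩ := mem_closure_iff.1 hy (h '' E) (h.isOpenMap _ C.isOpen)
    (mem_image_of_mem h hw)
  exact C.free w' hw' hE

theorem apply_notMem (C : FreeChain h D V n x E F G z) {y : ℂ} (hy : y ∈ closure E) :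
    h y ∉ E := by
  intro hyE
  obtain ⟨w, hw, hwE⟩ := mem_closure_iff.1 hy (h ⁻¹' E) (C.isOpen.preimage h.continuous) hyE
  exact C.free w hwE hw

theorem ne (C : FreeChain h D V n x E F G z) : h z ≠ z := C.fpf.ne z (C.fpf.subset C.mem)

theorem F_subset_V (C : FreeChain h D V n x E F G z) : F ⊆ V := fun w hw =>
  (C.F_subset w hw).elim (fun h => C.subset h) fun h => h ▸ C.mem

theorem G_subset_V (C : FreeChain h D V n x E F G z) : G ⊆ V := fun w hw =>
  (C.G_subset w hw).elim (fun h => C.subset h) fun h => h ▸ C.mem'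

theorem free_F (C : FreeChain h D V n x E F G z) {w : ℂ} (hw : w ∈ F) : h w ∉ F := by
  intro hw'
  rcases C.F_subset _ hw with h1 | rfl <;> rcases C.F_subset _ hw' with h2 | h2
  · exact C.free w h1 h2
  · exact C.apply_ne h1 C.mem_closure h2
  · exact C.apply_notMem C.mem_closure h2
  · exact C.ne h2

theorem free_G (C : FreeChain h D V n x E F G z) {w : ℂ} (hw : w ∈ G) : h w ∉ G := by
  intro hw'
  rcases C.G_subset _ hw with h1 | rfl <;> rcases C.G_subset _ hw' with h2 | h2
  · exact C.free w h1 h2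
  · exact C.apply_ne h1 C.mem_closure' h2
  · exact C.apply_notMem C.mem_closure' h2
  · exact C.ne (h.injective h2)

theorem mem_of_bad (C : FreeChain h D V n x E F G z) {a : ℂ} (ha : a ∈ F) (ha' : h (h a) ∈ G) :
    a ∈ E ∧ h (h a) ∈ E := by
  rcases C.F_subset _ ha with h1 | rfl <;> rcases C.G_subset _ ha' with h2 | h2
  · exact ⟨h1, h2⟩
  · exact (C.apply_ne h1 C.mem_closure (h.injective h2)).elim
  · exact (C.apply_notMem C.mem_closure' h2).elim
  · exact (C.ne (h.injective h2)).elim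

theorem exists_bad (C : FreeChain h D V n x E F G z) (hn : 3 ≤ n)
    (IH : ∀ j, 0 < j → j < n → NoPeriod j) : ∃ a ∈ F, h (h a) ∈ G := by
  by_contra! hbad
  have hGD : G ⊆ D := C.G_subset_V.trans C.fpf.subset
  have hFD : F ⊆ D := C.F_subset_V.trans C.fpf.subset
  have hGk : ∀ k, 0 < k → k < n → h^[k] x ∉ G := fun k hk hkn hkG => by
    obtain ⟨δ, ⟨h1, h2⟩, hδ⟩ := (((C.compact_G.eventually_thickening_subset C.fpf.isOpen hGD).and
      (eventually_thickening_image_disjoint C.compact_G C.compact_G fun w hw => C.free_G hw)).and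
      self_mem_nhdsWithin).exists
    have hsub := Metric.self_subset_thickening hδ G
    exact C.fpf.not_return IH Metric.isOpen_thickening (C.conn_G.thickening δ) h1 h2
      (hsub C.x_mem_G) hk hkn (fun i hi => C.orbit i (by omega)) (hsub hkG)
  have hFk : ∀ k, 0 < k → k < n → h^[k] x ∉ F := fun k hk hkn hkF => by
    obtain ⟨δ, ⟨h1, h2⟩, hδ⟩ := (((C.compact_F.eventually_thickening_subset C.fpf.isOpen hFD).and
      (eventually_thickening_image_disjoint C.compact_F C.compact_F fun w hw => C.free_F hw)).and
      self_mem_nhdsWithin).exists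
    have hsub := Metric.self_subset_thickening hδ F
    exact C.fpf.not_return IH Metric.isOpen_thickening (C.conn_F.thickening δ) h1 h2
      (hsub C.x_mem_F) hk hkn (fun i hi => C.orbit i (by omega)) (hsub hkF)
  have hcF' : IsCompact (h '' F) := C.compact_F.image h.continuous
  have hF'k : ∀ k, 2 ≤ k → k < n → h^[k] x ∉ h '' F := by
    rintro k hk hkn ⟨w, hw, hwk⟩
    obtain ⟨k, rfl⟩ : ∃ i, k = i + 1 := ⟨k - 1, by omega⟩
    rw [Function.iterate_succ_apply'] at hwk
    exact hFk k (by omega) (by omega) (h.injective hwk ▸ hw)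
  obtain ⟨δ, ⟨⟨⟨⟨⟨hT1D, hT3D⟩, hT1⟩, hT3⟩, hT31⟩, hT1k, hT3k⟩, hδ⟩ :=
    (((((((C.compact_G.eventually_thickening_subset C.fpf.isOpen hGD).and
    (hcF'.eventually_thickening_subset C.fpf.isOpen (by
      rintro _ ⟨w, hw, rfl⟩; exact C.fpf.mapsTo w (C.F_subset_V hw)))).and
    (eventually_thickening_image_disjoint C.compact_G C.compact_G fun w hw => C.free_G hw)).and
    (eventually_thickening_image_disjoint (h := h) hcF' hcF' (by
      rintro _ ⟨w, hw, rfl⟩ ⟨w', hw', he⟩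
      exact C.free_F hw (h.injective he ▸ hw')))).and
    (eventually_thickening_image_disjoint (h := h) hcF' C.compact_G (by
      rintro _ ⟨w, hw, rfl⟩; exact hbad w hw))).and
    ((C.compact_G.eventually_thickening_subset
      (U := ((fun k => h^[k] x) '' Ico 2 n)ᶜ) ((finite_Ico 2 n).image _).isClosed.isOpen_compl
      (by rintro w hw ⟨k, hk, rfl⟩; exact hGk k (by have := hk.1; omega) hk.2 hw)).and
     (hcF'.eventually_thickening_subset
      (U := ((fun k => h^[k] x) '' Ico 2 n)ᶜ) ((finite_Ico 2 n).image _).isClosed.isOpen_compl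
      (by rintro w hw ⟨k, hk, rfl⟩; exact hF'k k hk.1 hk.2 hw)))).and
    self_mem_nhdsWithin).exists
  have hsub1 := Metric.self_subset_thickening hδ G
  have hsub3 := Metric.self_subset_thickening hδ (h '' F)
  set T1 := Metric.thickening δ G
  set T3 := Metric.thickening δ (h '' F)
  obtain ⟨ψ, hψ, hψT, hψx⟩ := PlaneIsotopic.exists_drag Metric.isOpen_thickening
    (C.conn_G.thickening δ) (hsub1 C.x_mem_G) (hsub1 C.z_mem_G)
  obtain ⟨φ, hφ, hφT, hφx⟩ := PlaneIsotopic.exists_drag Metric.isOpen_thickening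
    ((C.conn_F.image h h.continuous.continuousOn).thickening δ)
    (hsub3 (mem_image_of_mem h C.z_mem_F)) (hsub3 (mem_image_of_mem h C.x_mem_F))
  have H' := C.fpf.trans_of_ne (hψ.trans hφ) (fun w hw => by
      rw [Homeomorph.trans_apply, hψT w fun h => hw (hT1D h), hφT w fun h => hw (hT3D h)])
    fun y hy hfix => by
      rw [Homeomorph.trans_apply] at hfix
      by_cases h1 : h y ∈ T1
      · have h2 := Homeomorph.apply_mem_of_support hψT h1
        by_cases h3 : ψ (h y) ∈ T3
        · exact hT31 y (hfix ▸ Homeomorph.apply_mem_of_support hφT h3) h1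
        · rw [hφT _ h3] at hfix
          exact hT1 y (by rwa [hfix] at h2) h1
      · rw [hψT _ h1] at hfix
        by_cases h3 : h y ∈ T3
        · exact hT3 y (hfix ▸ Homeomorph.apply_mem_of_support hφT h3) h3
        · rw [hφT _ h3] at hfix
          exact C.fpf.ne y hy hfix
  have horb : ∀ k, k + 1 < n → (h.trans (ψ.trans φ))^[k] (h x) = h^[k + 1] x := by
    intro k
    induction k with
    | zero => intro _; rfl
    | succ k ih =>
      intro hk
      have hm : h^[k + 1 + 1] x ∈ (fun k => h^[k] x) '' Ico 2 n := ⟨k + 1 + 1, ⟨by omega, hk⟩, rfl⟩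
      rw [Function.iterate_succ_apply', ih (by omega), Homeomorph.trans_apply,
        ← Function.iterate_succ_apply' h, Homeomorph.trans_apply,
        hψT _ fun h => hT1k h hm, hφT _ fun h => hT3k h hm]
  refine IH (n - 1) (by omega) (by omega) _ D V H' (h x) (fun k hk => ?_) ?_
  · rw [horb k (by omega)]
    exact C.orbit _ (by omega)
  · obtain ⟨k, rfl⟩ : ∃ k, n = k + 2 := ⟨n - 2, by omega⟩
    change (h.trans (ψ.trans φ))^[k + 1] (h x) = h x
    rw [Function.iterate_succ_apply', horb k (by omega), Homeomorph.trans_apply,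
        ← Function.iterate_succ_apply' h, C.period, Homeomorph.trans_apply, hψx, hφx]

end FreeChain

end FixedPointFree

theorem PlaneIsotopic.exists_fixed_of_orbitLoop {h : ℂ ≃ₜ ℂ} (hh : PlaneIsotopic h) {a : ℂ}
    {α : Path a (h a)} (hα : ∀ t, h (α t) ≠ α t) {κ : Path (h (h a)) a}
    (hκ : ∀ s t, h (κ s) ≠ κ t) :
    ∃ p, h p = p ∧ ¬ LogChange (fun t => orbitLoop h α κ t - p) 0 := by
  by_contra! hp
  refine hh.not_logChange_orbitLoop hα hκ ?_
  refine logChange_eq_zero_of_winding (U := {w | h w ≠ w}) (f := fun w => h w - w)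
    (isOpen_ne_fun h.continuous continuous_id) (Path.continuous _) (by simp) (fun t => ?_)
    (fun p hpU => hp p (by simpa using hpU)) (by fun_prop) fun w hw => sub_ne_zero.2 hw
  have ht := mem_range_self (f := orbitLoop h α κ) t
  rw [orbitLoop, Path.trans_range, Path.trans_range] at ht
  rcases ht with (⟨s, hs⟩ | ⟨s, hs⟩) | ⟨s, hs⟩ <;> rw [orbitLoop, ← hs]
  · exact hα s
  · exact fun h' => hα s (h.injective h')
  · exact hκ s s

namespace FixedPointFree

namespace FreeChain

variable {h h' : ℂ ≃ₜ ℂ} {D V : Set ℂ} {n : ℕ} {x z p : ℂ} {E F G : Set ℂ} {s : ℂ → ℂ}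

theorem lift (C : FreeChain h D V n x E F G z) (hs : ContinuousOn s D)
    (hs1 : ∀ w ∈ D, exp (s w) = w - p) (H' : FixedPointFree h' (s '' D) (s '' V))
    (hh : ∀ w ∈ V, h' (s w) = s (h w)) :
    FreeChain h' (s '' D) (s '' V) n (s x) (s '' E) (s '' F) (s '' G) (s z) := by
  have hVD := C.fpf.subset
  have hED := C.subset.trans hVD
  have hinj : InjOn s D := fun u hu v hv huv => by
    have := hs1 u hu
    rw [huv, hs1 v hv] at this
    exact (sub_left_injective this).symm
  have horb : ∀ k ≤ n, h'^[k] (s x) = s (h^[k] x) := by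
    intro k
    induction k with
    | zero => intro _; rfl
    | succ k ih =>
      intro hk
      rw [Function.iterate_succ_apply', ih (by omega), hh _ (C.orbit k hk),
        Function.iterate_succ_apply']
  exact
  { fpf := H'
    orbit := fun k hk => by
      rw [horb k hk.le]
      exact mem_image_of_mem s (C.orbit k hk)
    period := by rw [horb n le_rfl, C.period]
    isOpen := isOpen_image_log hs hs1 C.isOpen hED
    isPreconnected := C.isPreconnected.image s (hs.mono hED)
    subset := image_mono C.subset
    free := by
      rintro _ ⟨w, hw, rfl⟩ ⟨w', hw', he⟩
      rw [hh w (C.subset hw)] at he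
      exact C.free w hw (hinj (hED hw') (C.fpf.mapsTo w (C.subset hw)) he ▸ hw')
    mem := mem_image_of_mem s C.mem
    mem' := by
      rw [hh z C.mem]
      exact mem_image_of_mem s C.mem'
    mem_closure := ((hs z (hVD C.mem)).mono hED).mem_closure_image C.mem_closure
    mem_closure' := by
      rw [hh z C.mem]
      exact ((hs _ (hVD C.mem')).mono hED).mem_closure_image C.mem_closure'
    compact_F := C.compact_F.image_of_continuousOn (hs.mono (C.F_subset_V.trans hVD))
    compact_G := C.compact_G.image_of_continuousOn (hs.mono (C.G_subset_V.trans hVD))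
    conn_F := C.conn_F.image s (hs.mono (C.F_subset_V.trans hVD))
    conn_G := C.conn_G.image s (hs.mono (C.G_subset_V.trans hVD))
    F_subset := by
      rintro _ ⟨w, hw, rfl⟩
      exact (C.F_subset w hw).imp (mem_image_of_mem s) (congrArg s)
    G_subset := by
      rintro _ ⟨w, hw, rfl⟩
      rw [hh z C.mem]
      exact (C.G_subset w hw).imp (mem_image_of_mem s) (congrArg s)
    x_mem_F := mem_image_of_mem s C.x_mem_F
    x_mem_G := mem_image_of_mem s C.x_mem_G
    z_mem_F := mem_image_of_mem s C.z_mem_F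
    z_mem_G := by
      rw [hh z C.mem]
      exact mem_image_of_mem s C.z_mem_G }

theorem false_of_cover (hn : 3 ≤ n) (IH : ∀ j, 0 < j → j < n → NoPeriod j) (l : List (Set ℂ))
    (C : FreeChain h D V n x E F G z)
    (hl : ∀ B ∈ l, IsPreconnected B ∧ B ⊆ E ∧ ∀ w ∈ B, h (h w) ∈ E)
    (hcov : ∀ a ∈ F, h (h a) ∈ G → ∃ B ∈ l, a ∈ B) : False := by
  induction hN : l.length generalizing l h D V x E F G z with
  | zero =>
    obtain ⟨a, ha, ha'⟩ := C.exists_bad hn IH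
    obtain ⟨B, hB, -⟩ := hcov a ha ha'
    simp [List.length_eq_zero_iff.1 hN] at hB
  | succ N ih =>
    obtain ⟨B, l, rfl⟩ := List.exists_cons_of_length_eq_add_one hN
    have hN' : l.length = N := by simpa using hN
    by_cases hB : ∃ a ∈ F, a ∈ B ∧ h (h a) ∈ G
    swap
    · refine ih l C (fun B' h' => hl B' (List.mem_cons_of_mem _ h')) (fun a ha ha' => ?_) hN'
      obtain ⟨B', hB', haB'⟩ := hcov a ha ha'
      rcases List.mem_cons.1 hB' with rfl | hB'
      · exact (hB ⟨a, ha, haB', ha'⟩).elim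
      · exact ⟨B', hB', haB'⟩
    obtain ⟨a, haF, haB, haG⟩ := hB
    obtain ⟨haE, hbE⟩ := C.mem_of_bad haF haG
    have hVD := C.fpf.subset
    have hED := C.subset.trans hVD
    have hD : IsPathConnected D := C.fpf.isOpen.isConnected_iff_isPathConnected.1
      ⟨⟨a, hED haE⟩, C.fpf.isPreconnected⟩
    have hE : IsPathConnected E := C.isOpen.isConnected_iff_isPathConnected.1
      ⟨⟨a, haE⟩, C.isPreconnected⟩
    obtain ⟨α, hα⟩ := hD.joinedIn a (hED haE) (h a) (C.fpf.mapsTo a (C.subset haE))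
    obtain ⟨κ, hκ⟩ := hE.joinedIn (h (h a)) hbE a haE
    obtain ⟨p, hp, hγ⟩ := C.fpf.isotopic.exists_fixed_of_orbitLoop
      (fun t => C.fpf.ne _ (hα t)) (κ := κ) fun s t h' => C.free _ (hκ s) (h' ▸ hκ t)
    obtain ⟨h', s, hs, hs1, H', hh, hexp⟩ := C.fpf.exists_lift hp (C.subset haE)
    have hexp1 : ∀ w ∈ D, exp (h' (s w)) = h w - p := fun w hw => by
      rw [hexp, hs1 w hw, add_sub_cancel]
    have hexp2 : ∀ w ∈ D, exp (h' (h' (s w))) = h (h w) - p := fun w hw => by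
      rw [hexp, hexp1 w hw, add_sub_cancel]
    have hkey : h' (h' (s a)) ≠ s (h (h a)) := by
      intro he
      refine hγ ?_
      have h1 : LogChange (fun t => α t - p) (s (h a) - s a) := by
        have := LogChange.of_log (f := fun w => w - p) hs hs1 α.continuous hα
        simpa using this
      have h2 : LogChange (fun t => α.map h.continuous t - p) (h' (s (h a)) - h' (s a)) := by
        have := LogChange.of_log (f := fun w => h w - p) (h'.continuous.comp_continuousOn hs)
          hexp1 α.continuous hα
        simpa using this
      have h3 : LogChange (fun t => κ t - p) (s a - s (h (h a))) := by
        have := LogChange.of_log (f := fun w => w - p) hs hs1 κ.continuous fun t => hED (hκ t)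
        simpa using this
      have h4 := ((h1.trans (f := fun w => w - p) h2).trans (f := fun w => w - p) h3)
      rw [← he, hh a (C.subset haE)] at h4
      rw [PlaneIsotopic.orbitLoop]
      convert h4 using 1
      ring
    have hdich : ∀ B' ∈ B :: l, ∀ w ∈ B', h' (h' (s w)) = s (h (h w)) →
        ∀ w' ∈ B', h' (h' (s w')) = s (h (h w')) := by
      intro B' hB' w hw hwe w' hw'
      obtain ⟨hc, hBE, hBh⟩ := hl B' hB'
      have := eq_add_const_of_exp_eq hc (l := fun w => h' (h' (s w))) (m := fun w => s (h (h w)))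
        ((h'.continuous.comp h'.continuous).comp_continuousOn (hs.mono (hBE.trans hED)))
        (hs.comp (h.continuous.comp h.continuous).continuousOn fun w hw => hED (hBh w hw))
        (fun w hw => by rw [hexp2 w (hED (hBE hw)), hs1 _ (hED (hBh w hw))]) hw' hw
      simp only [hwe, sub_self] at this
      exact sub_eq_zero.1 this
    refine ih (l.map fun B' => s '' {w ∈ B' | h' (h' (s w)) = s (h (h w))})
      (C.lift hs hs1 H' hh) ?_ ?_ (by simpa using hN')
    · intro B' hB'
      obtain ⟨B', hB'l, rfl⟩ := List.mem_map.1 hB'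
      have hB'' := List.mem_cons_of_mem B hB'l
      obtain ⟨hc, hBE, hBh⟩ := hl B' hB''
      refine ⟨?_, image_mono fun w hw => hBE hw.1, ?_⟩
      · refine IsPreconnected.image ?_ s (hs.mono fun w hw => hED (hBE hw.1))
        rcases eq_empty_or_nonempty {w ∈ B' | h' (h' (s w)) = s (h (h w))} with h0 | ⟨w, hw⟩
        · rw [h0]
          exact isPreconnected_empty
        · rwa [sep_eq_self_iff_mem_true.2 (hdich B' hB'' w hw.1 hw.2)]
      · rintro _ ⟨w, hw, rfl⟩
        rw [hw.2]
        exact mem_image_of_mem s (hBh w hw.1)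
    · rintro _ ⟨w, hw, rfl⟩ ⟨g, hg, he⟩
      have hgw : g = h (h w) := by
        have h1 := hexp2 w (hVD (C.F_subset_V hw))
        rw [← he, hs1 g (hVD (C.G_subset_V hg))] at h1
        exact sub_left_injective h1
      subst hgw
      obtain ⟨B', hB', hwB'⟩ := hcov w hw hg
      rcases List.mem_cons.1 hB' with rfl | hB'l
      · exact (hkey (hdich B' hB' w hwB' he.symm a haB)).elim
      · exact ⟨_, List.mem_map.2 ⟨B', hB'l, rfl⟩, mem_image_of_mem s ⟨hwB', he.symm⟩⟩

end FreeChain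

end FixedPointFree

theorem exists_continuum_of_dist_le {a b y : ℂ} (A : Path a b) {δ : ℝ} (hδ : 0 < δ) {s : I}
    {E : Set ℂ} (hAE : ∀ t ≤ s, Metric.ball (A t) δ ⊆ E) (hy : dist y (A s) ≤ δ) :
    y ∈ closure E ∧ ∃ F, IsCompact F ∧ IsPreconnected F ∧ (∀ w ∈ F, w ∈ E ∨ w = y) ∧
      a ∈ F ∧ y ∈ F := by
  constructor
  · refine closure_mono (hAE s le_rfl) ?_
    rwa [closure_ball _ hδ.ne']
  have hI : Iic s = range fun t => min t s := by
    ext t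
    exact ⟨fun ht => ⟨t, min_eq_left ht⟩, by rintro ⟨t, rfl⟩; exact min_le_right t s⟩
  refine ⟨A '' Iic s ∪ segment ℝ (A s) y, ?_, ?_, ?_, Or.inl ⟨0, by simp, A.source⟩,
    Or.inr (right_mem_segment ..)⟩
  · refine (isClosed_Iic.isCompact.image A.continuous).union ?_
    rw [segment_eq_image_lineMap]
    exact isCompact_Icc.image (by fun_prop)
  · refine IsPreconnected.union (A s) ⟨s, by simp, rfl⟩ (left_mem_segment ..) ?_
      (convex_segment _ _).isPreconnected
    rw [hI, ← range_comp]
    exact isPreconnected_range (by fun_prop)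
  · rintro w (⟨t, ht, rfl⟩ | hw)
    · exact Or.inl (hAE t ht (Metric.mem_ball_self hδ))
    · rw [segment_eq_image_lineMap] at hw
      obtain ⟨t, ht, rfl⟩ := hw
      rcases eq_or_lt_of_le ht.2 with rfl | ht1
      · simp
      · refine Or.inl (hAE s le_rfl ?_)
        rw [Metric.mem_ball, dist_lineMap_left, Real.norm_of_nonneg ht.1, dist_comm]
        calc t * dist y (A s) ≤ t * δ := mul_le_mul_of_nonneg_left hy ht.1
          _ < δ := by nlinarith

namespace FixedPointFree

variable {h : ℂ ≃ₜ ℂ} {D V : Set ℂ} {n : ℕ} {x : ℂ}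

theorem FreeChain.false {z : ℂ} {E F G : Set ℂ} (hn : 3 ≤ n)
    (IH : ∀ j, 0 < j → j < n → NoPeriod j) (C : FreeChain h D V n x E F G z) : False := by
  have hc : Continuous fun w => h (h w) := h.continuous.comp h.continuous
  have hK : IsCompact (F ∩ (fun w => h (h w)) ⁻¹' G) :=
    C.compact_F.inter_right (C.compact_G.isClosed.preimage hc)
  obtain ⟨l, hl, hcov⟩ : ∃ l : List (Set ℂ), (∀ B ∈ l, IsPreconnected B ∧ B ⊆ E ∧
      ∀ w ∈ B, h (h w) ∈ E) ∧ ∀ a ∈ F ∩ (fun w => h (h w)) ⁻¹' G, ∃ B ∈ l, a ∈ B := by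
    refine hK.induction_on (p := fun S => ∃ l : List (Set ℂ), (∀ B ∈ l, IsPreconnected B ∧ B ⊆ E ∧
      ∀ w ∈ B, h (h w) ∈ E) ∧ ∀ a ∈ S, ∃ B ∈ l, a ∈ B) ⟨[], by simp, by simp⟩ ?_ ?_ ?_
    · rintro S T hST ⟨l, hl, hT⟩
      exact ⟨l, hl, fun a ha => hT a (hST ha)⟩
    · rintro S T ⟨l, hl, hS⟩ ⟨m, hm, hT⟩
      refine ⟨l ++ m, fun B hB => ?_, ?_⟩
      · rcases List.mem_append.1 hB with h1 | h1
        exacts [hl B h1, hm B h1]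
      · rintro a (ha | ha)
        · obtain ⟨B, hB, haB⟩ := hS a ha
          exact ⟨B, List.mem_append_left _ hB, haB⟩
        · obtain ⟨B, hB, haB⟩ := hT a ha
          exact ⟨B, List.mem_append_right _ hB, haB⟩
    · rintro a ⟨haF, haG⟩
      obtain ⟨haE, hbE⟩ := C.mem_of_bad haF haG
      obtain ⟨r, hr, hrE⟩ := Metric.isOpen_iff.1 (C.isOpen.inter (C.isOpen.preimage hc)) a
        ⟨haE, hbE⟩
      exact ⟨_, mem_nhdsWithin_of_mem_nhds (Metric.ball_mem_nhds a hr), [Metric.ball a r],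
        by simpa using ⟨(convex_ball a r).isPreconnected, fun w hw => (hrE hw).1,
          fun w hw => (hrE hw).2⟩, by simp⟩
  exact C.false_of_cover hn IH l hl fun a ha ha' => hcov a ⟨ha, ha'⟩

theorem exists_freeChain (H : FixedPointFree h D V) (hn : 2 ≤ n) (horb : ∀ k < n, h^[k] x ∈ V)
    (hper : h^[n] x = x) : ∃ E F G z, FreeChain h D V n x E F G z := by
  have hx0 : x ∈ V := horb 0 (by omega)
  have hx1 : h x ∈ V := horb 1 (by omega)
  have hV : IsPathConnected V := H.isOpen'.isConnected_iff_isPathConnected.1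
    ⟨⟨x, hx0⟩, H.isPreconnected'⟩
  obtain ⟨A, hA⟩ := hV.joinedIn x hx0 (h x) hx1
  have hAc : IsCompact (range A) := isCompact_range A.continuous
  obtain ⟨ρ, ⟨hρV, hρx⟩, hρ⟩ := (((hAc.eventually_thickening_subset H.isOpen'
    (range_subset_iff.2 hA)).and (eventually_thickening_image_disjoint (h := h)
      (isCompact_singleton (x := x)) (isCompact_singleton (x := x)) (by
      rintro _ rfl; exact H.ne _ (H.subset hx0)))).and self_mem_nhdsWithin).exists
  replace hρ : 0 < ρ := hρ
  simp only [Metric.thickening_singleton, Metric.mem_ball] at hρx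
  obtain ⟨δ, hδ, hδρ⟩ := exists_between hρ
  have hV' : ∀ {y t}, dist y (A t) ≤ δ → y ∈ V := fun {y t} hy =>
    hρV (Metric.mem_thickening_iff.2 ⟨A t, mem_range_self t, hy.trans_lt hδρ⟩)
  let S : Set (ℂ × I × I) := {q | dist q.1 (A q.2.1) ≤ δ ∧ dist (h q.1) (A q.2.2) ≤ δ}
  have hh := h.continuous
  have hc1 : Continuous fun q : ℂ × I × I => dist q.1 (A q.2.1) := by fun_prop
  have hc2 : Continuous fun q : ℂ × I × I => dist (h q.1) (A q.2.2) := by fun_prop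
  have hS : IsCompact S := by
    refine IsCompact.of_isClosed_subset (hAc.cthickening (r := δ) |>.prod isCompact_univ)
      ((isClosed_le hc1 continuous_const).inter (isClosed_le hc2 continuous_const)) fun q hq =>
        ⟨?_, mem_univ _⟩
    exact Metric.mem_cthickening_of_dist_le _ _ _ _ (mem_range_self _) hq.1
  obtain ⟨⟨z, s, s'⟩, ⟨hz, hz'⟩, hmin⟩ := hS.exists_isMinOn (f := fun q => max q.2.1 q.2.2)
    ⟨(x, 0, 1), by simp [S, hδ.le]⟩ (by fun_prop)
  dsimp only at hz hz'
  set T := max s s' with hT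
  have hmin' : ∀ w t t', dist w (A t) ≤ δ → dist (h w) (A t') ≤ δ → T ≤ max t t' :=
    fun w t t' h1 h2 => hmin (show (w, t, t') ∈ S from ⟨h1, h2⟩)
  have hT0 : 0 < T := by
    by_contra! h0
    have h1 : s = 0 := le_antisymm ((le_max_left _ _).trans h0) s.2.1
    have h2 : s' = 0 := le_antisymm ((le_max_right _ _).trans h0) s'.2.1
    rw [h1, A.source] at hz
    rw [h2, A.source] at hz'
    exact hρx z (hz.trans_lt hδρ) (hz'.trans_lt hδρ)
  have hlt : ∀ w, w ∈ Metric.thickening δ (A '' Iic T) → ∃ t < T, dist w (A t) < δ := by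
    intro w hw
    obtain ⟨_, ⟨t, ht, rfl⟩, hwt⟩ := Metric.mem_thickening_iff.1 hw
    rcases eq_or_lt_of_le (mem_Iic.1 ht) with rfl | ht
    · obtain ⟨l, hl, hlT⟩ := exists_Ioc_subset_of_mem_nhds
        ((isOpen_lt (f := fun t => dist w (A t)) (by fun_prop) continuous_const).mem_nhds hwt)
        ⟨0, hT0⟩
      obtain ⟨t, ht1, ht2⟩ := exists_between hl
      exact ⟨t, ht2, hlT ⟨ht1, ht2.le⟩⟩
    · exact ⟨t, ht, hwt⟩
  have hball : ∀ t ≤ T, Metric.ball (A t) δ ⊆ Metric.thickening δ (A '' Iic T) := fun t ht w hw =>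
    Metric.mem_thickening_iff.2 ⟨A t, mem_image_of_mem _ ht, hw⟩
  obtain ⟨hzE, F, hF, hF', hFE, hxF, hzF⟩ := exists_continuum_of_dist_le A hδ
    (fun t ht => hball t (ht.trans (le_max_left _ _))) hz
  obtain ⟨hzE', G, hG, hG', hGE, hxG, hzG⟩ := exists_continuum_of_dist_le A hδ
    (fun t ht => hball t (ht.trans (le_max_right _ _))) hz'
  have hI : Iic T = range fun t => min t T := by
    ext t
    exact ⟨fun ht => ⟨t, min_eq_left ht⟩, by rintro ⟨t, rfl⟩; exact min_le_right t T⟩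
  refine ⟨_, F, G, z,
    { fpf := H
      orbit := horb
      period := hper
      isOpen := Metric.isOpen_thickening
      isPreconnected := ?_
      subset := ?_
      free := ?_
      mem := hV' hz
      mem' := hV' hz'
      mem_closure := hzE
      mem_closure' := hzE'
      compact_F := hF
      compact_G := hG
      conn_F := hF'
      conn_G := hG'
      F_subset := hFE
      G_subset := hGE
      x_mem_F := hxF
      x_mem_G := hxG
      z_mem_F := hzF
      z_mem_G := hzG }⟩
  · refine IsPreconnected.thickening ?_ δ
    rw [hI, ← range_comp]
    exact isPreconnected_range (by fun_prop)
  · intro w hw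
    obtain ⟨t, -, ht⟩ := hlt w hw
    exact hV' ht.le
  · intro w hw hw'
    obtain ⟨t, ht, hwt⟩ := hlt w hw
    obtain ⟨t', ht', hwt'⟩ := hlt _ hw'
    exact (hmin' w t t' hwt.le hwt'.le).not_gt (max_lt ht ht')

theorem noPeriod {n : ℕ} (hn : 0 < n) : NoPeriod n := by
  induction n using Nat.strong_induction_on with
  | _ n ih =>
    obtain rfl | rfl | hn3 : n = 1 ∨ n = 2 ∨ 3 ≤ n := by omega
    · exact noPeriod_one
    · exact noPeriod_two
    · intro h D V H x horb hper
      obtain ⟨E, F, G, z, C⟩ := H.exists_freeChain (by omega) horb hper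
      exact C.false hn3 fun j hj hjn => ih j hjn hj

end FixedPointFree

theorem LogChange.symm {X : Type*} [TopologicalSpace X] {f : X → ℂ} {a b : X} {γ : Path a b} {d : ℂ}
    (h : LogChange (fun t => f (γ t)) d) : LogChange (fun t => f (γ.symm t)) (-d) := by
  obtain ⟨l, hl, hl1, rfl⟩ := h
  exact ⟨fun t => l (σ t), hl.comp unitInterval.continuous_symm, fun t => hl1 _, by simp⟩

/-- A function on a domain whose logarithm does not change along any loop has a logarithm. -/
theorem exists_log_of_loops {D : Set ℂ} (hD : IsOpen D) (hD' : IsPreconnected D) {f : ℂ → ℂ}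
    (hf : ContinuousOn f D) (hf0 : ∀ z ∈ D, f z ≠ 0)
    (hloop : ∀ (a : ℂ) (γ : Path a a), (∀ t, γ t ∈ D) → LogChange (fun t => f (γ t)) 0) :
    ∃ l : ℂ → ℂ, ContinuousOn l D ∧ ∀ z ∈ D, exp (l z) = f z := by
  rcases D.eq_empty_or_nonempty with rfl | ⟨x₀, hx₀⟩
  · exact ⟨0, by simp, by simp⟩
  have hDp : IsPathConnected D := hD.isConnected_iff_isPathConnected.1 ⟨⟨x₀, hx₀⟩, hD'⟩
  have hex : ∀ z, ∃ d, z ∈ D →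
      ∃ γ : Path x₀ z, (∀ t, γ t ∈ D) ∧ LogChange (fun t => f (γ t)) d := fun z => by
    by_cases hz : z ∈ D
    · obtain ⟨γ, hγ⟩ := hDp.joinedIn x₀ hx₀ z hz
      obtain ⟨d, hd⟩ := LogChange.exists_of_continuous (hf.comp_continuous γ.continuous hγ)
        fun t => hf0 _ (hγ t)
      exact ⟨d, fun _ => ⟨γ, hγ, hd⟩⟩
    · exact ⟨0, fun h => (hz h).elim⟩
  choose d hd using hex
  refine ⟨fun z => log (f x₀) + d z, fun z hz => ?_, fun z hz => ?_⟩
  · obtain ⟨r, hr, hrD⟩ := Metric.isOpen_iff.1 hD z hz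
    obtain ⟨m, hm, hm1⟩ := (convex_ball z r).exists_log (hf.mono hrD) fun w hw => hf0 w (hrD hw)
    obtain ⟨γ, hγ, hγd⟩ := hd z hz
    have hB := Metric.ball_mem_nhds z hr
    refine ContinuousAt.continuousWithinAt ?_
    refine ((continuousAt_const (y := log (f x₀) + (d z - m z))).add
      (hm.continuousAt hB)).congr ?_
    filter_upwards [hB] with w hw
    obtain ⟨γ', hγ', hγd'⟩ := hd w (hrD hw)
    obtain ⟨β, hβ⟩ := ((convex_ball z r).isPathConnected ⟨z, Metric.mem_ball_self hr⟩).joinedIn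
      z (Metric.mem_ball_self hr) w hw
    have hβm := LogChange.of_log hm hm1 β.continuous hβ
    have hsum := (hγd.trans hβm).trans hγd'.symm
    have h0 := hloop x₀ ((γ.trans β).trans γ'.symm) fun t => by
      have ht := mem_range_self (f := (γ.trans β).trans γ'.symm) t
      rw [Path.trans_range, Path.trans_range, Path.symm_range] at ht
      rcases ht with (⟨s, hs⟩ | ⟨s, hs⟩) | ⟨s, hs⟩ <;> rw [← hs]
      exacts [hγ s, hrD (hβ s), hγ' s]
    have := hsum.unique h0
    rw [β.source, β.target] at this
    simp only [Pi.add_apply]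
    linear_combination this
  · obtain ⟨γ, hγ, hγd⟩ := hd z hz
    have := hγd.exp_mul_eq
    rw [γ.source, γ.target] at this
    rw [exp_add, exp_log (hf0 _ hx₀), mul_comm, this]

theorem logChange_sub_congr {γ : I → ℂ} (hγ : Continuous γ) (hloop : γ 1 = γ 0) {X : Set ℂ}
    (hX : IsPreconnected X) (hγX : ∀ t, γ t ∉ X) {p q : ℂ} (hp : p ∈ X) (hq : q ∈ X)
    (h : LogChange (fun t => γ t - p) 0) : LogChange (fun t => γ t - q) 0 := by
  have key : ∀ p ∈ X, ∃ ε > 0, ∀ q, dist q p < ε →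
      LogChange (fun t => (γ t - q) / (γ t - p)) 0 := by
    intro p hp
    have hne : ∀ t, γ t - p ≠ 0 := fun t h => hγX t (sub_eq_zero.1 h ▸ hp)
    obtain ⟨t₀, -, ht₀⟩ := isCompact_univ.exists_isMinOn (f := fun t => ‖γ t - p‖)
      (univ_nonempty (α := I)) (by fun_prop)
    refine ⟨‖γ t₀ - p‖, norm_pos_iff.2 (hne _), fun q hq => ?_⟩
    have := LogChange.of_slitPlane (φ := fun t => (γ t - q) / (γ t - p))
      ((hγ.sub continuous_const).div (hγ.sub continuous_const) hne) fun t => ?_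
    · rwa [hloop, sub_self] at this
    · refine Complex.ball_one_subset_slitPlane ?_
      have h1 : ‖γ t₀ - p‖ ≤ ‖γ t - p‖ := ht₀ (mem_univ t)
      have h2 : (γ t - q) / (γ t - p) - 1 = (p - q) / (γ t - p) := by
        rw [div_sub_one (hne t)]
        ring
      rw [mem_ball_iff_norm, h2, norm_div, div_lt_one (norm_pos_iff.2 (hne t)), ← dist_eq_norm,
        dist_comm]
      exact hq.trans_le h1
  have hmul : ∀ p q, LogChange (fun t => (γ t - q) / (γ t - p)) 0 → (∀ t, γ t ≠ p) →
      LogChange (fun t => γ t - p) 0 → LogChange (fun t => γ t - q) 0 := by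
    intro p q h1 h2 h3
    have := h1.mul h3
    rw [add_zero] at this
    exact this.congr fun t => div_mul_cancel₀ _ (sub_ne_zero.2 (h2 t))
  have hγX' : ∀ p ∈ X, ∀ t, γ t ≠ p := fun p hp t he => hγX t (he ▸ hp)
  have hinv : ∀ p q, LogChange (fun t => (γ t - q) / (γ t - p)) 0 →
      LogChange (fun t => (γ t - p) / (γ t - q)) 0 := by
    rintro p q ⟨l, hl, hl1, hl0⟩
    refine ⟨fun t => -l t, hl.neg, fun t => ?_, ?_⟩
    · rw [exp_neg, hl1, inv_div]
    · linear_combination -hl0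
  refine (hX.induction₂' (fun p q => LogChange (fun t => γ t - p) 0 →
    LogChange (fun t => γ t - q) 0)
    (fun p hp => ?_) (fun _ _ _ _ _ _ h1 h2 h3 => h2 (h1 h3)) hp hq) h
  obtain ⟨ε, hε, hq⟩ := key p hp
  filter_upwards [mem_nhdsWithin_of_mem_nhds (Metric.ball_mem_nhds p hε), self_mem_nhdsWithin]
    with q h1 h2
  exact ⟨hmul p q (hq q h1) (hγX' p hp), hmul q p (hinv p q (hq q h1)) (hγX' q h2)⟩

theorem exists_hasLogs_nhds {K P : Set ℂ} (hK : IsCompact K) (hKc : IsConnected K)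
    (hK' : IsConnected Kᶜ) (hP : IsClosed P) (hKP : Disjoint K P) :
    ∃ D, IsOpen D ∧ IsPreconnected D ∧ HasLogs D ∧ K ⊆ D ∧ Disjoint D P := by
  have hO : IsPathConnected Kᶜ := hK.isClosed.isOpen_compl.isConnected_iff_isPathConnected.1 hK'
  obtain ⟨R, hR⟩ := hK.isBounded.subset_ball 0
  have hq : (R : ℂ) ∈ Kᶜ := fun h => by
    have := hR h
    rw [mem_ball_zero_iff, norm_real, Real.norm_eq_abs] at this
    exact this.not_ge (le_abs_self R)
  obtain ⟨L, hLc, hLp, hLK, hqL, hPL⟩ : ∃ L, IsCompact L ∧ IsPreconnected L ∧ L ⊆ Kᶜ ∧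
      (R : ℂ) ∈ L ∧ P ∩ Metric.closedBall 0 R ⊆ L := by
    refine ((isCompact_closedBall 0 R).inter_left hP).induction_on (p := fun S => ∃ L,
      IsCompact L ∧ IsPreconnected L ∧ L ⊆ Kᶜ ∧ (R : ℂ) ∈ L ∧ S ⊆ L)
      ⟨{(R : ℂ)}, isCompact_singleton, isPreconnected_singleton, by simpa using hq, by simp⟩
      ?_ ?_ ?_
    · rintro S T hST ⟨L, h1, h2, h3, h4, h5⟩
      exact ⟨L, h1, h2, h3, h4, hST.trans h5⟩
    · rintro S T ⟨L, h1, h2, h3, h4, h5⟩ ⟨M, m1, m2, m3, m4, m5⟩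
      exact ⟨L ∪ M, h1.union m1, h2.union _ h4 m4 m2, union_subset h3 m3, Or.inl h4,
        union_subset_union h5 m5⟩
    · rintro p ⟨hpP, -⟩
      have hpK : p ∈ Kᶜ := fun hp => Set.disjoint_left.1 hKP hp hpP
      obtain ⟨r, hr, hrK⟩ := Metric.nhds_basis_closedBall.mem_iff.1
        (hK.isClosed.isOpen_compl.mem_nhds hpK)
      obtain ⟨γ, hγ⟩ := hO.joinedIn p hpK R hq
      refine ⟨Metric.closedBall p r,
        mem_nhdsWithin_of_mem_nhds (Metric.closedBall_mem_nhds p hr),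
        Metric.closedBall p r ∪ range γ, (isCompact_closedBall p r).union
          (isCompact_range γ.continuous), ?_, union_subset hrK (range_subset_iff.2 hγ),
        Or.inr ⟨1, γ.target⟩, subset_union_left⟩
      exact (convex_closedBall p r).isPreconnected.union p (Metric.mem_closedBall_self hr.le)
        ⟨0, γ.source⟩ (isPreconnected_range γ.continuous)
  set D₀ : Set ℂ := Metric.ball 0 R \ L with hD₀
  have hD₀o : IsOpen D₀ := Metric.isOpen_ball.sdiff hLc.isClosed
  have hKD₀ : K ⊆ D₀ := fun z hz => ⟨hR hz, fun h => hLK h hz⟩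
  obtain ⟨x₀, hx₀⟩ := hKc.nonempty
  have hDo : IsOpen (connectedComponentIn D₀ x₀) := hD₀o.connectedComponentIn
  have hDD₀ := connectedComponentIn_subset D₀ x₀
  have hDo' : IsOpen (D₀ \ connectedComponentIn D₀ x₀) := by
    refine isOpen_iff_mem_nhds.2 fun z hz => ?_
    refine mem_of_superset (hD₀o.connectedComponentIn.mem_nhds (mem_connectedComponentIn hz.1))
      fun w hw => ⟨connectedComponentIn_subset _ _ hw, fun hw' => hz.2 ?_⟩
    rw [connectedComponentIn_eq hw', ← connectedComponentIn_eq hw]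
    exact mem_connectedComponentIn hz.1
  refine ⟨connectedComponentIn D₀ x₀, hDo, isPreconnected_connectedComponentIn, ?_,
    hKc.isPreconnected.subset_connectedComponentIn hx₀ hKD₀, ?_⟩
  · intro f hf hf0
    refine exists_log_of_loops hDo isPreconnected_connectedComponentIn hf hf0 fun a γ hγ => ?_
    classical
    set g : ℂ → ℂ := (connectedComponentIn D₀ x₀).piecewise f 1 with hg
    have hgf : EqOn g f (connectedComponentIn D₀ x₀) := piecewise_eqOn ..
    have hg1 : EqOn g 1 (D₀ \ connectedComponentIn D₀ x₀) := fun z hz =>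
      piecewise_eq_of_notMem _ _ _ hz.2
    have hgc : ContinuousOn g D₀ := by
      rw [← union_sdiff_cancel hDD₀]
      exact ContinuousOn.union_of_isOpen (hf.congr hgf) (continuousOn_const.congr hg1) hDo hDo'
    have hg0 : ∀ z ∈ D₀, g z ≠ 0 := fun z hz => by
      by_cases hzD : z ∈ connectedComponentIn D₀ x₀
      · rw [hgf hzD]
        exact hf0 z hzD
      · rw [hg1 ⟨hz, hzD⟩]
        exact one_ne_zero
    have hfar : ∀ p : ℂ, R ≤ ‖p‖ → LogChange (fun t => γ t - p) 0 := fun p hp => by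
      have hne : ∀ w ∈ Metric.ball (0 : ℂ) R, w - p ≠ 0 := fun w hw h => by
        rw [sub_eq_zero.1 h, mem_ball_zero_iff] at hw
        exact hw.not_ge hp
      obtain ⟨l, hl, hl1⟩ := (convex_ball (0 : ℂ) R).exists_log (f := fun w => w - p)
        (by fun_prop) hne
      have := LogChange.of_log hl hl1 γ.continuous fun t => (hDD₀ (hγ t)).1
      rwa [γ.source, γ.target, sub_self] at this
    refine (logChange_eq_zero_of_winding hD₀o γ.continuous (by simp) (fun t => hDD₀ (hγ t))
      (fun p hp => ?_) hgc hg0).congr fun t => hgf (hγ t)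
    by_cases hpR : R ≤ ‖p‖
    · exact hfar p hpR
    · have hpL : p ∈ L := by
        by_contra hpL
        exact hp ⟨by simpa using hpR, hpL⟩
      refine logChange_sub_congr γ.continuous (by simp) hLp (fun t => (hDD₀ (hγ t)).2) hqL hpL
        (hfar _ ?_)
      rw [norm_real, Real.norm_eq_abs]
      exact le_abs_self R
  · refine Set.disjoint_left.2 fun z hz hzP => (hDD₀ hz).2 (hPL ⟨hzP, ?_⟩)
    exact Metric.ball_subset_closedBall (hDD₀ hz).1

theorem PlaneIsotopic.exists_fixed_of_orbit {h : ℂ ≃ₜ ℂ} (hh : PlaneIsotopic h) {C : Set ℂ}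
    (hC : IsCompact C) (hC' : IsConnected C) (hacyc : IsConnected (h ⁻¹' C ∪ C)ᶜ)
    (horb : (∃ c ∈ C, ∀ i : ℕ, 0 < i → h.symm^[i] c ∈ C) ∨
      ∃ c ∈ C, ∀ i : ℕ, 0 < i → h^[i] c ∈ C) : ∃ x ∈ C, h x = x := by
  by_contra! hfix
  have hX : IsCompact (h ⁻¹' C) := h.isCompact_preimage.2 hC
  have hX' : IsConnected (h ⁻¹' C) := h.isConnected_preimage.2 hC'
  have hrec : ∃ y ∈ h ⁻¹' C, ∀ T ∈ 𝓝 y, ∃ x ∈ T, ∃ j > 0, h^[j] x ∈ T ∧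
      ∀ k < j, h^[k] x ∈ h ⁻¹' C := by
    rcases horb with ⟨c, hc, hcC⟩ | ⟨c, hc, hcC⟩
    · have hinv : ∀ m k, h^[k] (h.symm^[m + k] c) = h.symm^[m] c := fun m k => by
        rw [add_comm, Function.iterate_add_apply]
        exact Function.LeftInverse.iterate h.apply_symm_apply k _
      have hu : ∀ i, h.symm^[i + 1] c ∈ h ⁻¹' C := fun i => by
        rw [mem_preimage, Function.iterate_succ_apply', h.apply_symm_apply]
        rcases Nat.eq_zero_or_pos i with rfl | hi
        exacts [hc, hcC i hi]
      obtain ⟨y, hy, φ, hφ, hlim⟩ := hX.tendsto_subseq hu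
      refine ⟨y, hy, fun T hT => ?_⟩
      obtain ⟨N, hN⟩ := eventually_atTop.1 (hlim.eventually hT)
      have hlt : φ N < φ (N + 1) := hφ N.lt_succ_self
      refine ⟨_, hN (N + 1) (by omega), φ (N + 1) - φ N, by omega, ?_, fun k hk => ?_⟩
      · have h1 : φ (N + 1) + 1 = φ N + 1 + (φ (N + 1) - φ N) := by omega
        have h2 := hN N le_rfl
        dsimp only [Function.comp] at h2 ⊢
        rwa [h1, hinv]
      · have h1 : φ (N + 1) + 1 = (φ (N + 1) - k) + 1 + k := by omega
        dsimp only [Function.comp]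
        rw [h1, hinv]
        exact hu _
    · have hu : ∀ i, h^[i] c ∈ h ⁻¹' C := fun i => by
        rw [mem_preimage, ← Function.iterate_succ_apply' h]
        exact hcC _ (Nat.succ_pos i)
      obtain ⟨y, hy, φ, hφ, hlim⟩ := hX.tendsto_subseq hu
      refine ⟨y, hy, fun T hT => ?_⟩
      obtain ⟨N, hN⟩ := eventually_atTop.1 (hlim.eventually hT)
      have hlt : φ N < φ (N + 1) := hφ N.lt_succ_self
      refine ⟨_, hN N le_rfl, φ (N + 1) - φ N, by omega, ?_, fun k hk => ?_⟩
      · have h2 := hN (N + 1) (by omega)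
        dsimp only [Function.comp] at h2 ⊢
        rwa [← Function.iterate_add_apply, Nat.sub_add_cancel hlt.le]
      · dsimp only [Function.comp]
        rw [← Function.iterate_add_apply]
        exact hu _
  obtain ⟨y, hy, hrec⟩ := hrec
  have hcap : (h ⁻¹' C ∩ C).Nonempty := by
    rcases horb with ⟨c, hc, hcC⟩ | ⟨c, hc, hcC⟩
    · exact ⟨h.symm c, by simpa using hc, hcC 1 one_pos⟩
    · exact ⟨c, hcC 1 one_pos, hc⟩
  obtain ⟨D, hDo, hDc, hDl, hKD, hDP⟩ := exists_hasLogs_nhds (hX.union hC)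
    (hX'.union hcap hC') hacyc (isClosed_eq h.continuous continuous_id) (by
      refine Set.disjoint_left.2 fun z hz (hzf : h z = z) => ?_
      rcases hz with hz | hz
      · rw [mem_preimage, hzf] at hz
        exact hfix z hz hzf
      · exact hfix z hz hzf)
  have hWo : IsOpen (D ∩ h ⁻¹' D) := hDo.inter (hDo.preimage h.continuous)
  have hXW : h ⁻¹' C ⊆ connectedComponentIn (D ∩ h ⁻¹' D) y :=
    hX'.isPreconnected.subset_connectedComponentIn hy fun z hz =>
      ⟨hKD (Or.inl hz), hKD (Or.inr hz)⟩
  have H : FixedPointFree h D (connectedComponentIn (D ∩ h ⁻¹' D) y) :=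
    { isotopic := hh
      isOpen := hDo
      isPreconnected := hDc
      hasLogs := hDl
      ne := fun z hz hzf => Set.disjoint_left.1 hDP hz hzf
      isOpen' := hWo.connectedComponentIn
      isPreconnected' := isPreconnected_connectedComponentIn
      subset := fun z hz => (connectedComponentIn_subset _ _ hz).1
      mapsTo := fun z hz => (connectedComponentIn_subset _ _ hz).2 }
  have hyD : y ∈ D := hKD (Or.inl hy)
  obtain ⟨δ, ⟨h1, h2⟩, hδ⟩ := (((isCompact_singleton.eventually_thickening_subset hDo
    (singleton_subset_iff.2 hyD)).and (eventually_thickening_image_disjoint (h := h)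
      (isCompact_singleton (x := y)) (isCompact_singleton (x := y)) (by
      rintro _ rfl; exact H.ne _ hyD))).and self_mem_nhdsWithin).exists
  obtain ⟨x, hx, j, hj, hjT, hjX⟩ := hrec _ (Metric.isOpen_thickening.mem_nhds
    (Metric.self_subset_thickening hδ {y} rfl))
  exact H.not_return (fun i hi _ => FixedPointFree.noPeriod hi) Metric.isOpen_thickening
    (isPreconnected_singleton.thickening δ) h1 h2 hx hj (Nat.lt_succ_self j)
    (fun k hk => hXW (hjX k hk)) hjT

end PlaneTopology

/-- **Theorem 1 (Boroński).** If `h` is an orientation preserving planar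
homeomorphism, `C` a continuum with `h⁻¹(C) ∪ C` acyclic, and some `c ∈ C` has
its whole backward orbit, or its whole forward orbit, contained in `C`, then
`C` contains a fixed point of `h`. -/
theorem fixed_point_of_orbit_in_continuum
    (h : (ℝ × ℝ) ≃ₜ (ℝ × ℝ)) (hor : IsotopicToIdentity h)
    (C : Set (ℝ × ℝ)) (hC : IsContinuum C)
    (hacyc : IsAcyclic (⇑h ⁻¹' C ∪ C))
    (horb : (∃ c ∈ C, ∀ i : ℕ, 0 < i → (⇑h.symm)^[i] c ∈ C) ∨
            (∃ c ∈ C, ∀ i : ℕ, 0 < i → (⇑h)^[i] c ∈ C)) :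
    ∃ x ∈ C, h x = x := by
  let e : ℂ ≃ₜ ℝ × ℝ := Complex.equivRealProdCLM.toHomeomorph
  let h' : ℂ ≃ₜ ℂ := e.trans (h.trans e.symm)
  have hh' : ∀ z, h' z = e.symm (h (e z)) := fun z => rfl
  have hiso : PlaneIsotopic h' := by
    obtain ⟨F, hF, hFg, hF0, hF1⟩ := hor
    refine ⟨fun t z => e.symm (F t (e z)), ?_, fun t => ?_, fun z => ?_, fun z => ?_⟩
    · exact e.symm.continuous.comp (hF.comp ((continuous_subtype_val.comp continuous_fst).prodMk
        (e.continuous.comp continuous_snd)))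
    · obtain ⟨g, hg⟩ := hFg t
      have hgi : Function.Injective (F t) := hg ▸ g.injective
      exact e.symm.injective.comp (hgi.comp e.injective)
    · simp [hF0]
    · simp [hF1, hh']
  have hpre : h' ⁻¹' (e ⁻¹' C) ∪ e ⁻¹' C = e ⁻¹' (h ⁻¹' C ∪ C) := by
    ext z
    simp [hh']
  have hsymm : ∀ i w, h'.symm^[i] (e.symm w) = e.symm (h.symm^[i] w) := fun i w =>
    Function.Semiconj.iterate_right (f := e.symm) (ga := h.symm) (gb := h'.symm)
      (fun w => congrArg (fun w => e.symm (h.symm w)) (e.apply_symm_apply w)) i w |>.symm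
  have hiter : ∀ i w, h'^[i] (e.symm w) = e.symm (h^[i] w) := fun i w =>
    Function.Semiconj.iterate_right (f := e.symm) (ga := h) (gb := h')
      (fun w => congrArg (fun w => e.symm (h w)) (e.apply_symm_apply w).symm) i w |>.symm
  obtain ⟨x, hxC, hx⟩ := hiso.exists_fixed_of_orbit (e.isCompact_preimage.2 hC.1)
    (e.isConnected_preimage.2 hC.2.1) (by
      rw [hpre, ← Set.preimage_compl]
      exact e.isConnected_preimage.2 hacyc) (by
      refine horb.imp ?_ ?_ <;> rintro ⟨c, hc, hcC⟩ <;> refine ⟨e.symm c, by simpa using hc, ?_⟩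
      · intro i hi
        rw [hsymm]
        simpa using hcC i hi
      · intro i hi
        rw [hiter]
        simpa using hcC i hi)
  refine ⟨e x, hxC, e.symm.injective ?_⟩
  rw [← hh', hx, e.symm_apply_apply]
end

section
/- Let h : ℝ² → ℝ² be an orientation preserving homeomorphism and let C ⊆ ℝ² be a continuum such that h⁻¹(C) ∪ C is acyclic. If C contains a periodic orbit of h (i.e., there is c ∈ C and k ≥ 1 with hᵏ(c) = c and hⁱ(c) ∈ C for all i), then C contains a fixed point of h. Equivalently, if h has no fixed point in C then C contains no periodic orbit of h. -/
section

open Set Topology unitInterval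

/-- `f` has a continuous logarithm on `s`. -/
def HasLogOn {X : Type*} [TopologicalSpace X] (f : X → ℂ) (s : Set X) : Prop :=
  ∃ l : X → ℂ, ContinuousOn l s ∧ ∀ x ∈ s, Complex.exp (l x) = f x

theorem exists_log_homotopy_s1 {A : Type*} [TopologicalSpace A] {q : I × A → ℂ}
    (hq : Continuous q) (hne : ∀ p, q p ≠ 0) {f : A → ℂ} (hf : Continuous f)
    (h0 : ∀ a, q (0, a) = Complex.exp (f a)) :
    ∃ Q : I × A → ℂ, Continuous Q ∧ (∀ p, Complex.exp (Q p) = q p) ∧ ∀ a, Q (0, a) = f a := by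
  let H : C(I × A, {z : ℂ // z ≠ 0}) := ⟨fun p => ⟨q p, hne p⟩, by fun_prop⟩
  have H0 : ∀ a, H (0, a) = (fun z : ℂ ↦ (⟨_, z.exp_ne_zero⟩ : {z : ℂ // z ≠ 0}))
      ((⟨f, hf⟩ : C(A, ℂ)) a) := fun a => Subtype.ext (h0 a)
  refine ⟨Complex.isCoveringMap_exp.liftHomotopy H ⟨f, hf⟩ H0, map_continuous _, fun p => ?_,
    fun a => Complex.isCoveringMap_exp.liftHomotopy_zero H ⟨f, hf⟩ H0 a⟩
  have := congrFun (Complex.isCoveringMap_exp.liftHomotopy_lifts H ⟨f, hf⟩ H0) p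
  exact congrArg Subtype.val this

theorem IsPreconnected.eq_of_exp_eq_one {X : Type*} [TopologicalSpace X] {s : Set X}
    (hs : IsPreconnected s) {g : X → ℂ} (hg : ContinuousOn g s)
    (h1 : ∀ x ∈ s, Complex.exp (g x) = 1) {x y : X} (hx : x ∈ s) (hy : y ∈ s) : g x = g y := by
  have hd : DiscreteTopology (AddSubgroup.zmultiples (2 * Real.pi * Complex.I : ℂ)) :=
    NormedSpace.discreteTopology_zmultiples _
  refine hs.constant_of_mapsTo (T := (AddSubgroup.zmultiples (2 * Real.pi * Complex.I : ℂ) : Set ℂ))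
    (hT := ⟨hd⟩) hg (fun x hx => ?_) hx hy
  obtain ⟨n, hn⟩ := Complex.exp_eq_one_iff.1 (h1 x hx)
  exact ⟨n, by simp [hn]⟩

theorem HasLogOn.mul {X : Type*} [TopologicalSpace X] {f g : X → ℂ} {s : Set X}
    (hf : HasLogOn f s) (hg : HasLogOn g s) : HasLogOn (fun x => f x * g x) s := by
  obtain ⟨l, hl, hle⟩ := hf
  obtain ⟨m, hm, hme⟩ := hg
  exact ⟨fun x => l x + m x, hl.add hm, fun x hx => by rw [Complex.exp_add, hle x hx, hme x hx]⟩

theorem HasLogOn.zpow {X : Type*} [TopologicalSpace X] {f : X → ℂ} {s : Set X}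
    (hf : HasLogOn f s) (k : ℤ) : HasLogOn (fun x => f x ^ k) s := by
  obtain ⟨l, hl, hle⟩ := hf
  exact ⟨fun x => k * l x, continuousOn_const.mul hl, fun x hx => by
    rw [Complex.exp_int_mul, hle x hx]⟩

theorem HasLogOn.congr {X : Type*} [TopologicalSpace X] {f g : X → ℂ} {s : Set X}
    (hf : HasLogOn f s) (h : ∀ x ∈ s, f x = g x) : HasLogOn g s := by
  obtain ⟨l, hl, hle⟩ := hf
  exact ⟨l, hl, fun x hx => (hle x hx).trans (h x hx)⟩

theorem HasLogOn.mono {X : Type*} [TopologicalSpace X] {f : X → ℂ} {s t : Set X}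
    (hf : HasLogOn f s) (h : t ⊆ s) : HasLogOn f t := by
  obtain ⟨l, hl, hle⟩ := hf
  exact ⟨l, hl.mono h, fun x hx => hle x (h hx)⟩

theorem hasLogOn_of_mem_slitPlane {X : Type*} [TopologicalSpace X] {f : X → ℂ} {s : Set X}
    (hf : ContinuousOn f s) (h : ∀ x ∈ s, f x ∈ Complex.slitPlane) : HasLogOn f s :=
  ⟨fun x => Complex.log (f x), hf.clog h, fun x hx =>
    Complex.exp_log (Complex.slitPlane_ne_zero (h x hx))⟩

theorem hasLogOn_const {X : Type*} [TopologicalSpace X] {c : ℂ} (hc : c ≠ 0) (s : Set X) :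
    HasLogOn (fun _ => c) s :=
  ⟨fun _ => Complex.log c, continuousOn_const, fun _ _ => Complex.exp_log hc⟩

/-- A nonvanishing continuous function on a closed disc has a continuous logarithm. -/
theorem hasLogOn_closedBall {f : ℂ → ℂ} {r : ℝ} (hr : 0 ≤ r)
    (hf : ContinuousOn f (Metric.closedBall 0 r))
    (hne : ∀ z ∈ Metric.closedBall (0 : ℂ) r, f z ≠ 0) : HasLogOn f (Metric.closedBall 0 r) := by
  have hmem : ∀ (t : I) (z : Metric.closedBall (0 : ℂ) r),
      (t : ℝ) • (z : ℂ) ∈ Metric.closedBall (0 : ℂ) r := by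
    intro t z
    have := mem_closedBall_zero_iff.1 z.2
    rw [mem_closedBall_zero_iff, norm_smul, Real.norm_of_nonneg t.2.1]
    exact (mul_le_of_le_one_left (norm_nonneg _) t.2.2).trans this
  have hc : Continuous (fun p : I × Metric.closedBall (0 : ℂ) r => f ((p.1 : ℝ) • (p.2 : ℂ))) :=
    hf.comp_continuous (by fun_prop) fun p => hmem _ _
  obtain ⟨Q, hQ, hQe, -⟩ := exists_log_homotopy_s1 (f := fun _ => Complex.log (f 0)) hc
    (fun p => hne _ (hmem _ _)) continuous_const
    (fun a => by
      rw [Complex.exp_log (hne 0 (by simpa using hr))]; simp)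
  classical
  refine ⟨fun z => if hz : z ∈ Metric.closedBall (0 : ℂ) r then Q (1, ⟨z, hz⟩) else 0, ?_, ?_⟩
  · rw [continuousOn_iff_continuous_domRestrict]
    have : Continuous fun z : Metric.closedBall (0 : ℂ) r => Q (1, z) := by fun_prop
    convert this using 2 with z
    simp only [domRestrict_apply, dif_pos z.2]
  · intro z hz
    simp only [dif_pos hz, hQe]
    simp

/-- A nonvanishing continuous function on the real line has a continuous logarithm. -/
theorem exists_log_real {f : ℝ → ℂ} (hf : Continuous f) (hne : ∀ t, f t ≠ 0) :
    ∃ l : ℝ → ℂ, Continuous l ∧ ∀ t, Complex.exp (l t) = f t := by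
  obtain ⟨Q, hQ, hQe, -⟩ := exists_log_homotopy_s1 (A := ℝ) (q := fun p => f ((p.1 : ℝ) * p.2))
    (f := fun _ => Complex.log (f 0)) (by fun_prop) (fun p => hne _) continuous_const
    (fun a => by rw [Complex.exp_log (hne 0)]; simp)
  exact ⟨fun t => Q (1, t), by fun_prop, fun t => by simp [hQe]⟩

theorem exists_continuous_extension {X : Type*} [TopologicalSpace X] [NormalSpace X] {s : Set X}
    (hs : IsClosed s) {f : X → ℂ} (hf : ContinuousOn f s) :
    ∃ g : X → ℂ, Continuous g ∧ ∀ x ∈ s, g x = f x := by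
  obtain ⟨g, hg⟩ := ContinuousMap.exists_restrict_eq hs (⟨_, hf.domRestrict⟩ : C(s, ℂ))
  exact ⟨g, g.continuous, fun x hx => congrArg (fun k : C(s, ℂ) => k ⟨x, hx⟩) hg⟩

theorem hasLogOn_sub_iff {K : Set ℂ} {a b : ℂ} (h : ∀ z ∈ K, ‖a - b‖ < ‖z - a‖) :
    HasLogOn (fun z => z - a) K ↔ HasLogOn (fun z => z - b) K := by
  have hne : ∀ z ∈ K, z - a ≠ 0 := fun z hz h0 => by
    have := h z hz
    rw [h0, norm_zero] at this
    exact absurd (norm_nonneg _) this.not_ge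
  have hs : ∀ z ∈ K, (z - b) / (z - a) ∈ Complex.slitPlane := fun z hz => by
    have : (z - b) / (z - a) = 1 + (a - b) / (z - a) := by
      field_simp [hne z hz]; ring
    rw [this]
    apply Complex.mem_slitPlane_of_norm_lt_one
    rw [norm_div, div_lt_one (norm_pos_iff.2 (hne z hz))]
    exact h z hz
  have hl : HasLogOn (fun z => (z - b) / (z - a)) K :=
    hasLogOn_of_mem_slitPlane (ContinuousOn.div (by fun_prop) (by fun_prop) hne) hs
  constructor
  · intro ha
    refine (ha.mul hl).congr fun z hz => ?_
    field_simp [hne z hz]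
  · intro hb
    refine (hb.mul (hl.zpow (-1))).congr fun z hz => ?_
    have h1 := hne z hz
    have h2 : z - b ≠ 0 := fun h0 => Complex.slitPlane_ne_zero (hs z hz) (by simp [h0])
    simp only [zpow_neg, zpow_one]
    field_simp

/-- If `a` lies outside a nonseparating compact set `K`, then `z - a` has a logarithm on `K`. -/
theorem hasLogOn_sub {K : Set ℂ} (hK : IsCompact K) (hKc : IsPreconnected Kᶜ) {a : ℂ}
    (ha : a ∉ K) : HasLogOn (fun z => z - a) K := by
  obtain ⟨R, hR⟩ := hK.isBounded.subset_closedBall 0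
  have hre : ∀ z ∈ K, 0 < (z - (-(R + 1) : ℝ)).re := fun z hz => by
    have h1 := mem_closedBall_zero_iff.1 (hR hz)
    have h2 := (abs_le.1 (Complex.abs_re_le_norm z)).1
    rw [Complex.sub_re, Complex.ofReal_re]
    linarith
  have hfar : ((-(R + 1) : ℝ) : ℂ) ∈ Kᶜ := fun h => by simpa using hre _ h
  refine (hKc.induction₂ (fun a b => HasLogOn (fun z => z - a) K ↔ HasLogOn (fun z => z - b) K)
    (fun x hx => ?_) (fun x y z _ _ _ h1 h2 => h1.trans h2) (fun x y _ _ h => h.symm) hfar ha).1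
    (hasLogOn_of_mem_slitPlane (by fun_prop) fun z hz => Or.inl (hre z hz))
  obtain ⟨ε, hε, hb⟩ := Metric.isOpen_iff.1 hK.isClosed.isOpen_compl x hx
  filter_upwards [mem_nhdsWithin_of_mem_nhds (Metric.ball_mem_nhds x hε)] with y hy
  refine hasLogOn_sub_iff fun z hz => ?_
  have h1 : ε ≤ dist z x := by
    by_contra! h
    exact hb h hz
  rw [Metric.mem_ball, dist_comm, dist_eq_norm] at hy
  rw [dist_eq_norm] at h1
  linarith

/-- A nonvanishing continuous function on a compact subset of the line has a logarithm. -/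
theorem hasLogOn_real {T : Set ℝ} (hT : IsCompact T) {f : ℝ → ℂ} (hf : ContinuousOn f T)
    (hne : ∀ t ∈ T, f t ≠ 0) : HasLogOn f T := by
  obtain ⟨m, hm, hmf⟩ : ∃ m > 0, ∀ t ∈ T, m ≤ ‖f t‖ := by
    rcases T.eq_empty_or_nonempty with rfl | hTn
    · exact ⟨1, one_pos, by simp⟩
    · obtain ⟨t, ht, hmin⟩ := hT.exists_isMinOn hTn hf.norm
      exact ⟨‖f t‖, norm_pos_iff.2 (hne t ht), fun s hs => hmin hs⟩
  obtain ⟨δ, hδ, hδf⟩ := Metric.uniformContinuousOn_iff.1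
    (hT.uniformContinuousOn_of_continuous hf) m hm
  have hslit : ∀ s ∈ T, ∀ t ∈ T, dist s t < δ → f s / f t ∈ Complex.slitPlane := by
    intro s hs t ht hst
    have h0 := hne t ht
    have : f s / f t = 1 + (f s - f t) / f t := by field_simp; ring
    rw [this]
    apply Complex.mem_slitPlane_of_norm_lt_one
    rw [norm_div, div_lt_one (norm_pos_iff.2 h0), ← dist_eq_norm]
    exact (hδf s hs t ht hst).trans_le (hmf t ht)
  obtain ⟨R, hR⟩ := hT.isBounded.subset_closedBall 0
  have key : ∀ n : ℕ, HasLogOn f (T ∩ Iic (-R - 1 + n * (δ / 2))) := by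
    intro n
    induction n with
    | zero =>
      refine ⟨0, continuousOn_const, fun t ht => ?_⟩
      have h1 := hR ht.1
      have h2 : t ≤ -R - 1 + (0 : ℕ) * (δ / 2) := ht.2
      rw [mem_closedBall_zero_iff, Real.norm_eq_abs, abs_le] at h1
      simp only [Nat.cast_zero, zero_mul] at h2
      linarith
    | succ n ih =>
      obtain ⟨l, hl, hle⟩ := ih
      set x := -R - 1 + n * (δ / 2) with hx
      have hx' : -R - 1 + ((n + 1 : ℕ) : ℝ) * (δ / 2) = x + δ / 2 := by
        rw [hx]; push_cast; ring
      rw [hx']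
      obtain ⟨k, hk, hke, hkx⟩ : ∃ k : ℝ → ℂ, ContinuousOn k (T ∩ Icc x (x + δ / 2)) ∧
          (∀ t ∈ T ∩ Icc x (x + δ / 2), Complex.exp (k t) = f t) ∧ (x ∈ T → k x = l x) := by
        have main : ∀ s ∈ T ∩ Icc x (x + δ / 2), ∀ c, Complex.exp c = f s →
            ContinuousOn (fun t => c + Complex.log (f t / f s)) (T ∩ Icc x (x + δ / 2)) ∧
            (∀ t ∈ T ∩ Icc x (x + δ / 2), Complex.exp (c + Complex.log (f t / f s)) = f t) := by
          intro s hs c hc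
          have hsl : ∀ t ∈ T ∩ Icc x (x + δ / 2), f t / f s ∈ Complex.slitPlane := by
            intro t ht
            apply hslit t ht.1 s hs.1
            have h1 := ht.2.1
            have h2 := ht.2.2
            have h3 := hs.2.1
            have h4 := hs.2.2
            rw [Real.dist_eq, abs_lt]
            constructor <;> linarith
          refine ⟨continuousOn_const.add
            (((hf.mono inter_subset_left).div_const _).clog hsl), fun t ht => ?_⟩
          rw [Complex.exp_add, hc, Complex.exp_log (Complex.slitPlane_ne_zero (hsl t ht))]
          field_simp [hne s hs.1]
        by_cases hxT : x ∈ T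
        · obtain ⟨h1, h2⟩ := main x ⟨hxT, le_refl x, by linarith⟩ (l x) (hle x ⟨hxT, le_refl x⟩)
          exact ⟨_, h1, h2, fun _ => by simp [div_self (hne x hxT)]⟩
        · rcases (T ∩ Icc x (x + δ / 2)).eq_empty_or_nonempty with he | ⟨s, hs⟩
          · exact ⟨0, continuousOn_const, by simp [he], fun h => absurd h hxT⟩
          · obtain ⟨h1, h2⟩ := main s hs _ (Complex.exp_log (hne s hs.1))
            exact ⟨_, h1, h2, fun h => absurd h hxT⟩
      have hu : T ∩ Iic (x + δ / 2) = (T ∩ Iic x) ∪ (T ∩ Icc x (x + δ / 2)) := by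
        rw [← inter_union_distrib_left, Iic_union_Icc_eq_Iic (by linarith)]
      have e1 : ∀ t ∈ T ∩ Iic x, (if t ≤ x then l t else k t) = l t := fun t ht => if_pos ht.2
      have e2 : ∀ t ∈ T ∩ Icc x (x + δ / 2), (if t ≤ x then l t else k t) = k t := by
        intro t ht
        split_ifs with h
        · obtain rfl : t = x := le_antisymm h ht.2.1
          exact (hkx ht.1).symm
        · rfl
      rw [hu]
      refine ⟨fun t => if t ≤ x then l t else k t, ?_, ?_⟩
      · exact (hl.congr e1).union_of_isClosed (hk.congr e2) (hT.isClosed.inter isClosed_Iic)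
          (hT.isClosed.inter isClosed_Icc)
      · rintro t (ht | ht)
        · simp only [e1 t ht, hle t ht]
        · simp only [e2 t ht, hke t ht]
  obtain ⟨n, hn⟩ := exists_nat_ge ((2 * R + 1) / (δ / 2))
  refine (key n).mono fun t ht => ⟨ht, ?_⟩
  have h1 := hR ht
  rw [mem_closedBall_zero_iff, Real.norm_eq_abs, abs_le] at h1
  rw [div_le_iff₀ (by positivity)] at hn
  rw [mem_Iic]
  linarith

/-- On a closed subset of a circle, a nonvanishing continuous function has a logarithm after
division by an integral power of `z - a`, where `a` is the centre of the circle. -/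
theorem exists_zpow_hasLogOn_sphere {a : ℂ} {r : ℝ} (hr : 0 < r) {S : Set ℂ} (hS : IsClosed S)
    (hSs : S ⊆ Metric.sphere a r) {f : ℂ → ℂ} (hf : ContinuousOn f S)
    (hne : ∀ z ∈ S, f z ≠ 0) : ∃ k : ℤ, HasLogOn (fun z => f z * (z - a) ^ (-k)) S := by
  have hSc : IsCompact S := (isCompact_sphere a r).of_isClosed_subset hS hSs
  have hnorm : ∀ z ∈ Metric.sphere a r, ‖z - a‖ = r := fun z hz => by
    rwa [← dist_eq_norm]
  by_cases hall : Metric.sphere a r ⊆ S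
  · obtain rfl := Subset.antisymm hSs hall
    have hmem : ∀ t : ℝ, a + r * Complex.exp (t * Complex.I) ∈ Metric.sphere a r := fun t => by
      simp [Complex.norm_exp_ofReal_mul_I, hr.le]
    obtain ⟨l, hl, hle⟩ := exists_log_real
      (f := fun t => f (a + r * Complex.exp (t * Complex.I)))
      (hf.comp_continuous (by fun_prop) hmem) (fun t => hne _ (hmem t))
    have hper : ∀ t : ℝ, Complex.exp (l (t + 2 * Real.pi) - l t) = 1 := fun t => by
      rw [Complex.exp_sub, hle, hle]
      have : Complex.exp (((t + 2 * Real.pi : ℝ) : ℂ) * Complex.I)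
          = Complex.exp (t * Complex.I) := by
        rw [Complex.exp_eq_exp_iff_exists_int]
        exact ⟨1, by push_cast; ring⟩
      rw [this, div_self (hne _ (hmem t))]
    obtain ⟨k, hk⟩ := Complex.exp_eq_one_iff.1 (hper 0)
    have hk' : ∀ t : ℝ, l (t + 2 * Real.pi) = l t + k * (2 * Real.pi * Complex.I) := fun t => by
      have : l (t + 2 * Real.pi) - l t = l (0 + 2 * Real.pi) - l 0 :=
        isPreconnected_univ.eq_of_exp_eq_one
        (g := fun t : ℝ => l (t + 2 * Real.pi) - l t) (by fun_prop) (fun t _ => hper t)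
        (mem_univ t) (mem_univ 0)
      rw [← hk, ← this]; ring
    let M : ℝ → ℂ := fun t => l t - k * (t * Complex.I) - k * Complex.log r
    have hMc : Continuous M := by fun_prop
    have hMp : Function.Periodic M (2 * Real.pi) := fun t => by
      simp only [M, hk']
      push_cast
      ring
    have hMe : ∀ s t : ℝ, Complex.exp (s * Complex.I) = Complex.exp (t * Complex.I) →
        M s = M t := by
      intro s t hst
      obtain ⟨n, hn⟩ := Complex.exp_eq_exp_iff_exists_int.1 hst
      have hn' : (s : ℂ) = ((t + n * (2 * Real.pi) : ℝ) : ℂ) := by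
        apply mul_right_cancel₀ Complex.I_ne_zero
        rw [hn]; push_cast; ring
      rw [Complex.ofReal_inj.1 hn']
      exact hMp.int_mul n t
    have harg : ∀ w : ℂ, ‖w‖ = 1 → Complex.exp (w.arg * Complex.I) = w := fun w hw => by
      have := Complex.norm_mul_exp_arg_mul_I w
      rwa [hw, Complex.ofReal_one, one_mul] at this
    have hw1 : ∀ z ∈ Metric.sphere a r, ‖(z - a) / r‖ = 1 := fun z hz => by
      rw [norm_div, hnorm z hz, Complex.norm_of_nonneg hr.le, div_self hr.ne']
    have hrC : (r : ℂ) ≠ 0 := Complex.ofReal_ne_zero.2 hr.ne'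
    refine ⟨k, fun z => M ((z - a) / r).arg, fun z₀ hz₀ => ?_, fun z hz => ?_⟩
    · have h0 : (z₀ - a) / r ≠ 0 := norm_ne_zero_iff.1 (by rw [hw1 z₀ hz₀]; exact one_ne_zero)
      have hc : ContinuousWithinAt
          (fun z => M (((z - a) / r / ((z₀ - a) / r)).arg + ((z₀ - a) / r).arg))
          (Metric.sphere a r) z₀ := by
        refine (hMc.continuousAt.comp (ContinuousAt.add ?_ continuousAt_const)).continuousWithinAt
        refine ContinuousAt.comp (g := Complex.arg) (Complex.continuousAt_arg ?_) (by fun_prop)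
        rw [div_self h0]
        exact Complex.one_mem_slitPlane
      have heq : ∀ z ∈ Metric.sphere a r, M ((z - a) / r).arg =
          M (((z - a) / r / ((z₀ - a) / r)).arg + ((z₀ - a) / r).arg) := fun z hz => by
        apply hMe
        rw [Complex.ofReal_add, add_mul, Complex.exp_add, harg _ (hw1 z hz),
          harg _ (hw1 z₀ hz₀), harg, div_mul_cancel₀ _ h0]
        rw [norm_div, hw1 z hz, hw1 z₀ hz₀, div_one]
      exact hc.congr heq (heq z₀ hz₀)
    · have h1 : (z - a) = r * Complex.exp (((z - a) / r).arg * Complex.I) := by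
        rw [harg _ (hw1 z hz), mul_div_cancel₀ _ hrC]
      simp only [M]
      rw [Complex.exp_sub, Complex.exp_sub, hle, ← h1, Complex.exp_int_mul, Complex.exp_int_mul,
        Complex.exp_log hrC, harg _ (hw1 z hz), add_sub_cancel, zpow_neg, div_div, ← mul_zpow,
        div_mul_cancel₀ _ hrC, div_eq_mul_inv]
  · obtain ⟨m, hm, hmS⟩ := not_subset.1 hall
    refine ⟨0, ?_⟩
    have hma : m - a ≠ 0 := norm_ne_zero_iff.1 (by rw [hnorm m hm]; exact hr.ne')
    have hw1 : ∀ z ∈ S, ‖-(z - a) / (m - a)‖ = 1 := fun z hz => by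
      rw [norm_div, norm_neg, hnorm z (hSs hz), hnorm m hm, div_self hr.ne']
    have hw2 : ∀ z ∈ S, -(z - a) / (m - a) ∈ Complex.slitPlane := fun z hz => by
      rw [Complex.mem_slitPlane_iff_arg]
      refine ⟨fun h => hmS ?_, norm_ne_zero_iff.1 (by rw [hw1 z hz]; exact one_ne_zero)⟩
      have := Complex.norm_mul_exp_arg_mul_I (-(z - a) / (m - a))
      rw [hw1 z hz, h, Complex.exp_pi_mul_I, eq_div_iff hma] at this
      have hzm : m = z := by
        push_cast at this
        linear_combination -this
      rwa [hzm]
    have hβ : ContinuousOn (fun z => (-(z - a) / (m - a)).arg) S := fun z hz =>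
      ((Complex.continuousAt_arg (hw2 z hz)).comp
        (f := fun z => -(z - a) / (m - a)) (by fun_prop)).continuousWithinAt
    have hinv : ∀ z ∈ S, a - (m - a) *
        Complex.exp (((-(z - a) / (m - a)).arg : ℝ) * Complex.I) = z := fun z hz => by
      have := Complex.norm_mul_exp_arg_mul_I (-(z - a) / (m - a))
      rw [hw1 z hz, Complex.ofReal_one, one_mul] at this
      rw [this]
      field_simp
      ring
    obtain ⟨l, hl, hle⟩ := hasLogOn_real (hSc.image_of_continuousOn hβ)
      (f := fun t : ℝ => f (a - (m - a) * Complex.exp (t * Complex.I)))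
      (by
        refine hf.comp (by fun_prop) ?_
        rintro _ ⟨z, hz, rfl⟩
        simp only
        rwa [hinv z hz])
      (by
        rintro _ ⟨z, hz, rfl⟩
        simp only
        rw [hinv z hz]
        exact hne z hz)
    refine ⟨fun z => l (-(z - a) / (m - a)).arg, hl.comp hβ (mapsTo_image _ _), fun z hz => ?_⟩
    have := hle _ (mem_image_of_mem _ hz)
    simp only at this
    rw [this, hinv z hz]
    simp

/-- A function which is continuous and nonvanishing on a closed disc with finitely many open discs
removed has a logarithm on every nonseparating compact subset which misses all the centres. -/
theorem hasLogOn_of_closedBall_diff {K : Set ℂ} (hK : IsCompact K) (hKc : IsPreconnected Kᶜ)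
    {R : ℝ} (hR : 0 ≤ R) (hKR : K ⊆ Metric.closedBall 0 R) (L : List (ℂ × ℝ))
    (hL : ∀ p ∈ L, 0 < p.2 ∧ ∀ z ∈ K, p.2 ≤ dist z p.1) {f : ℂ → ℂ}
    (hf : ContinuousOn f {z | z ∈ Metric.closedBall 0 R ∧ ∀ p ∈ L, p.2 ≤ dist z p.1})
    (hne : ∀ z ∈ Metric.closedBall (0 : ℂ) R, (∀ p ∈ L, p.2 ≤ dist z p.1) → f z ≠ 0) :
    HasLogOn f K := by
  induction L generalizing f with
  | nil =>
    refine (hasLogOn_closedBall hR (hf.mono fun z hz => ⟨hz, by simp⟩)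
      fun z hz => hne z hz (by simp)).mono hKR
  | cons p L ih =>
    obtain ⟨a, r⟩ := p
    simp only [List.forall_mem_cons] at hL hf hne
    obtain ⟨⟨hr, hrK⟩, hL⟩ := hL
    have haK : a ∉ K := fun h => by
      have := hrK a h
      rw [dist_self] at this
      linarith
    have hEcl : IsClosed {z : ℂ | z ∈ Metric.closedBall 0 R ∧ ∀ p ∈ L, p.2 ≤ dist z p.1} := by
      have : {z : ℂ | z ∈ Metric.closedBall 0 R ∧ ∀ p ∈ L, p.2 ≤ dist z p.1} =
          Metric.closedBall 0 R ∩ ⋂ p ∈ L, {z | p.2 ≤ dist z p.1} := by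
        ext z
        simp
      rw [this]
      refine Metric.isClosed_closedBall.inter ?_
      exact isClosed_iInter fun p => isClosed_iInter fun _ =>
        isClosed_le continuous_const (by fun_prop)
    set E := {z : ℂ | z ∈ Metric.closedBall 0 R ∧ ∀ p ∈ L, p.2 ≤ dist z p.1}
    have hfE : ContinuousOn f (E ∩ {z | r ≤ dist z a}) := hf.mono fun z hz =>
      ⟨hz.1.1, hz.2, hz.1.2⟩
    have hneE : ∀ z ∈ E ∩ {z | r ≤ dist z a}, f z ≠ 0 := fun z hz => hne z hz.1.1 ⟨hz.2, hz.1.2⟩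
    have hsub : E ∩ Metric.sphere a r ⊆ E ∩ {z | r ≤ dist z a} := fun z hz => ⟨hz.1, hz.2.ge⟩
    have hScl : IsClosed (E ∩ Metric.sphere a r) := hEcl.inter Metric.isClosed_sphere
    obtain ⟨k, l, hl, hle⟩ := exists_zpow_hasLogOn_sphere hr hScl inter_subset_right
      (hfE.mono hsub) fun z hz => hneE z (hsub hz)
    obtain ⟨m, hm, hml⟩ := exists_continuous_extension hScl hl
    have hza : ∀ z, r ≤ dist z a → z - a ≠ 0 := fun z hz h0 => by
      rw [dist_eq_norm, h0, norm_zero] at hz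
      linarith
    set g : ℂ → ℂ := fun z => if r ≤ dist z a then f z * (z - a) ^ (-k) else Complex.exp (m z)
      with hg
    have e1 : ∀ z ∈ E ∩ {z | r ≤ dist z a}, g z = f z * (z - a) ^ (-k) := fun z hz => if_pos hz.2
    have e2 : ∀ z ∈ E ∩ {z | dist z a ≤ r}, g z = Complex.exp (m z) := fun z hz => by
      simp only [hg]
      split_ifs with h
      · have hzS : z ∈ E ∩ Metric.sphere a r := ⟨hz.1, le_antisymm hz.2 h⟩
        rw [hml z hzS, hle z hzS]
      · rfl
    have hEu : E = (E ∩ {z | r ≤ dist z a}) ∪ (E ∩ {z | dist z a ≤ r}) := by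
      ext z
      simp only [mem_union, mem_inter_iff, mem_ofPred_eq]
      have := le_total r (dist z a)
      tauto
    have hgc : ContinuousOn g E := by
      rw [hEu]
      refine ContinuousOn.union_of_isClosed (ContinuousOn.congr ?_ e1)
        (ContinuousOn.congr (by fun_prop) e2)
        (hEcl.inter (isClosed_le continuous_const (by fun_prop)))
        (hEcl.inter (isClosed_le (by fun_prop) continuous_const))
      exact hfE.mul (ContinuousOn.zpow₀ (by fun_prop) _ fun z hz => Or.inl (hza z hz.2))
    have hgne : ∀ z ∈ Metric.closedBall (0 : ℂ) R, (∀ p ∈ L, p.2 ≤ dist z p.1) → g z ≠ 0 := by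
      intro z hz hzL
      simp only [hg]
      split_ifs with h
      · exact mul_ne_zero (hneE z ⟨⟨hz, hzL⟩, h⟩) (zpow_ne_zero _ (hza z h))
      · exact Complex.exp_ne_zero _
    refine ((ih hL hgc hgne).mul ((hasLogOn_sub hK hKc haK).zpow k)).congr fun z hz => ?_
    rw [e1 z ⟨⟨hKR hz, fun p hp => (hL p hp).2 z hz⟩, hrK z hz⟩, mul_assoc,
      ← zpow_add₀ (hza z (hrK z hz)), neg_add_cancel, zpow_zero, mul_one]

/-- A nonvanishing continuous function on a nonseparating planar compact set has a continuous
logarithm. -/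
theorem IsCompact.hasLogOn {K : Set ℂ} (hK : IsCompact K) (hKc : IsPreconnected Kᶜ) {f : ℂ → ℂ}
    (hf : ContinuousOn f K) (hne : ∀ z ∈ K, f z ≠ 0) : HasLogOn f K := by
  obtain ⟨F, hF, hFf⟩ := exists_continuous_extension hK.isClosed hf
  obtain ⟨R, hR⟩ := hK.isBounded.subset_closedBall 0
  have hR' : K ⊆ Metric.closedBall 0 |R| :=
    hR.trans (Metric.closedBall_subset_closedBall (le_abs_self R))
  have hZ : IsCompact (Metric.closedBall 0 |R| ∩ {z | F z = 0}) :=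
    (isCompact_closedBall _ _).inter_right (isClosed_eq hF continuous_const)
  have hball : ∀ z ∈ Metric.closedBall 0 |R| ∩ {z | F z = 0},
      ∃ ε > 0, Metric.ball z ε ⊆ Kᶜ := fun z hz =>
    Metric.isOpen_iff.1 hK.isClosed.isOpen_compl z fun hzK => hne z hzK ((hFf z hzK).symm.trans hz.2)
  choose! ε hε hεK using hball
  obtain ⟨t, ht, hcov⟩ := hZ.elim_nhds_subcover (fun z => Metric.ball z (ε z))
    fun z hz => Metric.ball_mem_nhds z (hε z hz)
  refine (hasLogOn_of_closedBall_diff hK hKc (abs_nonneg R) hR'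
    (t.toList.map fun z => (z, ε z)) ?_ hF.continuousOn ?_).congr hFf
  · intro p hp
    obtain ⟨z, hz, rfl⟩ := List.mem_map.1 hp
    have hz := ht z (Finset.mem_toList.1 hz)
    refine ⟨hε z hz, fun w hw => ?_⟩
    by_contra! h
    exact hεK z hz h hw
  · intro z hz hzL h0
    obtain ⟨w, hw, hzw⟩ := mem_iUnion₂.1 (hcov ⟨hz, h0⟩)
    exact (Metric.mem_ball.1 hzw).not_ge
      (hzL (w, ε w) (List.mem_map.2 ⟨w, Finset.mem_toList.2 hw, rfl⟩))

/-- Any two points of an open disc are related by a plane homeomorphism supported in the disc which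
does not turn any chord by the angle `π`. -/
theorem exists_homeomorph_ball_push {p q : ℂ} {r : ℝ} (hq : q ∈ Metric.ball p r) :
    ∃ φ : ℂ ≃ₜ ℂ, φ p = q ∧ (∀ z ∉ Metric.ball p r, φ z = z) ∧
      (∀ z ∈ Metric.ball p r, φ z ∈ Metric.ball p r) ∧
      ∀ x y, x ≠ y → (φ x - φ y) / (x - y) ∈ Complex.slitPlane := by
  have hr : 0 < r := Metric.pos_of_mem_ball hq
  obtain ⟨w, hw, hqw⟩ : ∃ w : ℂ, ‖w‖ < 1 ∧ q = p + r * w := by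
    refine ⟨(q - p) / r, ?_, ?_⟩
    · rw [norm_div, Complex.norm_of_nonneg hr.le, div_lt_one hr, ← dist_eq_norm]
      exact hq
    · have : (r : ℂ) ≠ 0 := Complex.ofReal_ne_zero.2 hr.ne'
      field_simp
      ring
  let ψ : ℂ → ℂ := fun z => (max 0 (r - ‖z - p‖) : ℝ) * w
  have hψ : ∀ x y, ‖ψ x - ψ y‖ ≤ ‖w‖ * ‖x - y‖ := fun x y => by
    simp only [ψ]
    rw [← sub_mul, norm_mul, mul_comm, ← Complex.ofReal_sub, Complex.norm_real, Real.norm_eq_abs]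
    gcongr
    rw [max_comm, max_comm 0 (r - ‖y - p‖)]
    refine (abs_max_sub_max_le_abs _ _ _).trans ?_
    have := abs_norm_sub_norm_le (y - p) (x - p)
    rw [sub_sub_sub_cancel_right, norm_sub_rev y x] at this
    rwa [sub_sub_sub_cancel_left]
  have happ : ApproximatesLinearOn (fun z => z + ψ z)
      ((ContinuousLinearEquiv.refl ℝ ℂ : ℂ ≃L[ℝ] ℂ) : ℂ →L[ℝ] ℂ) univ ‖w‖₊ := by
    intro x _ y _
    have : x + ψ x - (y + ψ y) - (x - y) = ψ x - ψ y := by ring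
    simpa [this] using hψ x y
  let φ : ℂ ≃ₜ ℂ := happ.toHomeomorph _ (Or.inr (by
    have h1 : ‖((ContinuousLinearEquiv.refl ℝ ℂ).symm : ℂ →L[ℝ] ℂ)‖₊ = 1 := by
      apply NNReal.eq
      exact ContinuousLinearMap.norm_id
    rw [h1, inv_one]
    exact hw))
  have hφ : ∀ z, φ z = z + ψ z := fun z => rfl
  refine ⟨φ, ?_, fun z hz => ?_, fun z hz => ?_, fun x y hxy => ?_⟩
  · rw [hφ, hqw]
    simp [ψ, hr.le]
  · rw [hφ]
    rw [Metric.mem_ball, not_lt, dist_eq_norm] at hz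
    simp [ψ, hz]
  · rw [hφ]
    rw [Metric.mem_ball, dist_eq_norm] at hz ⊢
    have h1 : z + ψ z - p = (z - p) + ψ z := by ring
    have h2 : ‖ψ z‖ = (r - ‖z - p‖) * ‖w‖ := by
      simp only [ψ]
      rw [norm_mul, Complex.norm_of_nonneg (le_max_left _ _), max_eq_right (by linarith)]
    have h3 := norm_add_le (z - p) (ψ z)
    rw [h1]
    nlinarith
  · have hne : x - y ≠ 0 := sub_ne_zero.2 hxy
    have : (φ x - φ y) / (x - y) = 1 + (ψ x - ψ y) / (x - y) := by
      rw [hφ, hφ]; field_simp; ring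
    rw [this]
    apply Complex.mem_slitPlane_of_norm_lt_one
    have hpos := norm_pos_iff.2 hne
    rw [norm_div, div_lt_one hpos]
    exact (hψ x y).trans_lt (mul_lt_of_lt_one_left hpos hw)

theorem div_mem_slitPlane_of_convex {B : Set ℂ} (hB : Convex ℝ B) {u v x : ℂ} (hu : u ∈ B)
    (hv : v ∈ B) (hx : x ∉ B) : (v - x) / (u - x) ∈ Complex.slitPlane := by
  have hux : u - x ≠ 0 := sub_ne_zero.2 fun h => hx (h ▸ hu)
  by_contra h
  rw [Complex.mem_slitPlane_iff] at h
  push Not at h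
  set s := -((v - x) / (u - x)).re with hs
  have hs0 : 0 ≤ s := by linarith [h.1]
  have h1 : (v - x) / (u - x) = ((-s : ℝ) : ℂ) := by
    apply Complex.ext <;> simp [h.2, hs]
  rw [div_eq_iff hux] at h1
  have hpos : 0 < 1 + s := by linarith
  have hposC : (1 + s : ℂ) ≠ 0 := by exact_mod_cast hpos.ne'
  have h2 : x = (1 / (1 + s)) • v + (s / (1 + s)) • u := by
    simp only [Complex.real_smul]
    push_cast at h1 ⊢
    field_simp
    linear_combination -h1
  exact hx (h2 ▸ hB hv hu (by positivity) (by positivity) (by field_simp))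

/-- Plane homeomorphisms `h` with `h ⁻¹' U = V` for which the displacement `h x - x` has a logarithm
on `V ∪ U` and the chord ratio `(h x - h y) / (x - y)` has a symmetric logarithm. -/
structure Admissible (U V : Set ℂ) (h : ℂ ≃ₜ ℂ) : Prop where
  mem_iff : ∀ x, h x ∈ U ↔ x ∈ V
  log_displacement : HasLogOn (fun x => h x - x) (V ∪ U)
  log_ratio : ∃ ρ : ℂ × ℂ → ℂ, ContinuousOn ρ {p | p.1 ≠ p.2} ∧
    (∀ x y, x ≠ y → Complex.exp (ρ (x, y)) = (h x - h y) / (x - y)) ∧ ∀ x y, ρ (x, y) = ρ (y, x)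

theorem Admissible.apply_ne {U V : Set ℂ} {h : ℂ ≃ₜ ℂ} (H : Admissible U V h) {x : ℂ}
    (hx : x ∈ V ∪ U) : h x ≠ x := by
  obtain ⟨l, -, hle⟩ := H.log_displacement
  intro h0
  have := hle x hx
  simp only [h0, sub_self] at this
  exact Complex.exp_ne_zero _ this

/-- Admissibility is preserved by composing with a push inside a disc which is free for `h`. -/
theorem Admissible.trans_push {U V : Set ℂ} {h φ : ℂ ≃ₜ ℂ} (H : Admissible U V h) {B : Set ℂ}
    (hB : Convex ℝ B) (hBU : B ⊆ U) (hfree : ∀ x ∈ B, h x ∉ B) (hid : ∀ z ∉ B, φ z = z)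
    (hmaps : ∀ z ∈ B, φ z ∈ B)
    (hslit : ∀ x y, x ≠ y → (φ x - φ y) / (x - y) ∈ Complex.slitPlane) :
    Admissible U V (h.trans φ) where
  mem_iff x := by
    rw [← H.mem_iff, Homeomorph.trans_apply]
    by_cases hx : h x ∈ B
    · exact iff_of_true (hBU (hmaps _ hx)) (hBU hx)
    · rw [hid _ hx]
  log_displacement := by
    have hne : ∀ x ∈ V ∪ U, h x - x ≠ 0 := fun x hx => sub_ne_zero.2 (H.apply_ne hx)
    refine (H.log_displacement.mul (hasLogOn_of_mem_slitPlane
      (f := fun x => (φ (h x) - x) / (h x - x)) ?_ fun x hx => ?_)).congr fun x hx => ?_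
    · exact ContinuousOn.div (by fun_prop) (by fun_prop) hne
    · by_cases hxB : h x ∈ B
      · exact div_mem_slitPlane_of_convex hB hxB (hmaps _ hxB) fun h1 => hfree x h1 hxB
      · simp only [hid _ hxB]
        rw [div_self (hne x hx)]
        exact Complex.one_mem_slitPlane
    · rw [mul_div_cancel₀ _ (hne x hx)]
      rfl
  log_ratio := by
    obtain ⟨ρ, hρ, hρe, hρs⟩ := H.log_ratio
    refine ⟨fun p => ρ p + Complex.log ((φ (h p.1) - φ (h p.2)) / (h p.1 - h p.2)), ?_, ?_, ?_⟩
    · refine hρ.add (ContinuousOn.clog (ContinuousOn.div (by fun_prop) (by fun_prop) ?_) ?_)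
      · exact fun p hp => sub_ne_zero.2 fun h0 => hp (h.injective h0)
      · exact fun p hp => hslit _ _ fun h0 => hp (h.injective h0)
    · intro x y hxy
      have h1 : h x ≠ h y := fun h0 => hxy (h.injective h0)
      have h2 := sub_ne_zero.2 h1
      simp only
      rw [Complex.exp_add, hρe x y hxy,
        Complex.exp_log (Complex.slitPlane_ne_zero (hslit _ _ h1)), Homeomorph.trans_apply,
        Homeomorph.trans_apply]
      field_simp
    · intro x y
      simp only
      rw [hρs x y, ← neg_sub (φ (h x)), ← neg_sub (h x), neg_div_neg_eq]

/-- An admissible homeomorphism has no periodic orbit of period at most two in `U`. -/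
theorem Admissible.not_period_two {U V : Set ℂ} {h : ℂ ≃ₜ ℂ} (H : Admissible U V h)
    (hV : IsPreconnected V) {w : ℂ} (hw : w ∈ U) (hhw : h w ∈ U) : h (h w) ≠ w := by
  intro h2
  have hwV : w ∈ V := (H.mem_iff w).1 hhw
  have hhwV : h w ∈ V := (H.mem_iff (h w)).1 (h2.symm ▸ hw)
  obtain ⟨l, hl, hle⟩ := H.log_displacement
  obtain ⟨ρ, hρ, hρe, hρs⟩ := H.log_ratio
  have hfix : ∀ x ∈ V, h x ≠ x := fun x hx => H.apply_ne (Or.inl hx)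
  have hVU : MapsTo h V (V ∪ U) := fun x hx => Or.inr ((H.mem_iff x).2 hx)
  have key : l (h w) - l w - ρ (w, h w) = l (h (h w)) - l (h w) - ρ (h w, h (h w)) := by
    refine hV.eq_of_exp_eq_one (g := fun x => l (h x) - l x - ρ (x, h x)) ?_ ?_ hwV hhwV
    · refine ((hl.comp h.continuous.continuousOn hVU).sub (hl.mono subset_union_left)).sub
        (hρ.comp (f := fun x => (x, h x)) (by fun_prop) fun x hx => (hfix x hx).symm)
    · intro x hx
      have h1 : h x ≠ x := hfix x hx
      have h3 : h (h x) - h x ≠ 0 := sub_ne_zero.2 fun h0 => h1 (h.injective h0)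
      have h4 : h x - x ≠ 0 := sub_ne_zero.2 h1
      rw [Complex.exp_sub, Complex.exp_sub, hle _ (hVU hx), hle x (Or.inl hx),
        hρe x (h x) h1.symm, ← neg_sub (h (h x)), ← neg_sub (h x) x, neg_div_neg_eq]
      field_simp
  rw [h2, hρs (h w) w] at key
  have hll : l (h w) = l w := by linear_combination key / 2
  have e1 := hle w (Or.inl hwV)
  have e2 := hle (h w) (Or.inl hhwV)
  simp only at e1 e2
  rw [hll, e1, h2] at e2
  apply hfix w hwV
  linear_combination e2 / 2

/-- A path which starts at the end of an orbit segment and leads to its beginning, and which meets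
its own image only against the direction of travel, can be used to close up the orbit. -/
theorem Admissible.exists_closing {U V : Set ℂ} {h : ℂ ≃ₜ ℂ} (H : Admissible U V h)
    (hU : IsOpen U) {Γ : ℝ → ℂ} {L : ℝ} (hL : 0 ≤ L) (hΓ : ContinuousOn Γ (Icc 0 L))
    (hΓU : ∀ u ∈ Icc 0 L, Γ u ∈ U)
    (hback : ∀ u ∈ Icc 0 L, ∀ v ∈ Icc 0 u, h (Γ u) ≠ Γ v) {r : ℕ}
    (hret : h^[r] (Γ L) = Γ 0) (hr : 1 ≤ r)
    (hmiss : ∀ i, 0 < i → i < r → ∀ u ∈ Icc 0 L, h^[i] (Γ L) ≠ Γ u) :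
    ∃ g : ℂ ≃ₜ ℂ, Admissible U V g ∧ g^[r] (Γ L) = Γ L ∧
      ∀ i < r, g^[i] (Γ L) = h^[i] (Γ L) := by
  obtain ⟨δ₁, hδ₁, h₁⟩ : ∃ δ > 0, ∀ u ∈ Icc 0 L, ∀ v ∈ Icc 0 u,
      ∀ x ∈ Metric.ball (Γ u) δ, h x ∉ Metric.ball (Γ v) δ := by
    have hc : IsCompact ((fun p : ℝ × ℝ => (Γ p.1, Γ p.2)) ''
        ((Icc 0 L ×ˢ Icc 0 L) ∩ {p | p.2 ≤ p.1})) := by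
      refine ((isCompact_Icc.prod isCompact_Icc).inter_right
        (isClosed_le continuous_snd continuous_fst)).image_of_continuousOn ?_
      exact (hΓ.comp continuousOn_fst fun p hp => hp.1.1).prodMk
        (hΓ.comp continuousOn_snd fun p hp => hp.1.2)
    obtain ⟨δ, hδ, hsub⟩ := hc.exists_thickening_subset_open
      (t := {p : ℂ × ℂ | h p.1 ≠ p.2}) (isOpen_ne_fun (by fun_prop) (by fun_prop)) (by
        rintro _ ⟨⟨u, v⟩, ⟨⟨hu, hv⟩, hvu⟩, rfl⟩
        exact hback u hu v ⟨hv.1, hvu⟩)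
    refine ⟨δ, hδ, fun u hu v hv x hx hhx => ?_⟩
    have : (x, h x) ∈ {p : ℂ × ℂ | h p.1 ≠ p.2} := hsub (Metric.mem_thickening_iff.2 ⟨(Γ u, Γ v),
      ⟨(u, v), ⟨⟨hu, hv.1, hv.2.trans hu.2⟩, hv.2⟩, rfl⟩, by
        rw [Prod.dist_eq]
        exact max_lt hx hhx⟩)
    exact this rfl
  obtain ⟨δ₂, hδ₂, h₂⟩ : ∃ δ > 0, ∀ u ∈ Icc 0 L, ∀ x ∈ Metric.ball (Γ u) δ,
      x ∈ U ∧ ∀ i, 0 < i → i < r → x ≠ h^[i] (Γ L) := by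
    have hfin : (((fun i => h^[i] (Γ L)) '' (Ioo 0 r : Set ℕ))).Finite :=
      (finite_Ioo 0 r).image _
    obtain ⟨δ, hδ, hsub⟩ := (isCompact_Icc.image_of_continuousOn hΓ).exists_thickening_subset_open
      (hU.sdiff hfin.isClosed) (by
        rintro _ ⟨u, hu, rfl⟩
        refine ⟨hΓU u hu, ?_⟩
        rintro ⟨i, hi, h0⟩
        exact hmiss i hi.1 hi.2 u hu h0)
    refine ⟨δ, hδ, fun u hu x hx => ?_⟩
    have := hsub (Metric.mem_thickening_iff.2 ⟨Γ u, mem_image_of_mem _ hu, hx⟩)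
    exact ⟨this.1, fun i hi hir h0 => this.2 ⟨i, ⟨hi, hir⟩, h0.symm⟩⟩
  obtain ⟨δ, hδ, hd₁, hd₂⟩ : ∃ δ > 0, δ ≤ δ₁ ∧ δ ≤ δ₂ :=
    ⟨min δ₁ δ₂, lt_min hδ₁ hδ₂, min_le_left _ _, min_le_right _ _⟩
  let S : ℝ → Prop := fun u => ∃ Φ : ℂ ≃ₜ ℂ, Admissible U V (h.trans Φ) ∧
    (∀ z, (∀ v ∈ Icc 0 u, z ∉ Metric.ball (Γ v) δ) → Φ z = z) ∧ Φ (Γ 0) = Γ u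
  have hS0 : S 0 := ⟨Homeomorph.refl ℂ, H, fun z _ => rfl, rfl⟩
  have hstep : ∀ u v, 0 ≤ u → u ≤ v → v ≤ L → dist (Γ v) (Γ u) < δ → S u → S v := by
    rintro u v hu huv hvL hd ⟨Φ, hΦ, hΦi, hΦ0⟩
    have huL : u ∈ Icc 0 L := ⟨hu, huv.trans hvL⟩
    obtain ⟨φ, hφ, hφi, hφm, hφs⟩ := exists_homeomorph_ball_push (Metric.mem_ball.2 hd)
    have huu : u ∈ Icc 0 u := ⟨hu, le_rfl⟩
    refine ⟨Φ.trans φ, hΦ.trans_push (convex_ball (Γ u) δ)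
      (fun x hx => (h₂ u huL x (Metric.ball_subset_ball hd₂ hx)).1) ?_ hφi hφm hφs, ?_, ?_⟩
    · intro x hx hΦx
      have hN : ∀ v ∈ Icc 0 u, h x ∉ Metric.ball (Γ v) δ := fun v hv hm =>
        h₁ u huL v hv x (Metric.ball_subset_ball hd₁ hx) (Metric.ball_subset_ball hd₁ hm)
      have := hΦi _ hN
      rw [Homeomorph.trans_apply, this] at hΦx
      exact hN u huu hΦx
    · intro z hz
      rw [Homeomorph.trans_apply, hΦi z fun v hv => hz v ⟨hv.1, hv.2.trans huv⟩,
        hφi z (hz u ⟨hu, huv⟩)]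
    · rw [Homeomorph.trans_apply, hΦ0, hφ]
  have hSL : S L := by
    obtain ⟨η, hη, hηΓ⟩ := Metric.uniformContinuousOn_iff.1
      (isCompact_Icc.uniformContinuousOn_of_continuous hΓ) δ hδ
    have hn : ∀ n : ℕ, S (min (n * (η / 2)) L) := by
      intro n
      induction n with
      | zero => simpa [hL] using hS0
      | succ n ih =>
        have h0 : 0 ≤ (n : ℝ) * (η / 2) := by positivity
        have h1 : (n : ℝ) * (η / 2) ≤ ((n + 1 : ℕ) : ℝ) * (η / 2) := by
          push_cast
          nlinarith
        have h3 := min_le_min_right L h1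
        refine hstep _ _ (le_min h0 hL) h3 (min_le_right _ _) (hηΓ _
          ⟨le_min (h0.trans h1) hL, min_le_right _ _⟩ _ ⟨le_min h0 hL, min_le_right _ _⟩ ?_) ih
        rw [Real.dist_eq]
        refine (abs_min_sub_min_le_max _ _ _ _).trans_lt ?_
        have : ((n + 1 : ℕ) : ℝ) * (η / 2) - n * (η / 2) = η / 2 := by
          push_cast
          ring
        rw [this, sub_self, abs_zero, abs_of_pos (half_pos hη)]
        exact max_lt (half_lt_self hη) hη
    obtain ⟨n, hn'⟩ := exists_nat_ge (L / (η / 2))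
    rw [div_le_iff₀ (by positivity)] at hn'
    simpa [min_eq_right hn'] using hn n
  obtain ⟨Φ, hΦ, hΦi, hΦ0⟩ := hSL
  have hiter : ∀ i < r, (h.trans Φ)^[i] (Γ L) = h^[i] (Γ L) := by
    intro i
    induction i with
    | zero => exact fun _ => rfl
    | succ i ih =>
      intro hi
      rw [Function.iterate_succ_apply', ih (by omega), Homeomorph.trans_apply,
        ← Function.iterate_succ_apply' h]
      exact hΦi _ fun v hv hm =>
        (h₂ v hv _ (Metric.ball_subset_ball hd₂ hm)).2 (i + 1) (by omega) hi rfl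
  refine ⟨h.trans Φ, hΦ, ?_, hiter⟩
  obtain ⟨s, rfl⟩ : ∃ s, r = s + 1 := ⟨r - 1, by omega⟩
  rw [Function.iterate_succ_apply', hiter s (by omega), Homeomorph.trans_apply,
    ← Function.iterate_succ_apply' h, hret, hΦ0]

/-- A path from a point to its image can be rerouted, inside its union with its image, so that it
meets its own image only against the direction of travel. -/
theorem exists_backward_free_path {h : ℂ ≃ₜ ℂ} {γ : ℝ → ℂ} (hγ : Continuous γ)
    (hend : h (γ 0) = γ 1) (hfix : ∀ t ∈ Icc (0 : ℝ) 1, h (γ t) ≠ γ t)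
    (htwo : ∀ c : ℝ, (∀ s ∈ Icc (0 : ℝ) 1, ∀ t ∈ Icc (0 : ℝ) 1, h (γ s) = γ t → c ≤ max s t) →
      ∀ s ∈ Icc (0 : ℝ) 1, ∀ t ∈ Icc (0 : ℝ) 1, s < c → t < c → h (h (γ s)) ≠ γ t) :
    ∃ (Γ : ℝ → ℂ) (A : ℝ), Continuous Γ ∧ 0 ≤ A ∧ Γ 0 = γ 0 ∧ Γ A = γ 1 ∧
      (∀ u ∈ Icc 0 A, ∃ t ∈ Icc (0 : ℝ) 1, Γ u = γ t ∨ Γ u = h (γ t)) ∧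
      ∀ u ∈ Icc 0 A, ∀ v ∈ Icc 0 u, h (Γ u) ≠ Γ v := by
  have hQ : IsCompact ((Icc (0 : ℝ) 1 ×ˢ Icc (0 : ℝ) 1) ∩ {p : ℝ × ℝ | h (γ p.1) = γ p.2}) :=
    (isCompact_Icc.prod isCompact_Icc).inter_right (isClosed_eq (by fun_prop) (by fun_prop))
  obtain ⟨⟨b, a⟩, ⟨⟨hb, ha⟩, hba⟩, hmin⟩ := hQ.exists_isMinOn
    ⟨(0, 1), ⟨⟨by simp, by simp⟩, hend⟩⟩
    (f := fun p : ℝ × ℝ => max p.1 p.2) (by fun_prop)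
  simp only at hb ha
  have hba : h (γ b) = γ a := hba
  have hfree : ∀ s ∈ Icc (0 : ℝ) 1, ∀ t ∈ Icc (0 : ℝ) 1, h (γ s) = γ t → max b a ≤ max s t :=
    fun s hs t ht hst => isMinOn_iff.1 hmin (s, t) ⟨⟨hs, ht⟩, hst⟩
  have h2 := htwo _ hfree
  have hne : a ≠ b := fun hab => hfix b hb (by rw [hba, hab])
  let Γ : ℝ → ℂ := fun u => if u ≤ a then γ u else h (γ (a + b - u))
  have e1 : ∀ u, u ≤ a → Γ u = γ u := fun u hu => if_pos hu
  have e2 : ∀ u, a ≤ u → Γ u = h (γ (a + b - u)) := fun u hu => by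
    rcases hu.eq_or_lt with rfl | hu
    · rw [e1 _ le_rfl, add_sub_cancel_left, hba]
    · exact if_neg hu.not_ge
  refine ⟨Γ, a + b, ?_, add_nonneg ha.1 hb.1, e1 0 ha.1, ?_, fun u hu => ?_, ?_⟩
  · refine Continuous.if_le hγ (by fun_prop) continuous_id continuous_const ?_
    rintro u rfl
    simp only [add_sub_cancel_left, hba]
  · rw [e2 _ (by linarith [hb.1]), sub_self, hend]
  · rcases le_total u a with h1 | h1
    · exact ⟨u, ⟨hu.1, h1.trans ha.2⟩, Or.inl (e1 u h1)⟩
    · exact ⟨a + b - u, ⟨by linarith [hu.2], by linarith [hb.2]⟩, Or.inr (e2 u h1)⟩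
  · rintro u ⟨hu0, hu1⟩ v ⟨hv0, hvu⟩ huv
    rcases le_total u a with hua | hua
    · have hva := hvu.trans hua
      rw [e1 u hua, e1 v hva] at huv
      have hu : u ∈ Icc (0 : ℝ) 1 := ⟨hu0, hua.trans ha.2⟩
      have hv : v ∈ Icc (0 : ℝ) 1 := ⟨hv0, hva.trans ha.2⟩
      have hf := hfree u hu v hv huv
      rw [max_eq_left hvu] at hf
      obtain rfl : u = a := le_antisymm hua ((le_max_right _ _).trans hf)
      have hbu : b < u := lt_of_le_of_ne ((le_max_left _ _).trans hf) hne.symm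
      rcases hvu.eq_or_lt with rfl | hvu
      · exact hfix v hv huv
      · exact h2 b hb v hv (lt_max_of_lt_right hbu) (lt_max_of_lt_right hvu) (by rw [hba, huv])
    · rw [e2 u hua] at huv
      have hs : a + b - u ∈ Icc (0 : ℝ) 1 := ⟨by linarith, by linarith [hb.2]⟩
      have hsb : a + b - u ≤ b := by linarith
      have hsv : a + b - u ≤ a + b - v := by linarith
      generalize a + b - u = s at *
      rcases le_total v a with hva | hva
      · rw [e1 v hva] at huv
        have hv : v ∈ Icc (0 : ℝ) 1 := ⟨hv0, hva.trans ha.2⟩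
        by_cases hs1 : s < max b a
        · by_cases hv1 : v < max b a
          · exact h2 s hs v hv hs1 hv1 huv
          · have hv2 : a = v := le_antisymm ((le_max_right _ _).trans (not_lt.1 hv1)) hva
            rw [← hv2, ← hba] at huv
            have hf := hfree s hs b hb (h.injective huv)
            rw [max_eq_right hsb] at hf
            rw [← hv2] at hv1
            exact hv1 (lt_max_of_lt_left (lt_of_le_of_ne ((le_max_right _ _).trans hf) hne))
        · have hs2 := not_lt.1 hs1
          obtain rfl : s = b := le_antisymm hsb ((le_max_left _ _).trans hs2)
          have has : a < s := lt_of_le_of_ne ((le_max_right _ _).trans hs2) hne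
          rw [hba] at huv
          have hf := hfree a ha v hv huv
          rw [max_eq_left hva] at hf
          exact has.not_ge ((le_max_left _ _).trans hf)
      · rw [e2 v hva] at huv
        have huv := h.injective huv
        have hs' : a + b - v ∈ Icc (0 : ℝ) 1 := ⟨by linarith, by linarith [hb.2]⟩
        have hs'b : a + b - v ≤ b := by linarith
        generalize a + b - v = s' at *
        have hf := hfree s hs s' hs' huv
        have hmb : max s s' ≤ b := max_le hsb hs'b
        have hab : a < b := lt_of_le_of_ne ((le_max_right _ _).trans (hf.trans hmb)) hne
        rw [max_eq_left hab.le] at hf h2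
        by_cases hs1 : s < b
        · have : s' = b := by
            rcases le_max_iff.1 hf with h3 | h3
            · exact absurd hs1 h3.not_gt
            · exact le_antisymm hs'b h3
          rw [this] at huv
          exact h2 s hs a ha hs1 hab (by rw [huv, hba])
        · have hsb' : s = b := le_antisymm hsb (not_lt.1 hs1)
          rw [hsb', hba] at huv
          exact hfix b hb (by rw [hba, huv, le_antisymm hs'b (hsb' ▸ hsv)])

theorem Admissible.not_period_two_of_path {U V : Set ℂ} {h : ℂ ≃ₜ ℂ} (H : Admissible U V h)
    (hU : IsOpen U) (hV : IsPreconnected V) {γ : ℝ → ℂ} (hγ : Continuous γ)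
    (hγU : ∀ t ∈ Icc (0 : ℝ) 1, γ t ∈ U) (hhγU : ∀ t ∈ Icc (0 : ℝ) 1, h (γ t) ∈ U) {c : ℝ}
    (hfree : ∀ s ∈ Icc (0 : ℝ) 1, ∀ t ∈ Icc (0 : ℝ) 1, h (γ s) = γ t → c ≤ max s t) {s t : ℝ}
    (hs : s ∈ Icc (0 : ℝ) 1) (ht : t ∈ Icc (0 : ℝ) 1) (hsc : s < c) (htc : t < c) :
    h (h (γ s)) ≠ γ t := by
  intro hst
  have hseg : ∀ u ∈ Icc (0 : ℝ) 1, t + u * (s - t) ∈ Icc (0 : ℝ) 1 ∩ Iio c := fun u hu =>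
    ((convex_Icc (0 : ℝ) 1).inter (convex_Iio c)).add_smul_sub_mem ⟨ht, htc⟩ ⟨hs, hsc⟩ hu
  have hdisj : ∀ u ∈ Icc (0 : ℝ) 1, ∀ v ∈ Icc (0 : ℝ) 1,
      h (γ (t + u * (s - t))) ≠ γ (t + v * (s - t)) := fun u hu v hv huv =>
    (hfree _ (hseg u hu).1 _ (hseg v hv).1 huv).not_gt (max_lt (hseg u hu).2 (hseg v hv).2)
  have hΓ1 : γ (t + 1 * (s - t)) = γ s := by rw [one_mul, add_sub_cancel]
  obtain ⟨g, hg, hg2, hgi⟩ := H.exists_closing hU (Γ := fun u => γ (t + u * (s - t))) zero_le_one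
    (by fun_prop) (fun u hu => hγU _ (hseg u hu).1)
    (fun u hu v hv => hdisj u hu v ⟨hv.1, hv.2.trans hu.2⟩) (r := 2)
    (by simpa using hst) (by norm_num)
    (fun i hi hi2 u hu => by
      obtain rfl : i = 1 := by omega
      exact hdisj 1 (by simp) u hu)
  have hg1 := hgi 1 (by norm_num)
  simp only [hΓ1, Function.iterate_one] at hg1 hg2
  refine hg.not_period_two hV (hγU s hs) (hg1 ▸ hhγU s hs) hg2

/-- An admissible homeomorphism has no periodic orbit in a path connected subset of `U ∩ V`. -/
theorem Admissible.no_periodic_orbit {U V Y : Set ℂ} (hU : IsOpen U) (hV : IsPreconnected V)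
    (hY : IsPathConnected Y) (hYU : Y ⊆ U) (hYV : Y ⊆ V) (m : ℕ) (hm : 1 ≤ m) {h : ℂ ≃ₜ ℂ}
    (H : Admissible U V h) {x : ℂ} (hx : h^[m] x = x) (hxY : ∀ i, h^[i] x ∈ Y) : False := by
  induction m using Nat.strong_induction_on generalizing h x with
  | _ m ih =>
  have hmaps : ∀ y ∈ Y, h y ∈ U := fun y hy => (H.mem_iff y).2 (hYV hy)
  have hfix : ∀ y ∈ Y, h y ≠ y := fun y hy => H.apply_ne (Or.inl (hYV hy))
  have hm2 : 1 < m := by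
    by_contra hm2
    obtain rfl : m = 1 := by omega
    exact hfix x (hxY 0) hx
  have hj := hY.joinedIn x (hxY 0) (h x) (hxY 1)
  have hγY : ∀ t, hj.somePath.extend t ∈ Y := fun t => hj.somePath_mem _
  obtain ⟨Γ, A, hΓ, hA, hΓ0, hΓA, hΓY, hback⟩ := exists_backward_free_path (h := h)
    hj.somePath.continuous_extend (by simp) (fun t _ => hfix _ (hγY t))
    (fun c hc s hs t ht => H.not_period_two_of_path hU hV hj.somePath.continuous_extend
      (fun t _ => hYU (hγY t)) (fun t _ => hmaps _ (hγY t)) hc hs ht)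
  have hΓ0 : Γ 0 = x := by simpa using hΓ0
  have hΓA : Γ A = h x := by simpa using hΓA
  have hΓU : ∀ u ∈ Icc 0 A, Γ u ∈ U := fun u hu => by
    obtain ⟨t, ht, h1 | h1⟩ := hΓY u hu
    · exact h1 ▸ hYU (hγY t)
    · exact h1 ▸ hmaps _ (hγY t)
  have hT : IsCompact (Icc 0 A ∩ Γ ⁻¹' ((fun i => h^[i] x) '' Ico 1 m)) :=
    isCompact_Icc.inter_right (((finite_Ico 1 m).image _).isClosed.preimage hΓ)
  obtain ⟨τ, ⟨hτ, j, hjm, hjτ⟩, hleast⟩ := hT.exists_isLeast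
    ⟨A, ⟨hA, le_rfl⟩, 1, ⟨le_rfl, hm2⟩, hΓA.symm⟩
  have hjτ : h^[j] x = Γ τ := hjτ
  have hor : ∀ i, h^[i] (Γ τ) = h^[i + j] x := fun i => by
    rw [← hjτ, Function.iterate_add_apply]
  have hex : ∃ r, 1 ≤ r ∧ h^[r] (Γ τ) = x :=
    ⟨m - j, by have := hjm.2; omega, by rw [hor, Nat.sub_add_cancel hjm.2.le, hx]⟩
  classical
  obtain ⟨hr1, hrx⟩ := Nat.find_spec hex
  have hrm : Nat.find hex ≤ m - j :=
    Nat.find_le ⟨by have := hjm.2; omega, by rw [hor, Nat.sub_add_cancel hjm.2.le, hx]⟩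
  have hrmin : ∀ i < Nat.find hex, 1 ≤ i → h^[i] (Γ τ) ≠ x := fun i hi h1 h2 =>
    Nat.find_min hex hi ⟨h1, h2⟩
  generalize Nat.find hex = r at *
  have hjm1 := hjm.1
  have hjm2 := hjm.2
  have hτA : ∀ u ∈ Icc 0 τ, u ∈ Icc 0 A := fun u hu => ⟨hu.1, hu.2.trans hτ.2⟩
  obtain ⟨g, hg, hgr, hgi⟩ := H.exists_closing hU hτ.1 hΓ.continuousOn
    (fun u hu => hΓU u (hτA u hu)) (fun u hu => hback u (hτA u hu)) (hrx.trans hΓ0.symm) hr1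
    (fun i hi hir u hu hiu => by
      have hu' : u ∈ Icc 0 A ∩ Γ ⁻¹' ((fun i => h^[i] x) '' Ico 1 m) :=
        ⟨hτA u hu, i + j, ⟨by omega, by omega⟩, by rw [← hiu]; exact (hor i).symm⟩
      obtain rfl : u = τ := le_antisymm hu.2 (hleast hu')
      refine hrmin (r - i) (by omega) (by omega) ?_
      rw [← hrx]
      conv_lhs => rw [← hiu]
      rw [← Function.iterate_add_apply, Nat.sub_add_cancel hir.le])
  refine ih r (by omega) hr1 hg hgr fun i => ?_
  have hper : Function.IsPeriodicPt g r (Γ τ) := hgr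
  rw [← hper.iterate_mod_apply, hgi _ (Nat.mod_lt _ hr1), hor]
  exact hxY _

/-- Along an isotopy starting at the identity the chord ratio acquires a symmetric logarithm. -/
theorem exists_symm_log_ratio {F : ℝ → ℂ → ℂ} (hF : Continuous fun q : ℝ × ℂ => F q.1 q.2)
    (hinj : ∀ t, Function.Injective (F t)) (h0 : F 0 = id) :
    ∃ ρ : ℂ × ℂ → ℂ, ContinuousOn ρ {p | p.1 ≠ p.2} ∧
      (∀ x y, x ≠ y → Complex.exp (ρ (x, y)) = (F 1 x - F 1 y) / (x - y)) ∧
      ∀ x y, ρ (x, y) = ρ (y, x) := by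
  let q : I × {p : ℂ × ℂ // p.1 ≠ p.2} → ℂ := fun p => (F p.1 p.2.1.1 - F p.1 p.2.1.2) / (p.2.1.1 - p.2.1.2)
  have hd : ∀ a : {p : ℂ × ℂ // p.1 ≠ p.2}, a.1.1 - a.1.2 ≠ 0 := fun a => sub_ne_zero.2 a.2
  have hq : Continuous q := by
    refine Continuous.div (Continuous.sub ?_ ?_) (by fun_prop) fun p => hd p.2
    · exact hF.comp (f := fun p : I × {p : ℂ × ℂ // p.1 ≠ p.2} => ((p.1 : ℝ), p.2.1.1))
        (by fun_prop)
    · exact hF.comp (f := fun p : I × {p : ℂ × ℂ // p.1 ≠ p.2} => ((p.1 : ℝ), p.2.1.2))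
        (by fun_prop)
  obtain ⟨Q, hQ, hQe, hQ0⟩ := exists_log_homotopy_s1 (q := q) (f := fun _ => 0)
    hq
    (fun p => div_ne_zero (sub_ne_zero.2 fun h => p.2.2 (hinj _ h)) (hd p.2)) continuous_const
    (fun a => by simp [q, h0, div_self (hd a)])
  have hsymm : ∀ x y (hxy : x ≠ y), Q (1, ⟨(x, y), hxy⟩) = Q (1, ⟨(y, x), hxy.symm⟩) := by
    intro x y hxy
    have := isPreconnected_univ.eq_of_exp_eq_one
      (g := fun t : I => Q (t, ⟨(x, y), hxy⟩) - Q (t, ⟨(y, x), hxy.symm⟩)) (by fun_prop)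
      (fun t _ => by
        rw [Complex.exp_sub, hQe, hQe]
        have h1 := sub_ne_zero.2 hxy
        have h2 : F t x - F t y ≠ 0 := sub_ne_zero.2 fun h => hxy (hinj _ h)
        simp only [q]
        rw [← neg_sub (F t x), ← neg_sub x, neg_div_neg_eq]
        exact div_self (div_ne_zero h2 h1)) (mem_univ 1) (mem_univ 0)
    simp only [hQ0, sub_self] at this
    exact sub_eq_zero.1 this
  classical
  refine ⟨fun p => if hp : p.1 ≠ p.2 then Q (1, ⟨p, hp⟩) else 0, ?_, ?_, ?_⟩
  · rw [continuousOn_iff_continuous_domRestrict]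
    have : Continuous fun p : {p : ℂ × ℂ // p.1 ≠ p.2} => Q (1, p) := by fun_prop
    refine this.congr fun p => ?_
    rw [domRestrict_apply, dif_pos p.2]
  · intro x y hxy
    simp only [dif_pos hxy, hQe, q]
    simp
  · intro x y
    by_cases hxy : x = y
    · rw [hxy]
    · have hyx : y ≠ x := fun h => hxy h.symm
      simp only [ne_eq, hxy, hyx, not_false_eq_true, dite_true, hsymm x y hxy]

/-- Two planar continua whose union does not separate the plane have connected intersection. -/
theorem isPreconnected_inter_of_union {X Y : Set ℂ} (hX : IsCompact X) (hXc : IsPreconnected X)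
    (hY : IsCompact Y) (hYc : IsPreconnected Y) (hXY : IsPreconnected (X ∪ Y)ᶜ) :
    IsPreconnected (X ∩ Y) := by
  rw [isPreconnected_closed_iff]
  rintro t t' ht ht' hcov ⟨a, haXY, hat⟩ ⟨b, hbXY, hbt'⟩
  by_contra hemp
  have hcl := hX.isClosed.inter hY.isClosed
  obtain ⟨u, hu0, hu1, -⟩ := exists_continuous_zero_one_of_isClosed (hcl.inter ht) (hcl.inter ht')
    (by
      rw [Set.disjoint_left]
      intro z hz hz'
      exact hemp ⟨z, hz.1, hz.2, hz'.2⟩)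
  classical
  let f : ℂ → ℂ := fun z => if z ∈ X then Complex.exp (Real.pi * u z * Complex.I)
    else Complex.exp (-(Real.pi * u z * Complex.I))
  have e1 : ∀ z ∈ X, f z = Complex.exp (Real.pi * u z * Complex.I) := fun z hz => if_pos hz
  have e2 : ∀ z ∈ Y, f z = Complex.exp (-(Real.pi * u z * Complex.I)) := fun z hz => by
    by_cases hzX : z ∈ X
    · rw [e1 z hzX]
      rcases hcov ⟨hzX, hz⟩ with h1 | h1
      · have : u z = 0 := hu0 ⟨⟨hzX, hz⟩, h1⟩
        simp [this]
      · have : u z = 1 := hu1 ⟨⟨hzX, hz⟩, h1⟩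
        simp [this, Complex.exp_neg]
    · exact if_neg hzX
  obtain ⟨l, hl, hle⟩ := (hX.union hY).hasLogOn hXY (f := f)
    ((ContinuousOn.congr (by fun_prop) e1).union_of_isClosed (ContinuousOn.congr (by fun_prop) e2)
      hX.isClosed hY.isClosed)
    (fun z _ => by
      simp only [f]
      split_ifs <;> exact Complex.exp_ne_zero _)
  have hcX : l a - Real.pi * u a * Complex.I = l b - Real.pi * u b * Complex.I :=
    hXc.eq_of_exp_eq_one (g := fun z => l z - Real.pi * u z * Complex.I)
      ((hl.mono subset_union_left).sub (by fun_prop))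
      (fun z hz => by
        rw [Complex.exp_sub, hle z (Or.inl hz), e1 z hz]
        exact div_self (Complex.exp_ne_zero _)) haXY.1 hbXY.1
  have hcY : l a + Real.pi * u a * Complex.I = l b + Real.pi * u b * Complex.I :=
    hYc.eq_of_exp_eq_one (g := fun z => l z + Real.pi * u z * Complex.I)
      ((hl.mono subset_union_right).add (by fun_prop))
      (fun z hz => by
        rw [Complex.exp_add, hle z (Or.inr hz), e2 z hz, ← Complex.exp_add, neg_add_cancel,
          Complex.exp_zero]) haXY.2 hbXY.2
  have hua : u a = 0 := hu0 ⟨haXY, hat⟩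
  have hub : u b = 1 := hu1 ⟨hbXY, hbt'⟩
  rw [hua, hub] at hcX hcY
  push_cast at hcX hcY
  have : (Real.pi : ℂ) * Complex.I = 0 := by linear_combination (hcX - hcY) / 2
  simp [Real.pi_ne_zero] at this

theorem HasLogOn.exists_isOpen {K : Set ℂ} {f : ℂ → ℂ} (hf : HasLogOn f K) (hK : IsClosed K)
    (hfc : Continuous f) : ∃ W, IsOpen W ∧ K ⊆ W ∧ HasLogOn f W := by
  obtain ⟨l, hl, hle⟩ := hf
  obtain ⟨m, hm, hml⟩ := exists_continuous_extension hK hl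
  refine ⟨{z | f z * Complex.exp (-m z) ∈ Complex.slitPlane},
    Complex.isOpen_slitPlane.preimage (by fun_prop), fun z hz => ?_, ?_⟩
  · rw [mem_ofPred_eq, hml z hz, ← hle z hz, ← Complex.exp_add, add_neg_cancel, Complex.exp_zero]
    exact Complex.one_mem_slitPlane
  · refine ((hasLogOn_of_mem_slitPlane (f := fun z => f z * Complex.exp (-m z)) (by fun_prop)
      fun z hz => hz).mul (g := fun z => Complex.exp (m z))
      ⟨m, hm.continuousOn, fun z _ => rfl⟩).congr fun z _ => ?_
    rw [mul_assoc, ← Complex.exp_add, neg_add_cancel, Complex.exp_zero, mul_one]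

theorem exists_fixed_point_of_isotopic {h : ℂ ≃ₜ ℂ} {F : ℝ → ℂ → ℂ}
    (hF : Continuous fun q : ℝ × ℂ => F q.1 q.2) (hinj : ∀ t, Function.Injective (F t))
    (hF0 : F 0 = id) (hF1 : F 1 = h) {C : Set ℂ} (hC : IsCompact C) (hCc : IsPreconnected C)
    (hacyc : IsPreconnected (h ⁻¹' C ∪ C)ᶜ) {c : ℂ} {k : ℕ} (hk : 1 ≤ k) (hkc : h^[k] c = c)
    (hcC : ∀ i, h^[i] c ∈ C) : ∃ x ∈ C, h x = x := by
  by_contra! hfix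
  have hhC : IsCompact (h ⁻¹' C) := h.isCompact_preimage.2 hC
  have hhCc : IsPreconnected (h ⁻¹' C) := h.isPreconnected_preimage.2 hCc
  have hK := hhC.union hC
  have hlog : HasLogOn (fun x => h x - x) (h ⁻¹' C ∪ C) := by
    refine hK.hasLogOn hacyc (by fun_prop) fun z hz => sub_ne_zero.2 ?_
    rcases hz with hz | hz
    · exact fun h0 => hfix _ hz (congrArg h h0)
    · exact hfix z hz
  obtain ⟨W, hW, hKW, hlogW⟩ := hlog.exists_isOpen hK.isClosed (by fun_prop)
  have hinter := isPreconnected_inter_of_union hhC hhCc hC hCc hacyc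
  have hcc : c ∈ C := hcC 0
  set U := connectedComponentIn (W ∩ h.symm ⁻¹' W) c
  have hU : IsOpen U := (hW.inter (hW.preimage h.symm.continuous)).connectedComponentIn
  have hCU : C ⊆ U := hCc.subset_connectedComponentIn hcc fun x hx =>
    ⟨hKW (Or.inr hx), hKW (Or.inl (by simpa using hx))⟩
  have hUW : U ⊆ W ∩ h.symm ⁻¹' W := connectedComponentIn_subset _ _
  have hV : IsPreconnected (h ⁻¹' U) :=
    h.isPreconnected_preimage.2 isPreconnected_connectedComponentIn
  have hadm : Admissible U (h ⁻¹' U) h := by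
    refine ⟨fun x => Iff.rfl, hlogW.mono ?_, ?_⟩
    · rintro x (hx | hx)
      · simpa using (hUW hx).2
      · exact (hUW hx).1
    · rw [← hF1]
      exact exists_symm_log_ratio hF hinj hF0
  set Y := connectedComponentIn (U ∩ h ⁻¹' U) c
  have hsub : h ⁻¹' C ∩ C ⊆ U ∩ h ⁻¹' U := fun x hx => ⟨hCU hx.2, hCU hx.1⟩
  have horb : ∀ i, h^[i] c ∈ h ⁻¹' C ∩ C := fun i =>
    ⟨by rw [mem_preimage, ← Function.iterate_succ_apply' h]; exact hcC _, hcC i⟩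
  have hAY : h ⁻¹' C ∩ C ⊆ Y := hinter.subset_connectedComponentIn (horb 0) hsub
  have hYo : IsOpen Y := (hU.inter (hU.preimage h.continuous)).connectedComponentIn
  have hYp : IsPathConnected Y := by
    rw [← hYo.isConnected_iff_isPathConnected]
    exact isConnected_connectedComponentIn_iff.2 (hsub (horb 0))
  have hYsub : Y ⊆ U ∩ h ⁻¹' U := connectedComponentIn_subset _ _
  exact Admissible.no_periodic_orbit hU hV hYp (fun x hx => (hYsub hx).1)
    (fun x hx => (hYsub hx).2) k hk hadm hkc fun i => hAY (horb i)

end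

/-- If `h` is an orientation preserving planar homeomorphism and `C` a
continuum with `h⁻¹(C) ∪ C` acyclic which contains a periodic orbit of `h`
(there are `c ∈ C` and `k ≥ 1` with `hᵏ(c) = c` and `hⁱ(c) ∈ C` for all `i`),
then `C` contains a fixed point of `h`. -/
theorem fixed_point_of_periodic_orbit_in_continuum
    (h : (ℝ × ℝ) ≃ₜ (ℝ × ℝ)) (hor : IsotopicToIdentity h)
    (C : Set (ℝ × ℝ)) (hC : IsContinuum C)
    (hacyc : IsAcyclic (⇑h ⁻¹' C ∪ C))
    (hper : ∃ c ∈ C, ∃ k : ℕ, 1 ≤ k ∧ (⇑h)^[k] c = c ∧ ∀ i : ℕ, (⇑h)^[i] c ∈ C) :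
    ∃ x ∈ C, h x = x := by
  obtain ⟨F, hF, hFh, hF0, hF1⟩ := hor
  obtain ⟨c, -, k, hk, hkc, hcC⟩ := hper
  let e : ℂ ≃ₜ ℝ × ℝ := Complex.equivRealProdCLM.toHomeomorph
  let g : ℂ ≃ₜ ℂ := (e.trans h).trans e.symm
  have hg : ∀ z, g z = e.symm (h (e z)) := fun _ => rfl
  have hiter : ∀ i, g^[i] (e.symm c) = e.symm (h^[i] c) := fun i => by
    induction i with
    | zero => rfl
    | succ i ih =>
      rw [Function.iterate_succ_apply', ih, hg, e.apply_symm_apply,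
        ← Function.iterate_succ_apply' h]
  have hpre : (g ⁻¹' (e ⁻¹' C) ∪ e ⁻¹' C)ᶜ = e ⁻¹' (h ⁻¹' C ∪ C)ᶜ := by
    ext z
    simp [hg]
  obtain ⟨x, hx, hgx⟩ := exists_fixed_point_of_isotopic (h := g)
    (F := fun t z => e.symm (F t (e z))) (C := e ⁻¹' C) (c := e.symm c)
    (e.symm.continuous.comp (hF.comp (continuous_fst.prodMk (e.continuous.comp continuous_snd))))
    (fun t => by
      obtain ⟨f, hf⟩ := hFh t
      rw [← hf]
      exact e.symm.injective.comp (f.injective.comp e.injective))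
    (by ext1 z; simp [hF0]) (by ext1 z; simp [hF1, hg]) (e.isCompact_preimage.2 hC.1)
    (e.isPreconnected_preimage.2 hC.2.1.isPreconnected)
    (by rw [hpre]; exact e.isPreconnected_preimage.2 hacyc.isPreconnected) hk
    (by rw [hiter, hkc]) (fun i => by rw [hiter]; simpa using hcC i)
  refine ⟨e x, hx, ?_⟩
  rw [hg] at hgx
  rw [← e.apply_symm_apply (h (e x)), hgx]
end
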